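/- Let n ≥ 3, ℓ ≥ 2 and m₁, m₂ ≥ 1 be integers with m₁ < n−1, m₂ < n−1 and ℓ·(m₁+m₂) = 2(n−1). Set p = (n+2)/(n−2), λ = n(n−2)/(4ℓ²) and h(r) = ((m₁+m₂)/2)·cos r − (m₂−m₁)/2. Then for every positive integer k there exists a C² function w_k : [0,π] → ℝ satisfying w_k''(r) + (h(r)/sin r)·w_k'(r) + λ·(|w_k(r)|^{p−1}·w_k(r) − w_k(r)) = 0 for all r ∈ (0,π), with w_k'(0) = 0 and w_k'(π) = 0, such that w_k has exactly k zeroes in [0,π]. -/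

import Mathlib

namespace SphODE
section Part1
open Set Filter Topology

lemma mono_aux {f : ℝ → ℝ} {a b : ℝ} (hab : a ≤ b) (hc : ContinuousOn f (Icc a b))
    (hd : ∀ x ∈ Ioo a b, ∃ d, 0 ≤ d ∧ HasDerivAt f d x) : f a ≤ f b := by
  have : MonotoneOn f (Icc a b) := by
    apply monotoneOn_of_deriv_nonneg (convex_Icc a b) hc
    · intro x hx
      rw [interior_Icc] at hx
      obtain ⟨d, _, h⟩ := hd x hx
      exact h.differentiableAt.differentiableWithinAt
    · intro x hx
      rw [interior_Icc] at hx
      obtain ⟨d, h0, h⟩ := hd x hx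
      rwa [h.deriv]
  exact this (left_mem_Icc.2 hab) (right_mem_Icc.2 hab) hab

/-- version with derivative on the closed interval -/
lemma mono_aux' {f : ℝ → ℝ} {a b : ℝ} (hab : a ≤ b)
    (hd : ∀ x ∈ Icc a b, ∃ d, 0 ≤ d ∧ HasDerivAt f d x) : f a ≤ f b := by
  apply mono_aux hab
  · intro x hx
    obtain ⟨d, _, h⟩ := hd x hx
    exact h.continuousAt.continuousWithinAt
  · intro x hx
    exact hd x (Ioo_subset_Icc_self hx)

noncomputable def ff (p x : ℝ) : ℝ := |x| ^ (p - 1) * x - x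
noncomputable def FF (p x : ℝ) : ℝ := |x| ^ (p + 1) / (p + 1) - x ^ 2 / 2
noncomputable def om (m m' : ℕ) (r : ℝ) : ℝ := Real.sin (r / 2) ^ m * Real.cos (r / 2) ^ m'
noncomputable def BB (m m' : ℕ) (r : ℝ) : ℝ :=
  (m / 2) * (Real.cos (r / 2) / Real.sin (r / 2)) - (m' / 2) * (Real.sin (r / 2) / Real.cos (r / 2))

def Sol (m m' : ℕ) (lam p : ℝ) (w v : ℝ → ℝ) : Prop :=
  ∀ s ∈ Ioo 0 Real.pi, HasDerivAt w (v s) s ∧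
    HasDerivAt v (-(BB m m' s * v s) - lam * ff p (w s)) s

lemma FF_deriv {p : ℝ} (hp : 1 < p) (x : ℝ) : HasDerivAt (FF p) (ff p x) x := by
  have h1 := (hasDerivAt_abs_rpow x (p := p + 1) (by linarith)).div_const (p + 1)
  have h2 := ((hasDerivAt_pow 2 x).div_const 2)
  have := h1.sub h2
  refine this.congr_deriv ?_
  unfold ff
  rw [show p + 1 - 2 = p - 1 by ring]
  have : p + 1 ≠ 0 := by linarith
  field_simp
  norm_num
  ring

lemma mul_ff {p : ℝ} (hp : 1 < p) (x : ℝ) : x * ff p x = |x| ^ (p + 1) - x ^ 2 := by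
  unfold ff
  rw [show p + 1 = (p - 1) + 2 by ring, Real.rpow_add_of_nonneg (abs_nonneg x) (by linarith) (by norm_num)]
  rw [Real.rpow_two, sq_abs]; ring

lemma ff_cont {p : ℝ} (hp : 1 < p) : Continuous (ff p) := by
  unfold ff
  apply Continuous.sub _ continuous_id
  apply Continuous.mul _ continuous_id
  exact continuous_abs.rpow_const (fun x => Or.inr (by linarith))

lemma ff_neg (p x : ℝ) : ff p (-x) = - ff p x := by
  unfold ff; rw [abs_neg]; ring

lemma FF_neg (p x : ℝ) : FF p (-x) = FF p x := by
  unfold FF; rw [abs_neg]; ring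

lemma ff_zero (p : ℝ) : ff p 0 = 0 := by simp [ff]
lemma ff_one (p : ℝ) : ff p 1 = 0 := by simp [ff]
lemma FF_zero {p : ℝ} (hp : 1 < p) : FF p 0 = 0 := by
  simp [FF]; left; rw [Real.zero_rpow]; linarith

lemma young {p η : ℝ} (hp : 1 < p) (hη : 0 < η) : ∃ C > 0, ∀ x : ℝ, x ^ 2 ≤ η * |x| ^ (p + 1) + C := by
  refine ⟨((1 / η) ^ (1 / (p - 1))) ^ 2, by positivity, fun x => ?_⟩
  by_cases h : 1 / η ≤ |x| ^ (p - 1)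
  · rw [show p + 1 = (p - 1) + 2 by ring, Real.rpow_add_of_nonneg (abs_nonneg x) (by linarith) (by norm_num)]
    rw [Real.rpow_two, sq_abs]
    have h1 : 1 ≤ η * |x| ^ (p - 1) := by
      rw [div_le_iff₀ hη] at h; linarith
    have := mul_le_mul_of_nonneg_right h1 (sq_nonneg x)
    nlinarith [sq_nonneg ((1 / η) ^ (1 / (p - 1)))]
  · push Not at h
    have h1 : |x| ≤ (1 / η) ^ (1 / (p - 1)) := by
      have := Real.rpow_le_rpow (Real.rpow_nonneg (abs_nonneg x) _) h.le (z := 1 / (p - 1)) (by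
        apply div_nonneg <;> linarith)
      rwa [← Real.rpow_mul (abs_nonneg x), mul_one_div_cancel (by linarith), Real.rpow_one] at this
    have h2 : x ^ 2 ≤ ((1 / η) ^ (1 / (p - 1))) ^ 2 := by
      rw [← sq_abs]; gcongr
    have : 0 ≤ η * |x| ^ (p + 1) := by positivity
    linarith

lemma FF_lower {p : ℝ} (hp : 1 < p) : ∃ C > 0, ∀ x : ℝ, |x| ^ (p + 1) / (2 * (p + 1)) - C ≤ FF p x := by
  obtain ⟨C, hC, h⟩ := young hp (η := 1 / (p + 1)) (by apply one_div_pos.2; linarith)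
  refine ⟨C / 2, by linarith, fun x => ?_⟩
  have := h x
  unfold FF
  have h1 : |x| ^ (p + 1) / (2 * (p + 1)) = (1 / (p + 1) * |x| ^ (p + 1)) / 2 := by
    have : p + 1 ≠ 0 := by linarith
    field_simp
  have h2 : |x| ^ (p + 1) / (p + 1) = 1 / (p + 1) * |x| ^ (p + 1) := by ring
  rw [h1, h2]; linarith

lemma ff_abs_le {p : ℝ} (hp : 1 < p) (x : ℝ) : |ff p x| ≤ |x| ^ p + |x| := by
  unfold ff
  have : |x| ^ p = |x| ^ (p - 1) * |x| := by
    have := Real.rpow_add_of_nonneg (abs_nonneg x) (y := p - 1) (z := 1) (by linarith) (by norm_num)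
    rw [Real.rpow_one] at this
    rw [← this, sub_add_cancel]
  rw [this]
  calc _ ≤ |(|x| ^ (p - 1) * x)| + |x| := abs_sub _ _
    _ = _ := by rw [abs_mul, abs_of_nonneg (Real.rpow_nonneg (abs_nonneg x) _)]

lemma ff_hasDeriv {p : ℝ} (hp : 1 < p) (x : ℝ) : HasDerivAt (ff p) (p * |x| ^ (p - 1) - 1) x := by
  have key : HasDerivAt (fun x : ℝ => |x| ^ (p - 1) * x) (p * |x| ^ (p - 1)) x := by
    rcases lt_trichotomy x 0 with h | h | h
    · have h1 : HasDerivAt (fun y : ℝ => -((-y) ^ p)) (p * (-x) ^ (p - 1)) x := by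
        have := ((hasDerivAt_neg x).rpow_const (p := p) (Or.inr hp.le)).neg
        exact this.congr_deriv (by ring)
      rw [abs_of_neg h]
      apply h1.congr_of_eventuallyEq
      filter_upwards [Iio_mem_nhds h] with y hy
      have hy : y < 0 := hy
      rw [abs_of_neg hy]
      have := Real.rpow_add (x := -y) (by linarith) (p - 1) 1
      rw [Real.rpow_one, sub_add_cancel] at this
      rw [this]; ring
    · subst h
      rw [abs_zero, Real.zero_rpow (by linarith), mul_zero]
      rw [hasDerivAt_iff_tendsto_slope]
      have hc : ContinuousAt (fun y : ℝ => |y| ^ (p - 1)) 0 :=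
        (continuous_abs.rpow_const (fun x => Or.inr (by linarith))).continuousAt
      have hc' : Tendsto (fun y : ℝ => |y| ^ (p - 1)) (𝓝[≠] 0) (𝓝 0) := by
        have := hc.tendsto
        simp only [abs_zero] at this
        rw [Real.zero_rpow (by linarith)] at this
        exact this.mono_left nhdsWithin_le_nhds
      apply hc'.congr'
      filter_upwards [self_mem_nhdsWithin] with y hy
      have hy : y ≠ 0 := hy
      rw [slope_def_field]
      simp
      field_simp
    · have h1 : HasDerivAt (fun y : ℝ => y ^ p) (p * x ^ (p - 1)) x := by
        have := (hasDerivAt_id x).rpow_const (p := p) (Or.inr hp.le)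
        simpa using this
      rw [abs_of_pos h]
      apply h1.congr_of_eventuallyEq
      filter_upwards [Ioi_mem_nhds h] with y hy
      have hy : 0 < y := hy
      rw [abs_of_pos hy]
      have := Real.rpow_add (x := y) hy (p - 1) 1
      rw [Real.rpow_one, sub_add_cancel] at this
      rw [this]
  exact key.sub (hasDerivAt_id x)

lemma ff_lip {p : ℝ} (hp : 1 < p) {M : ℝ} (hM : 0 < M) : ∃ L > 0, ∀ x ∈ Icc (-M) M, ∀ y ∈ Icc (-M) M,
    |ff p x - ff p y| ≤ L * |x - y| := by
  refine ⟨p * M ^ (p - 1) + 1, by positivity, fun x hx y hy => ?_⟩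
  have := (convex_Icc (-M) M).norm_image_sub_le_of_norm_hasDerivWithin_le (f := ff p)
    (f' := fun x => p * |x| ^ (p - 1) - 1) (C := p * M ^ (p - 1) + 1)
    (fun x _ => (ff_hasDeriv hp x).hasDerivWithinAt) (fun x hx => ?_) hy hx
  · simpa [Real.norm_eq_abs] using this
  · have h1 : |x| ≤ M := abs_le.2 hx
    have h2 : |x| ^ (p - 1) ≤ M ^ (p - 1) := Real.rpow_le_rpow (abs_nonneg _) h1 (by linarith)
    have h3 : 0 ≤ |x| ^ (p - 1) := by positivity
    rw [Real.norm_eq_abs, abs_le]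
    constructor <;> nlinarith

lemma half_facts {r : ℝ} (hr : r ∈ Ioo 0 Real.pi) : 0 < Real.sin (r / 2) ∧ 0 < Real.cos (r / 2) := by
  constructor
  · apply Real.sin_pos_of_pos_of_lt_pi <;> linarith [hr.1, hr.2, Real.pi_pos]
  · apply Real.cos_pos_of_mem_Ioo; constructor <;> linarith [hr.1, hr.2, Real.pi_pos]

lemma om_pos (m m' : ℕ) {r : ℝ} (hr : r ∈ Ioo 0 Real.pi) : 0 < om m m' r := by
  have := half_facts hr
  unfold om; exact mul_pos (pow_pos this.1 _) (pow_pos this.2 _)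

lemma om_cont (m m' : ℕ) : Continuous (om m m') := by unfold om; fun_prop

lemma om_deriv (m m' : ℕ) {r : ℝ} (hr : r ∈ Ioo 0 Real.pi) :
    HasDerivAt (om m m') (BB m m' r * om m m' r) r := by
  obtain ⟨h1, h2⟩ := half_facts hr
  have d : HasDerivAt (fun r : ℝ => r / 2) (1 / 2) r := (hasDerivAt_id r).div_const 2
  have hs := ((Real.hasDerivAt_sin (r / 2)).comp r d).pow m
  have hc := ((Real.hasDerivAt_cos (r / 2)).comp r d).pow m'
  have := hs.mul hc
  refine this.congr_deriv ?_
  simp only [om, BB, Function.comp, Pi.pow_apply]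
  have e1 : ∀ (k : ℕ) (x : ℝ), x ≠ 0 → (k : ℝ) * x ^ (k - 1) = k * x ^ k / x := by
    intro k x hx
    rcases k with _ | k
    · simp
    · rw [pow_succ]; field_simp; simp
  rw [e1 m _ h1.ne', e1 m' _ h2.ne']
  field_simp
  ring

lemma half_facts1 {r : ℝ} (h0 : 0 < r) (h1 : r ≤ 1) :
    r / 4 ≤ Real.sin (r / 2) ∧ Real.sin (r / 2) ≤ r / 2 ∧ 1 - r ^ 2 / 8 ≤ Real.cos (r / 2) ∧
      Real.cos (r / 2) ≤ 1 := by
  have hp := Real.pi_gt_three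
  have hp4 := Real.pi_le_four
  refine ⟨?_, Real.sin_le (by linarith), ?_, Real.cos_le_one _⟩
  · have := Real.mul_le_sin (x := r / 2) (by linarith) (by linarith)
    have h2 : 1 / 2 ≤ 2 / Real.pi := by
      rw [div_le_div_iff₀ (by norm_num) Real.pi_pos]; linarith
    nlinarith
  · have := Real.one_sub_sq_div_two_le_cos (x := r / 2)
    linarith

lemma BB_bound (m m' : ℕ) : ∃ C > 0, ∀ r ∈ Ioc (0 : ℝ) 1, |BB m m' r - m / r| ≤ C := by
  refine ⟨m + m' + 1, by positivity, fun r hr => ?_⟩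
  obtain ⟨h1, h2, h3, h4⟩ := half_facts1 hr.1 hr.2
  have hr0 := hr.1
  have hr1 := hr.2
  have hs : 0 < Real.sin (r / 2) := by linarith
  have hc : 7 / 8 ≤ Real.cos (r / 2) := by nlinarith
  set S := Real.sin (r / 2) with hS
  set c := Real.cos (r / 2) with hcdef
  have hlow : r / 2 * c ≤ S := by
    have := Real.le_tan (x := r / 2) (by linarith) (by linarith [Real.pi_gt_three])
    rwa [Real.tan_eq_sin_div_cos, le_div_iff₀ (by linarith)] at this
  have e1 : |c / S / 2 - 1 / r| ≤ 1 := by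
    have : c / S / 2 - 1 / r = (r * c - 2 * S) / (2 * r * S) := by field_simp
    rw [this, abs_div, abs_of_pos (a := 2 * r * S) (by positivity), div_le_one (by positivity)]
    rw [abs_le]; constructor <;> nlinarith [mul_pos hr0 hs]
  have e2 : |S / c / 2| ≤ 1 := by
    rw [abs_of_pos (by positivity), div_div, div_le_one (by positivity)]
    nlinarith
  have : BB m m' r - m / r = m * (c / S / 2 - 1 / r) - m' * (S / c / 2) := by
    unfold BB; rw [← hS, ← hcdef]; ring
  rw [this]
  calc _ ≤ |m * (c / S / 2 - 1 / r)| + |m' * (S / c / 2)| := abs_sub _ _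
    _ = m * |c / S / 2 - 1 / r| + m' * |S / c / 2| := by rw [abs_mul, abs_mul]; simp
    _ ≤ m * 1 + m' * 1 := by gcongr
    _ ≤ _ := by linarith

lemma om_bound (m m' : ℕ) : ∃ c > 0, ∀ r ∈ Ioc (0 : ℝ) 1, c * r ^ m ≤ om m m' r ∧ om m m' r ≤ r ^ m := by
  refine ⟨(1 / 4) ^ m * (7 / 8) ^ m', by positivity, fun r hr => ?_⟩
  obtain ⟨h1, h2, h3, h4⟩ := half_facts1 hr.1 hr.2
  have hr0 := hr.1
  have hr1 := hr.2
  have hs : 0 < Real.sin (r / 2) := by linarith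
  have hc : 7 / 8 ≤ Real.cos (r / 2) := by nlinarith
  unfold om
  constructor
  · have : (1 / 4 : ℝ) ^ m * (7 / 8) ^ m' * r ^ m = (r / 4) ^ m * (7 / 8) ^ m' := by
      rw [div_pow r, div_pow 1, one_pow]; ring
    rw [this]; gcongr
  · have e1 : Real.sin (r / 2) ^ m ≤ r ^ m := pow_le_pow_left₀ hs.le (by linarith) m
    have e2 : Real.cos (r / 2) ^ m' ≤ 1 := pow_le_one₀ (by linarith) h4
    calc _ ≤ r ^ m * 1 := by gcongr
      _ = _ := by ring

lemma BB_refl (m m' : ℕ) (r : ℝ) : BB m' m (Real.pi - r) = - BB m m' r := by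
  unfold BB
  rw [show (Real.pi - r) / 2 = Real.pi / 2 - r / 2 by ring, Real.sin_pi_div_two_sub, Real.cos_pi_div_two_sub]
  ring

lemma Sol.refl {m m' : ℕ} {lam p : ℝ} {w v : ℝ → ℝ} (h : Sol m m' lam p w v) :
    Sol m' m lam p (fun s => w (Real.pi - s)) (fun s => - v (Real.pi - s)) := by
  intro s hs
  obtain ⟨h1, h2⟩ := h (Real.pi - s) ⟨by linarith [hs.2], by linarith [hs.1]⟩
  have d : HasDerivAt (fun s : ℝ => Real.pi - s) (-1) s := by
    simpa using (hasDerivAt_id s).const_sub Real.pi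
  constructor
  · have := h1.comp s d
    exact this.congr_deriv (by ring)
  · have := (h2.comp s d).neg
    refine this.congr_deriv ?_
    have : BB m' m s = - BB m m' (Real.pi - s) := by
      rw [← BB_refl, sub_sub_cancel]
    rw [this]; ring

lemma Sol.neg {m m' : ℕ} {lam p : ℝ} {w v : ℝ → ℝ} (h : Sol m m' lam p w v) :
    Sol m m' lam p (fun s => - w s) (fun s => - v s) := by
  intro s hs
  obtain ⟨h1, h2⟩ := h s hs
  refine ⟨h1.neg, ?_⟩
  refine h2.neg.congr_deriv ?_
  rw [ff_neg]; ring

end Part1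
end SphODE

namespace SphODE
section Part2
open Set Filter Topology

noncomputable def PP (m : ℕ) (lam p θ : ℝ) (w v : ℝ → ℝ) (s : ℝ) : ℝ :=
  s ^ (m + 1) * (v s ^ 2 / 2 + lam * FF p (w s)) + θ * s ^ m * (w s * v s)

structure Good (m m' : ℕ) (lam p θ s1 δ C : ℝ) : Prop where
  s1pos : 0 < s1
  s1le : s1 ≤ 1
  δpos : 0 < δ
  Cpos : 0 < C
  mono : ∀ w v, Sol m m' lam p w v → ∀ s ∈ Ioc 0 s1, ∃ d, HasDerivAt (PP m lam p θ w v) d s ∧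
    s ^ m * (δ * (v s ^ 2 + |w s| ^ (p + 1)) - C) ≤ d
  Bpos : ∀ s ∈ Ioc 0 s1, 0 ≤ BB m m' s

lemma Ioc_sub {s1 s : ℝ} (h1 : s1 ≤ 1) (hs : s ∈ Ioc 0 s1) : s ∈ Ioo 0 Real.pi :=
  ⟨hs.1, by linarith [hs.2, Real.pi_gt_three]⟩

lemma exists_good (m m' : ℕ) (hm : 1 ≤ m) {lam p θ : ℝ} (hp : 1 < p) (hlam : 0 < lam)
    (h1 : ((m : ℝ) - 1) / 2 < θ) (h2 : θ < (m + 1) / (p + 1)) :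
    ∃ s1 δ C, Good m m' lam p θ s1 δ C := by
  obtain ⟨Cb, hCb, hB⟩ := BB_bound m m'
  set d1 := θ - ((m : ℝ) - 1) / 2 with hd1
  set d2 := (m + 1) / (p + 1) - θ with hd2
  have d1pos : 0 < d1 := by linarith
  have d2pos : 0 < d2 := by linarith
  set κ := lam * |((m : ℝ) + 1) / 2 - θ| + θ ^ 2 * Cb ^ 2 / d1 + 1 with hκ
  have κpos : 0 < κ := by positivity
  obtain ⟨Y, hY, hyoung⟩ := young hp (η := lam * d2 / (2 * κ)) (by positivity)
  have hm' : (1 : ℝ) ≤ m := by exact_mod_cast hm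
  refine ⟨min 1 (min (d1 / (4 * Cb)) (1 / Cb)), min (d1 / 2) (lam * d2 / 2), κ * Y, ?_, ?_, ?_, ?_, ?_, ?_⟩
  · positivity
  · exact min_le_left _ _
  · positivity
  · positivity
  · intro w v hsol s hs
    have hs1 : s ≤ 1 := hs.2.trans (min_le_left _ _)
    have hs2 : s ≤ d1 / (4 * Cb) := hs.2.trans ((min_le_right _ _).trans (min_le_left _ _))
    have hs0 : 0 < s := hs.1
    obtain ⟨hw, hv⟩ := hsol s (Ioc_sub (min_le_left _ _) hs)
    have hF := (FF_deriv hp (w s)).comp s hw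
    have hd := ((hasDerivAt_pow (m + 1) s).mul (((hv.pow 2).div_const 2).add (hF.const_mul lam))).add
      (((hasDerivAt_pow m s).const_mul θ).mul (hw.mul hv))
    refine ⟨_, hd, ?_⟩
    set ε := BB m m' s - m / s with hε
    have hBε : BB m m' s = m / s + ε := by rw [hε]; ring
    have hεb : |ε| ≤ Cb := hB s ⟨hs0, hs1⟩
    have hwf := mul_ff hp (w s)
    set X := |w s| ^ (p + 1) with hX
    have hFF : FF p (w s) = X / (p + 1) - w s ^ 2 / 2 := rfl
    simp only [Function.comp, Pi.pow_apply, Pi.mul_apply, Pi.add_apply]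
    have hpow : s ^ m = s ^ (m - 1) * s := by
      rw [← pow_succ]; congr 1; omega
    have key : ∀ (D : ℝ), D = s ^ m * (d1 * v s ^ 2 + lam * d2 * X - lam * (((m : ℝ) + 1) / 2 - θ) * w s ^ 2
        - s * ε * v s ^ 2 - θ * ε * (w s * v s)) →
        s ^ m * (min (d1 / 2) (lam * d2 / 2) * (v s ^ 2 + X) - κ * Y) ≤ D := by
      intro D hD
      rw [hD]
      apply mul_le_mul_of_nonneg_left _ (by positivity)
      have hXnn : 0 ≤ X := by positivity
      have a1 : s * ε * v s ^ 2 ≤ d1 / 4 * v s ^ 2 := by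
        apply mul_le_mul_of_nonneg_right _ (sq_nonneg _)
        calc s * ε ≤ s * Cb := by
              apply mul_le_mul_of_nonneg_left _ hs0.le
              exact (le_abs_self _).trans hεb
          _ ≤ d1 / (4 * Cb) * Cb := by gcongr
          _ = d1 / 4 := by field_simp
      have a2 : θ * ε * (w s * v s) ≤ d1 / 4 * v s ^ 2 + θ ^ 2 * Cb ^ 2 / d1 * w s ^ 2 := by
        have e2 : ε ^ 2 ≤ Cb ^ 2 := by
          rw [← sq_abs]; gcongr
        have : θ * ε * (w s * v s) ≤ d1 / 4 * v s ^ 2 + θ ^ 2 * ε ^ 2 / d1 * w s ^ 2 := by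
          have := sq_nonneg (d1 / 2 * v s - θ * ε * w s)
          have h3 : d1 / 4 * v s ^ 2 + θ ^ 2 * ε ^ 2 / d1 * w s ^ 2 - θ * ε * (w s * v s)
            = (d1 / 2 * v s - θ * ε * w s) ^ 2 / d1 := by field_simp; ring
          have : 0 ≤ (d1 / 2 * v s - θ * ε * w s) ^ 2 / d1 := by positivity
          linarith
        have h4 : θ ^ 2 * ε ^ 2 / d1 * w s ^ 2 ≤ θ ^ 2 * Cb ^ 2 / d1 * w s ^ 2 := by gcongr
        linarith
      have a3 : lam * (((m : ℝ) + 1) / 2 - θ) * w s ^ 2 ≤ lam * |((m : ℝ) + 1) / 2 - θ| * w s ^ 2 := by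
        gcongr; exact le_abs_self _
      have a4 : κ * w s ^ 2 ≤ lam * d2 / 2 * X + κ * Y := by
        have := mul_le_mul_of_nonneg_left (hyoung (w s)) κpos.le
        have e : κ * (lam * d2 / (2 * κ) * X + Y) = lam * d2 / 2 * X + κ * Y := by field_simp
        linarith
      have a5 : κ * w s ^ 2 = lam * |((m : ℝ) + 1) / 2 - θ| * w s ^ 2 + θ ^ 2 * Cb ^ 2 / d1 * w s ^ 2 + w s ^ 2 := by
        rw [hκ]; ring
      have a6 : min (d1 / 2) (lam * d2 / 2) * (v s ^ 2 + X) ≤ d1 / 2 * v s ^ 2 + lam * d2 / 2 * X := by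
        rw [mul_add]
        gcongr
        · exact min_le_left _ _
        · exact min_le_right _ _
      nlinarith [sq_nonneg (w s)]
    apply key
    have hwf' : ff p (w s) * w s = X - w s ^ 2 := by rw [← hwf]; ring
    have e1 : (m + 1 - 1 : ℕ) = m := by omega
    have hpow1 : s ^ (m + 1) = s ^ (m - 1) * s * s := by rw [pow_succ, hpow]
    rw [hBε, hFF, e1, hpow1, hpow]
    have hp1 : p + 1 ≠ 0 := by linarith
    have e2 : lam * d2 * X = lam * (m + 1) * X / (p + 1) - θ * lam * (ff p (w s) * w s + w s ^ 2) := by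
      rw [hwf', hd2]; field_simp; ring
    rw [e2, hd1]
    push_cast
    field_simp
    ring
  · intro s hs
    have hs1 : s ≤ 1 := hs.2.trans (min_le_left _ _)
    have hs2 : s ≤ 1 / Cb := hs.2.trans ((min_le_right _ _).trans (min_le_right _ _))
    have := (abs_le.1 (hB s ⟨hs.1, hs1⟩)).1
    have h3 : Cb ≤ 1 / s := by rw [le_div_iff₀ hs.1]; rw [le_div_iff₀ hCb] at hs2; linarith
    have h4 : 1 / s ≤ m / s := by gcongr; exact hs.1.le
    linarith

variable {m m' : ℕ} {lam p θ s1 δ C : ℝ} {w v : ℝ → ℝ}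

lemma Good.mono2 (G : Good m m' lam p θ s1 δ C) (hw : Sol m m' lam p w v) {s t : ℝ} (hs : 0 < s) (hst : s ≤ t)
    (ht : t ≤ s1) : PP m lam p θ w v s + C * s ^ (m + 1) ≤ PP m lam p θ w v t + C * t ^ (m + 1) := by
  apply mono_aux' (f := fun s => PP m lam p θ w v s + C * s ^ (m + 1)) hst
  intro x hx
  have hx0 : 0 < x := by linarith [hx.1]
  obtain ⟨d, h1, h2⟩ := G.mono w v hw x ⟨hx0, hx.2.trans ht⟩
  refine ⟨_, ?_, h1.add ((hasDerivAt_pow (m + 1) x).const_mul C)⟩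
  have e1 : (m + 1 - 1 : ℕ) = m := by omega
  rw [e1]; push_cast
  have : 0 ≤ x ^ m * (δ * (v x ^ 2 + |w x| ^ (p + 1))) := by
    have := G.δpos; positivity
  have h3 : 0 ≤ C * (m * x ^ m) := by have := G.Cpos; positivity
  nlinarith

lemma Good.mono1 (G : Good m m' lam p θ s1 δ C) (hw : Sol m m' lam p w v) {s t : ℝ} (hs : 0 < s) (hst : s ≤ t)
    (ht : t ≤ s1) : PP m lam p θ w v s ≤ PP m lam p θ w v t + C := by
  have := G.mono2 hw hs hst ht
  have h1 : 0 ≤ C * s ^ (m + 1) := by have := G.Cpos; positivity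
  have h2 : C * t ^ (m + 1) ≤ C * 1 := by
    have := G.Cpos
    have : t ^ (m + 1) ≤ 1 := pow_le_one₀ (by linarith) (by linarith [G.s1le])
    gcongr
  linarith

/-- pointwise growth bound -/
lemma Good.growth (G : Good m m' lam p θ s1 δ C) (hm : 1 ≤ m) (hw : Sol m m' lam p w v) {σ t : ℝ} (hs : 0 < σ)
    (hst : σ ≤ t) (ht : t ≤ s1) :
    |w t - w σ| ≤ σ ^ (-((m : ℝ) / 2 - 1 / 4)) *
      ((PP m lam p θ w v t - PP m lam p θ w v σ + C) / (2 * δ) + 1) := by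
  set e := (m : ℝ) / 2 - 1 / 4 with he
  have hm' : (1 : ℝ) ≤ m := by exact_mod_cast hm
  have hepos : 0 < e := by linarith
  have hδ := G.δpos
  have hC := G.Cpos
  set A := σ ^ (-e) with hA
  have hApos : 0 < A := Real.rpow_pos_of_pos hs _
  have key : ∀ τ : ℝ, |τ| = 1 → τ * w t - τ * w σ ≥
      - (A * ((PP m lam p θ w v t - PP m lam p θ w v σ + C) / (2 * δ) + 1)) := by
    intro τ hτ
    have := mono_aux' (f := fun s => A / 2 * ((PP m lam p θ w v s + C * s ^ (m + 1)) / δ + 2 * s ^ (1 / 2 : ℝ))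
      + τ * w s) hst ?_
    · have h1 : 0 ≤ C * σ ^ (m + 1) := by positivity
      have h2 : C * t ^ (m + 1) ≤ C * 1 := by
        have : t ^ (m + 1) ≤ 1 := pow_le_one₀ (by linarith) (by linarith [G.s1le])
        gcongr
      have h3 : t ^ (1 / 2 : ℝ) ≤ 1 := Real.rpow_le_one (by linarith) (by linarith [G.s1le]) (by norm_num)
      have h4 : 0 ≤ σ ^ (1 / 2 : ℝ) := by positivity
      have e1 : A / 2 * ((PP m lam p θ w v t + C * t ^ (m + 1)) / δ + 2 * t ^ (1 / 2 : ℝ)) -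
          A / 2 * ((PP m lam p θ w v σ + C * σ ^ (m + 1)) / δ + 2 * σ ^ (1 / 2 : ℝ))
          ≤ A * ((PP m lam p θ w v t - PP m lam p θ w v σ + C) / (2 * δ) + 1) := by
        have : A / 2 * ((PP m lam p θ w v t + C * t ^ (m + 1)) / δ + 2 * t ^ (1 / 2 : ℝ)) -
          A / 2 * ((PP m lam p θ w v σ + C * σ ^ (m + 1)) / δ + 2 * σ ^ (1 / 2 : ℝ))
          = A * ((PP m lam p θ w v t - PP m lam p θ w v σ + (C * t ^ (m + 1) - C * σ ^ (m + 1))) / (2 * δ) +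
            (t ^ (1 / 2 : ℝ) - σ ^ (1 / 2 : ℝ))) := by field_simp; ring
        rw [this]
        gcongr
        · linarith
        · linarith
      linarith
    · intro s hs'
      have hs0 : 0 < s := by linarith [hs'.1]
      have hsm : s ∈ Ioc 0 s1 := ⟨hs0, hs'.2.trans ht⟩
      obtain ⟨d, h1, h2⟩ := G.mono w v hw s hsm
      have hwd := (hw s (Ioc_sub G.s1le hsm)).1
      have hr : HasDerivAt (fun s : ℝ => s ^ (1 / 2 : ℝ)) ((1 / 2) * s ^ ((1 / 2 : ℝ) - 1)) s :=
        Real.hasDerivAt_rpow_const (Or.inl hs0.ne')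
      refine ⟨_, ?_, (((h1.add ((hasDerivAt_pow (m + 1) s).const_mul C)).div_const δ).add
        (hr.const_mul 2)).const_mul (A / 2) |>.add (hwd.const_mul τ)⟩
      have e1 : (m + 1 - 1 : ℕ) = m := by omega
      rw [e1]; push_cast
      have h3 : s ^ m * v s ^ 2 ≤ (d + C * ((m + 1) * s ^ m)) / δ := by
        rw [le_div_iff₀ hδ]
        have : 0 ≤ s ^ m * (δ * |w s| ^ (p + 1)) := by positivity
        have h3 : 0 ≤ C * (m * s ^ m) := by positivity
        nlinarith
      have h4 : (1 : ℝ) ≤ A * s ^ e := by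
        rw [hA, Real.rpow_neg hs.le]
        rw [inv_mul_eq_div, one_le_div (by positivity)]
        exact Real.rpow_le_rpow hs.le hs'.1 hepos.le
      have h5 : s ^ e * s ^ e = s ^ m * s ^ ((1 / 2 : ℝ) - 1) := by
        rw [← Real.rpow_natCast s m, ← Real.rpow_add hs0, ← Real.rpow_add hs0]
        congr 1; rw [he]; ring
      set u := s ^ ((1 / 2 : ℝ) - 1) with hu
      have hupos : 0 < u := Real.rpow_pos_of_pos hs0 _
      have hsmpos : 0 < s ^ m := by positivity
      -- AM-GM
      have h6 : 2 * (s ^ e * |v s|) ≤ s ^ m * v s ^ 2 + u := by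
        have hsq : (s ^ e * |v s|) ^ 2 = (s ^ m * v s ^ 2) * u := by
          rw [mul_pow, sq_abs, pow_two (s ^ e), h5]; ring
        have hn : 0 ≤ s ^ m * v s ^ 2 := by positivity
        have := sq_nonneg (s ^ m * v s ^ 2 - u)
        apply le_of_sq_le_sq _ (by positivity)
        nlinarith
      have h7 : |v s| ≤ A * (s ^ e * |v s|) := by
        have := mul_le_mul_of_nonneg_right h4 (abs_nonneg (v s))
        linarith
      have h8 : -|v s| ≤ τ * v s := by
        have : |τ * v s| = |v s| := by rw [abs_mul, hτ, one_mul]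
        rw [← this]; exact neg_abs_le _
      have h9 : A / 2 * (s ^ m * v s ^ 2 + u) ≤ A / 2 * ((d + C * ((m + 1) * s ^ m)) / δ + 2 * (1 / 2 * u)) := by
        gcongr
        linarith
      have h10 : A / 2 * (2 * (s ^ e * |v s|)) ≤ A / 2 * (s ^ m * v s ^ 2 + u) := by gcongr
      linarith
  have k1 := key 1 (by simp)
  have k2 := key (-1) (by simp)
  rw [abs_le]
  constructor <;> linarith

end Part2
end SphODE

namespace SphODE
section Part3
open Set Filter Topology

noncomputable def ph (ζ s : ℝ) : ℝ := 2 - s ^ ζ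
noncomputable def ph1 (ζ s : ℝ) : ℝ := - (ζ * s ^ (ζ - 1))
noncomputable def ph2 (ζ s : ℝ) : ℝ := - (ζ * ((ζ - 1) * s ^ (ζ - 2)))
noncomputable def Lph (m m' : ℕ) (lam p ζ : ℝ) (w : ℝ → ℝ) (s : ℝ) : ℝ :=
  ph2 ζ s + BB m m' s * ph1 ζ s + lam * (|w s| ^ (p - 1) - 1) * ph ζ s
noncomputable def uu (ζ : ℝ) (w v : ℝ → ℝ) (s : ℝ) : ℝ := v s * ph ζ s - w s * ph1 ζ s
noncomputable def yu (m m' : ℕ) (ζ : ℝ) (w v : ℝ → ℝ) (s : ℝ) : ℝ := om m m' s * uu ζ w v s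
noncomputable def yy (m m' : ℕ) (ζ : ℝ) (w v : ℝ → ℝ) (s : ℝ) : ℝ := yu m m' ζ w v s * (w s / ph ζ s)

variable {m m' : ℕ} {lam p θ s1 δ C ζ : ℝ} {w v : ℝ → ℝ}

lemma ph_bd (hζ : 0 < ζ) {s : ℝ} (hs : s ∈ Ioc (0 : ℝ) 1) : 1 ≤ ph ζ s ∧ ph ζ s ≤ 2 := by
  unfold ph
  have h1 : s ^ ζ ≤ 1 := Real.rpow_le_one hs.1.le hs.2 hζ.le
  have h2 : 0 ≤ s ^ ζ := Real.rpow_nonneg hs.1.le _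
  constructor <;> linarith

lemma ph_deriv {s : ℝ} (hs : 0 < s) : HasDerivAt (ph ζ) (ph1 ζ s) s := by
  have := (Real.hasDerivAt_rpow_const (x := s) (p := ζ) (Or.inl hs.ne')).const_sub 2
  exact this

lemma ph1_deriv {s : ℝ} (hs : 0 < s) : HasDerivAt (ph1 ζ) (ph2 ζ s) s := by
  have := ((Real.hasDerivAt_rpow_const (x := s) (p := ζ - 1) (Or.inl hs.ne')).const_mul ζ).neg
  refine this.congr_deriv ?_
  unfold ph2
  rw [show ζ - 1 - 1 = ζ - 2 by ring]

lemma Lph_neg (m m' : ℕ) (hm : 1 ≤ m) (hp : 1 < p) (hlam : 0 < lam) (hζ : 0 < ζ) (hζ1 : ζ ≤ 1)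
    (hsub : ((m : ℝ) / 2 - 1 / 4) * (p - 1) + 2 * ζ ≤ 2) (K : ℝ) (hK : 0 ≤ K) :
    ∃ s2, 0 < s2 ∧ s2 ≤ 1 ∧ ∀ w : ℝ → ℝ, ∀ s ∈ Ioc 0 s2, |w s| ≤ K * s ^ (-((m : ℝ) / 2 - 1 / 4)) →
      Lph m m' lam p ζ w s < 0 := by
  obtain ⟨Cb, hCb, hB⟩ := BB_bound m m'
  set e := (m : ℝ) / 2 - 1 / 4 with he
  set D := lam * K ^ (p - 1) with hD
  have hD0 : 0 ≤ D := by positivity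
  set T := ζ ^ 2 / (2 * (Cb * ζ + 2 * D)) with hT
  have hTpos : 0 < T := by positivity
  have hm' : (1 : ℝ) ≤ m := by exact_mod_cast hm
  refine ⟨min 1 (T ^ (1 / ζ)), by positivity, min_le_left _ _, ?_⟩
  intro w s hs hws
  have hs0 := hs.1
  have hs1 : s ≤ 1 := hs.2.trans (min_le_left _ _)
  have hsT : s ^ ζ ≤ T := by
    have : s ≤ T ^ (1 / ζ) := hs.2.trans (min_le_right _ _)
    have := Real.rpow_le_rpow hs0.le this hζ.le
    rwa [← Real.rpow_mul hTpos.le, one_div_mul_cancel hζ.ne', Real.rpow_one] at this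
  obtain ⟨hp1, hp2⟩ := ph_bd hζ (s := s) ⟨hs0, hs1⟩
  have hV : lam * (|w s| ^ (p - 1) - 1) ≤ D * (s ^ (ζ - 2) * s ^ ζ) := by
    have h1 : |w s| ^ (p - 1) ≤ (K * s ^ (-e)) ^ (p - 1) :=
      Real.rpow_le_rpow (abs_nonneg _) hws (by linarith)
    rw [Real.mul_rpow hK (Real.rpow_nonneg hs0.le _), ← Real.rpow_mul hs0.le] at h1
    have h2 : s ^ (-e * (p - 1)) ≤ s ^ (ζ - 2) * s ^ ζ := by
      rw [← Real.rpow_add hs0]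
      apply Real.rpow_le_rpow_of_exponent_ge hs0 hs1
      nlinarith
    have h3 : |w s| ^ (p - 1) ≤ K ^ (p - 1) * (s ^ (ζ - 2) * s ^ ζ) :=
      h1.trans (mul_le_mul_of_nonneg_left h2 (by positivity))
    rw [hD, mul_assoc]
    apply mul_le_mul_of_nonneg_left _ hlam.le
    linarith
  unfold Lph ph2 ph1
  set ε := BB m m' s - m / s with hε
  have hBε : BB m m' s = m / s + ε := by rw [hε]; ring
  have hεb : |ε| ≤ Cb := hB s ⟨hs0, hs1⟩
  have hq : s ^ (ζ - 1) = s ^ (ζ - 2) * s := by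
    have := Real.rpow_add hs0 (ζ - 2) 1
    rw [Real.rpow_one] at this
    rw [← this]; congr 1; ring
  set q := s ^ (ζ - 2) with hqdef
  have hqpos : 0 < q := Real.rpow_pos_of_pos hs0 _
  set z := s ^ ζ with hz
  have hzpos : 0 < z := Real.rpow_pos_of_pos hs0 _
  have hsz : s ≤ z := by
    have := Real.rpow_le_rpow_of_exponent_ge hs0 hs1 hζ1
    rwa [Real.rpow_one] at this
  have hVph : lam * (|w s| ^ (p - 1) - 1) * ph ζ s ≤ D * (q * z) * 2 := by
    calc _ ≤ D * (q * z) * ph ζ s := mul_le_mul_of_nonneg_right hV (by linarith)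
      _ ≤ _ := by gcongr
  rw [hq, hBε]
  have e1 : (m / s + ε) * -(ζ * (q * s)) = q * (-(ζ * m) - ε * ζ * s) := by field_simp; ring
  rw [e1]
  have e2 : - (ε * ζ * s) ≤ Cb * ζ * z := by
    have : -ε ≤ Cb := by linarith [(abs_le.1 hεb).1]
    calc -(ε * ζ * s) = -ε * (ζ * s) := by ring
      _ ≤ Cb * (ζ * s) := by gcongr
      _ ≤ Cb * (ζ * z) := by gcongr
      _ = _ := by ring
  have e3 : (Cb * ζ + 2 * D) * z ≤ ζ ^ 2 / 2 := by
    calc _ ≤ (Cb * ζ + 2 * D) * T := by gcongr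
      _ = _ := by rw [hT]; field_simp
  have e4 : -(ζ * ((ζ - 1) * q)) + q * (-(ζ * m) - ε * ζ * s) + D * (q * z) * 2
      = q * (-(ζ * (ζ - 1 + m)) + -(ε * ζ * s) + 2 * D * z) := by ring
  have e5 : -(ζ * (ζ - 1 + m)) + -(ε * ζ * s) + 2 * D * z < 0 := by nlinarith
  have := mul_neg_of_pos_of_neg hqpos e5
  linarith

lemma yu_deriv (hw : Sol m m' lam p w v) {s : ℝ} (hs : s ∈ Ioo 0 Real.pi) :
    HasDerivAt (yu m m' ζ w v) (-(om m m' s * w s * Lph m m' lam p ζ w s)) s := by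
  obtain ⟨h1, h2⟩ := hw s hs
  have := (om_deriv m m' hs).mul ((h2.mul (ph_deriv (ζ := ζ) hs.1)).sub (h1.mul (ph1_deriv (ζ := ζ) hs.1)))
  refine this.congr_deriv ?_
  simp only [Lph, ff, Pi.sub_apply, Pi.mul_apply]
  ring

lemma yy_deriv (hw : Sol m m' lam p w v) (hζ : 0 < ζ) {s : ℝ} (hs : s ∈ Ioc (0 : ℝ) 1) :
    HasDerivAt (yy m m' ζ w v) (om m m' s * (uu ζ w v s ^ 2 / ph ζ s ^ 2 -
      w s ^ 2 * Lph m m' lam p ζ w s / ph ζ s)) s := by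
  have hs' := Ioc_sub le_rfl hs
  have hph := ph_bd hζ hs
  have := (yu_deriv (ζ := ζ) hw hs').mul ((hw s hs').1.div (ph_deriv (ζ := ζ) hs.1) (by linarith))
  refine this.congr_deriv ?_
  simp only [yu, uu, Pi.div_apply]
  have : ph ζ s ≠ 0 := by linarith
  field_simp
  ring

lemma yy_deriv_nonneg (hζ : 0 < ζ) {s : ℝ} (hs : s ∈ Ioc (0 : ℝ) 1) (hL : Lph m m' lam p ζ w s < 0) :
    0 ≤ om m m' s * (uu ζ w v s ^ 2 / ph ζ s ^ 2 - w s ^ 2 * Lph m m' lam p ζ w s / ph ζ s) := by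
  have hph := ph_bd hζ hs
  have ho := om_pos m m' (Ioc_sub le_rfl hs)
  have h1 : 0 ≤ w s ^ 2 * -Lph m m' lam p ζ w s / ph ζ s := by
    apply div_nonneg _ (by linarith)
    exact mul_nonneg (sq_nonneg _) (by linarith)
  apply mul_nonneg ho.le
  have h2 : 0 ≤ uu ζ w v s ^ 2 / ph ζ s ^ 2 := by positivity
  have e : w s ^ 2 * -Lph m m' lam p ζ w s / ph ζ s = -(w s ^ 2 * Lph m m' lam p ζ w s / ph ζ s) := by ring
  linarith

lemma Good.disconj (G : Good m m' lam p θ s1 δ C) (hm : 1 ≤ m) (hp : 1 < p) (hlam : 0 < lam) (hζ : 0 < ζ)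
    (hζ1 : ζ ≤ 1) (hsub : ((m : ℝ) / 2 - 1 / 4) * (p - 1) + 2 * ζ ≤ 2) (K : ℝ) :
    ∃ s2, 0 < s2 ∧ s2 ≤ s1 ∧ ∀ w v : ℝ → ℝ, Sol m m' lam p w v →
      (∀ s ∈ Ioo 0 Real.pi, w s = 0 → v s ≠ 0) → PP m lam p θ w v s2 ≤ K →
      ∀ x y, 0 < x → x < y → y ≤ s2 → w x = 0 → w y = 0 → False := by
  have hδ := G.δpos
  have hC := G.Cpos
  obtain ⟨s2, hs2, hs21, hL⟩ := Lph_neg m m' hm hp hlam hζ hζ1 hsub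
    (max 0 ((K + 3 * C) / (2 * δ) + 1)) (le_max_left _ _)
  refine ⟨min s1 s2, lt_min G.s1pos hs2, min_le_left _ _, ?_⟩
  intro w v hw hdz hPK x y hx hxy hy hwx hwy
  have hys1 : y ≤ s1 := hy.trans (min_le_left _ _)
  have hys2 : y ≤ s2 := hy.trans (min_le_right _ _)
  have hPx : 0 ≤ PP m lam p θ w v x := by
    unfold PP; rw [hwx, FF_zero hp]; simp; positivity
  have hPy : PP m lam p θ w v y ≤ K + C := by
    have := G.mono1 hw (s := y) (by linarith) hy (min_le_left _ _)
    linarith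
  have hneg : ∀ s ∈ Icc x y, Lph m m' lam p ζ w s < 0 := by
    intro s hs
    apply hL w s ⟨by linarith [hs.1], by linarith [hs.2]⟩
    have h1 := G.growth hm hw (σ := s) (t := y) (by linarith [hs.1]) hs.2 hys1
    have h2 := G.mono1 hw hx hs.1 (hs.2.trans hys1)
    rw [hwy, zero_sub, abs_neg] at h1
    refine h1.trans ?_
    rw [mul_comm]
    apply mul_le_mul_of_nonneg_right _ (Real.rpow_nonneg (by linarith [hs.1]) _)
    refine le_trans ?_ (le_max_right _ _)
    have h9 : PP m lam p θ w v y - PP m lam p θ w v s + C ≤ K + 3 * C := by linarith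
    have h10 := div_le_div_of_nonneg_right h9 (show 0 ≤ 2 * δ by linarith)
    linarith
  have hmem : ∀ s ∈ Icc x y, s ∈ Ioc (0 : ℝ) 1 := fun s hs => ⟨by linarith [hs.1], by linarith [hs.2]⟩
  have hder : ∀ s ∈ Icc x y, ∃ d, 0 ≤ d ∧ HasDerivAt (yy m m' ζ w v) d s := fun s hs =>
    ⟨_, yy_deriv_nonneg hζ (hmem s hs) (hneg s hs), yy_deriv hw hζ (hmem s hs)⟩
  have hz : ∀ s ∈ Icc x y, yy m m' ζ w v s = 0 := by
    intro s hs
    have h1 := mono_aux' (f := yy m m' ζ w v) hs.1 (fun t ht => hder t ⟨ht.1, ht.2.trans hs.2⟩)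
    have h2 := mono_aux' (f := yy m m' ζ w v) hs.2 (fun t ht => hder t ⟨hs.1.trans ht.1, ht.2⟩)
    have e1 : yy m m' ζ w v x = 0 := by unfold yy; rw [hwx]; simp
    have e2 : yy m m' ζ w v y = 0 := by unfold yy; rw [hwy]; simp
    linarith
  set z := (x + y) / 2 with hzd
  have hzm : z ∈ Ioo x y := ⟨by rw [hzd]; linarith, by rw [hzd]; linarith⟩
  have hzc := Ioo_subset_Icc_self hzm
  have hd0 : HasDerivAt (yy m m' ζ w v) 0 z := by
    apply (hasDerivAt_const z (0 : ℝ)).congr_of_eventuallyEq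
    filter_upwards [Ioo_mem_nhds hzm.1 hzm.2] with t ht
    exact hz t (Ioo_subset_Icc_self ht)
  have heq := (yy_deriv hw hζ (hmem z hzc)).unique hd0
  have ho := om_pos m m' (Ioc_sub le_rfl (hmem z hzc))
  have hph := ph_bd hζ (hmem z hzc)
  have hLz := hneg z hzc
  have h3 := (mul_eq_zero.1 heq).resolve_left ho.ne'
  have h4 : 0 ≤ uu ζ w v z ^ 2 / ph ζ z ^ 2 := by positivity
  have h5 : 0 ≤ w z ^ 2 * -Lph m m' lam p ζ w z / ph ζ z := by
    apply div_nonneg _ (by linarith)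
    exact mul_nonneg (sq_nonneg _) (by linarith)
  have e : w z ^ 2 * -Lph m m' lam p ζ w z / ph ζ z = -(w z ^ 2 * Lph m m' lam p ζ w z / ph ζ z) := by ring
  have h6 : w z ^ 2 * -Lph m m' lam p ζ w z / ph ζ z = 0 := by linarith
  have h7 : uu ζ w v z ^ 2 / ph ζ z ^ 2 = 0 := by linarith
  have hphne : ph ζ z ≠ 0 := by linarith
  have hwz : w z = 0 := by
    rcases div_eq_zero_iff.1 h6 with h | h
    · rcases mul_eq_zero.1 h with h | h
      · exact pow_eq_zero_iff (two_ne_zero) |>.1 h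
      · linarith
    · exact absurd h hphne
  have huz : uu ζ w v z = 0 := by
    rcases div_eq_zero_iff.1 h7 with h | h
    · exact pow_eq_zero_iff (two_ne_zero) |>.1 h
    · exact absurd h (pow_ne_zero 2 hphne)
  have hvz : v z = 0 := by
    unfold uu at huz
    rw [hwz, zero_mul, sub_zero] at huz
    exact (mul_eq_zero.1 huz).resolve_right hphne
  exact hdz z (Ioc_sub le_rfl (hmem z hzc)) hwz hvz

lemma Good.blow (G : Good m m' lam p θ s1 δ C) (hm : 1 ≤ m) (hw : Sol m m' lam p w v) {K s3 c : ℝ} (hc : 0 < c)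
    (h3 : 0 < s3) (h31 : s3 ≤ s1) (hv : ∀ s ∈ Ioc 0 s3, c ≤ s ^ m * |v s|)
    (hK : ∀ s ∈ Ioc 0 s1, -K ≤ PP m lam p θ w v s) : False := by
  have hδ := G.δpos
  have hC := G.Cpos
  set X := (PP m lam p θ w v s3 + C + K + 1) / (δ * c ^ 2) with hX
  have hX0 : 0 < X := by
    have := hK s3 ⟨h3, h31⟩
    apply div_pos _ (by positivity); linarith
  set s := s3 * Real.exp (-X) with hs
  have hspos : 0 < s := by positivity
  have hs3 : s ≤ s3 := by
    have : Real.exp (-X) ≤ 1 := Real.exp_le_one_iff.2 (by linarith)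
    nlinarith
  have := mono_aux' (f := fun s => PP m lam p θ w v s + C * s - δ * c ^ 2 * Real.log s) hs3 ?_
  · have hl : Real.log s = Real.log s3 - X := by
      rw [hs, Real.log_mul h3.ne' (Real.exp_pos _).ne', Real.log_exp]; ring
    simp only [hl] at this
    have h1 := hK s ⟨hspos, hs3.trans h31⟩
    have h2 : δ * c ^ 2 * X = PP m lam p θ w v s3 + C + K + 1 := by rw [hX]; field_simp
    have h4 : C * s3 ≤ C * 1 := by gcongr; linarith [G.s1le]
    have h5 : 0 ≤ C * s := by positivity
    nlinarith
  · intro t ht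
    have ht0 : 0 < t := by linarith [ht.1]
    have ht1 : t ≤ 1 := by linarith [ht.2, G.s1le]
    obtain ⟨d, hd1, hd2⟩ := G.mono w v hw t ⟨ht0, ht.2.trans h31⟩
    refine ⟨_, ?_, (hd1.add ((hasDerivAt_id t).const_mul C)).sub
      ((Real.hasDerivAt_log ht0.ne').const_mul (δ * c ^ 2))⟩
    have h1 := hv t ⟨ht0, ht.2⟩
    have h2 : c ^ 2 ≤ (t ^ m * |v t|) ^ 2 := by gcongr
    have htm : t ^ m ≤ t := by
      calc t ^ m ≤ t ^ 1 := pow_le_pow_of_le_one ht0.le ht1 hm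
        _ = t := pow_one t
    have htm0 : 0 < t ^ m := by positivity
    have h3' : c ^ 2 * t⁻¹ ≤ t ^ m * v t ^ 2 := by
      rw [← div_eq_mul_inv, div_le_iff₀ ht0]
      rw [mul_pow, sq_abs] at h2
      calc c ^ 2 ≤ (t ^ m) ^ 2 * v t ^ 2 := h2
        _ = t ^ m * v t ^ 2 * t ^ m := by ring
        _ ≤ t ^ m * v t ^ 2 * t := by gcongr
    have h4 : 0 ≤ t ^ m * (δ * |w t| ^ (p + 1)) := by positivity
    have h5 : t ^ m * C ≤ C := by nlinarith
    have h6 := mul_le_mul_of_nonneg_left h3' hδ.le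
    nlinarith

lemma PP_neg (s : ℝ) : PP m lam p θ (fun s => - w s) (fun s => - v s) s = PP m lam p θ w v s := by
  unfold PP; rw [FF_neg]; ring

lemma yy_neg (s : ℝ) : yy m m' ζ (fun s => - w s) (fun s => - v s) s = yy m m' ζ w v s := by
  unfold yy yu uu; ring

lemma Lph_negw (s : ℝ) : Lph m m' lam p ζ (fun s => - w s) s = Lph m m' lam p ζ w s := by
  unfold Lph; rw [abs_neg]

lemma Good.yy_nonneg_aux (G : Good m m' lam p θ s1 δ C) (hm : 1 ≤ m) (hζ : 0 < ζ)
    (hw : Sol m m' lam p w v) {K s3 : ℝ} (h3 : 0 < s3) (h31 : s3 ≤ s1)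
    (hL : ∀ s ∈ Ioc 0 s3, Lph m m' lam p ζ w s < 0)
    (hK : ∀ s ∈ Ioc 0 s1, -K ≤ PP m lam p θ w v s) (hneg : yy m m' ζ w v s3 < 0) (hpos : 0 < w s3) : False := by
  have hmem : ∀ s ∈ Ioc 0 s3, s ∈ Ioc (0 : ℝ) 1 := fun s hs => ⟨hs.1, by linarith [hs.2, G.s1le]⟩
  have h1 : ∀ s ∈ Ioc 0 s3, yy m m' ζ w v s < 0 := by
    intro s hs
    refine lt_of_le_of_lt ?_ hneg
    apply mono_aux' hs.2
    intro t ht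
    have ht' : t ∈ Ioc 0 s3 := ⟨by linarith [hs.1, ht.1], ht.2⟩
    exact ⟨_, yy_deriv_nonneg hζ (hmem t ht') (hL t ht'), yy_deriv hw hζ (hmem t ht')⟩
  have hne : ∀ s ∈ Ioc 0 s3, w s ≠ 0 := by
    intro s hs h0
    have := h1 s hs
    unfold yy at this; rw [h0] at this; simp at this
  have hwpos : ∀ s ∈ Ioc 0 s3, 0 < w s := by
    intro s hs
    by_contra hcon
    push Not at hcon
    have hcont : ContinuousOn w (Icc s s3) := fun t ht =>
      ((hw t (Ioc_sub le_rfl (hmem t ⟨by linarith [hs.1, ht.1], ht.2⟩))).1).continuousAt.continuousWithinAt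
    obtain ⟨t, ht, hwt⟩ := intermediate_value_Icc hs.2 hcont ⟨hcon, hpos.le⟩
    exact hne t ⟨by linarith [hs.1, ht.1], ht.2⟩ hwt
  have hyu3 : yu m m' ζ w v s3 < 0 := by
    by_contra hcon
    push Not at hcon
    have h2 := ph_bd hζ (hmem s3 ⟨h3, le_rfl⟩)
    have : 0 ≤ yy m m' ζ w v s3 := mul_nonneg hcon (div_nonneg hpos.le (by linarith))
    linarith
  have hyu : ∀ s ∈ Ioc 0 s3, yu m m' ζ w v s ≤ yu m m' ζ w v s3 := by
    intro s hs
    apply mono_aux' hs.2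
    intro t ht
    have ht' : t ∈ Ioc 0 s3 := ⟨by linarith [hs.1, ht.1], ht.2⟩
    refine ⟨_, ?_, yu_deriv hw (Ioc_sub le_rfl (hmem t ht'))⟩
    have := om_pos m m' (Ioc_sub le_rfl (hmem t ht'))
    have h2 := mul_pos this (hwpos t ht')
    have := hL t ht'
    nlinarith
  obtain ⟨c, hc, hom⟩ := om_bound m m'
  refine G.blow hm hw (K := K) (s3 := s3) (c := -yu m m' ζ w v s3 / 2) (by linarith) h3 h31 ?_ hK
  intro s hs
  have h2 := hyu s hs
  have h4 := ph_bd hζ (hmem s hs)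
  have ho := om_pos m m' (Ioc_sub le_rfl (hmem s hs))
  have ho2 := (hom s (hmem s hs)).2
  have h5 : 0 ≤ - (w s * ph1 ζ s) := by
    unfold ph1
    have := hwpos s hs
    have h6 := hs.1
    have : 0 ≤ w s * (ζ * s ^ (ζ - 1)) := by positivity
    linarith
  have h6 : om m m' s * (v s * ph ζ s) ≤ yu m m' ζ w v s3 := by
    refine le_trans ?_ h2
    unfold yu uu
    apply mul_le_mul_of_nonneg_left _ ho.le
    linarith
  have hv : v s < 0 := by
    by_contra hcon
    push Not at hcon
    have : 0 ≤ om m m' s * (v s * ph ζ s) := mul_nonneg ho.le (mul_nonneg hcon (by linarith))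
    linarith
  rw [abs_of_neg hv]
  have h7 : om m m' s * (-v s * ph ζ s) ≤ om m m' s * (-v s * 2) := by
    apply mul_le_mul_of_nonneg_left _ ho.le
    apply mul_le_mul_of_nonneg_left h4.2; linarith
  have h8 : om m m' s * (-v s) ≤ s ^ m * (-v s) := mul_le_mul_of_nonneg_right ho2 (by linarith)
  nlinarith

lemma Good.yy_nonneg (G : Good m m' lam p θ s1 δ C) (hm : 1 ≤ m) (hζ : 0 < ζ)
    (hw : Sol m m' lam p w v) {K s3 : ℝ} (h3 : 0 < s3) (h31 : s3 ≤ s1)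
    (hL : ∀ s ∈ Ioc 0 s3, Lph m m' lam p ζ w s < 0)
    (hK : ∀ s ∈ Ioc 0 s1, -K ≤ PP m lam p θ w v s) : 0 ≤ yy m m' ζ w v s3 := by
  by_contra hcon
  push Not at hcon
  rcases lt_trichotomy (w s3) 0 with h | h | h
  · refine G.yy_nonneg_aux (K := K) hm hζ hw.neg h3 h31 ?_ ?_ (s3 := s3) ?_ (by linarith)
    · intro s hs; rw [Lph_negw]; exact hL s hs
    · intro s hs; rw [PP_neg]; exact hK s hs
    · rw [yy_neg]; exact hcon
  · unfold yy at hcon; rw [h] at hcon; simp at hcon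
  · exact G.yy_nonneg_aux hm hζ hw h3 h31 hL hK hcon h

lemma Good.regular (G : Good m m' lam p θ s1 δ C) (hm : 1 ≤ m) (hp : 1 < p) (hlam : 0 < lam) (hζ : 0 < ζ)
    (hζ1 : ζ ≤ 1) (hsub : ((m : ℝ) / 2 - 1 / 4) * (p - 1) + 2 * ζ ≤ 2) 
    (hw : Sol m m' lam p w v) {K : ℝ} (hK : ∀ s ∈ Ioc 0 s1, -K ≤ PP m lam p θ w v s) :
    ∃ s3, 0 < s3 ∧ s3 ≤ s1 ∧ ∃ M, ∀ s ∈ Ioc 0 s3, |w s| ≤ M ∧ |v s| ≤ M * s := by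
  have hδ := G.δpos
  have hC := G.Cpos
  have hm' : (1 : ℝ) ≤ m := by exact_mod_cast hm
  set Q := (PP m lam p θ w v s1 + K + C) / (2 * δ) + 1 with hQ
  have hQ0 : 0 ≤ Q := by
    have := hK s1 ⟨G.s1pos, le_rfl⟩
    have : 0 ≤ (PP m lam p θ w v s1 + K + C) / (2 * δ) := div_nonneg (by linarith) (by linarith)
    linarith
  obtain ⟨s2, hs2, hs21, hL⟩ := Lph_neg m m' hm hp hlam hζ hζ1 hsub
    (|w s1| + Q) (by positivity)
  set s3 := min s1 s2 with hs3
  have h3 : 0 < s3 := lt_min G.s1pos hs2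
  have h31 : s3 ≤ s1 := min_le_left _ _
  have hmem : ∀ s ∈ Ioc 0 s3, s ∈ Ioc (0 : ℝ) 1 := fun s hs => ⟨hs.1, by linarith [hs.2, G.s1le]⟩
  have hneg : ∀ s ∈ Ioc 0 s3, Lph m m' lam p ζ w s < 0 := by
    intro s hs
    apply hL w s ⟨hs.1, hs.2.trans (min_le_right _ _)⟩
    have h1 := G.growth hm hw (σ := s) (t := s1) hs.1 (hs.2.trans h31) le_rfl
    have h2 : (1 : ℝ) ≤ s ^ (-((m : ℝ) / 2 - 1 / 4)) :=
      Real.one_le_rpow_of_pos_of_le_one_of_nonpos hs.1 (hmem s hs).2 (by linarith)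
    have h4 := hK s ⟨hs.1, hs.2.trans h31⟩
    have h5 : (PP m lam p θ w v s1 - PP m lam p θ w v s + C) / (2 * δ) + 1 ≤ Q := by
      rw [hQ]; gcongr; linarith
    have h6 : |w s| ≤ |w s1| + |w s1 - w s| := by
      have := abs_sub_abs_le_abs_sub (w s) (w s1)
      rw [abs_sub_comm] at this; linarith
    set E := s ^ (-((m : ℝ) / 2 - 1 / 4)) with hE
    have h7 : |w s1| ≤ |w s1| * E := by nlinarith [abs_nonneg (w s1)]
    have h8 := mul_le_mul_of_nonneg_left h5 (show 0 ≤ E by linarith)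
    calc |w s| ≤ |w s1| + |w s1 - w s| := h6
      _ ≤ |w s1| * E + E * Q := by linarith
      _ = _ := by ring
  have hyy : ∀ s ∈ Ioc 0 s3, 0 ≤ yy m m' ζ w v s := fun s hs =>
    G.yy_nonneg hm hζ hw hs.1 (hs.2.trans h31) (fun t ht => hneg t ⟨ht.1, ht.2.trans hs.2⟩) hK
  have hwb : ∀ s ∈ Ioc 0 s3, |w s| ≤ 2 * |w s3| := by
    intro s hs
    have hmono := mono_aux' (f := fun s => (w s / ph ζ s) ^ 2) hs.2 ?_
    · have hmono : |w s / ph ζ s| ≤ |w s3 / ph ζ s3| := sq_le_sq.1 hmono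
      have p1 := ph_bd hζ (hmem s hs)
      have p2 := ph_bd hζ (hmem s3 ⟨h3, le_rfl⟩)
      rw [abs_div, abs_div, abs_of_pos (a := ph ζ s) (by linarith), abs_of_pos (a := ph ζ s3) (by linarith),
        div_le_div_iff₀ (by linarith) (by linarith)] at hmono
      nlinarith [abs_nonneg (w s), abs_nonneg (w s3)]
    · intro t ht
      have ht' : t ∈ Ioc 0 s3 := ⟨by linarith [hs.1, ht.1], ht.2⟩
      have hph := ph_bd hζ (hmem t ht')
      have hphne : ph ζ t ≠ 0 := by linarith
      have ho := om_pos m m' (Ioc_sub le_rfl (hmem t ht'))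
      have hd := ((hw t (Ioc_sub le_rfl (hmem t ht'))).1.div (ph_deriv (ζ := ζ) ht'.1) hphne).pow 2
      refine ⟨_, ?_, hd⟩
      have e : ((2 : ℕ) : ℝ) * (w / ph ζ) t ^ (2 - 1) * ((v t * ph ζ t - w t * ph1 ζ t) / ph ζ t ^ 2)
        = 2 * yy m m' ζ w v t / (om m m' t * ph ζ t ^ 2) := by
        unfold yy yu uu
        rw [show (2 - 1 : ℕ) = 1 from rfl, pow_one]
        simp only [Pi.div_apply]
        have := ho.ne'
        field_simp
        push_cast; ring
      rw [e]
      have := hyy t ht'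
      apply div_nonneg (by linarith); positivity
  set M0 := (2 * |w s3|) ^ p + 2 * |w s3| with hM0
  have hM00 : 0 ≤ M0 := by positivity
  have hff : ∀ s ∈ Ioc 0 s3, |ff p (w s)| ≤ M0 := by
    intro s hs
    refine (ff_abs_le hp _).trans ?_
    have := hwb s hs
    rw [hM0]
    gcongr
  have hov : ∀ s ∈ Ioc 0 s3, |om m m' s * v s| ≤ lam * M0 * s ^ (m + 1) := by
    intro s' hs'
    by_contra hcon
    push Not at hcon
    obtain ⟨c, hc, hom⟩ := om_bound m m'
    refine G.blow hm hw (K := K) (s3 := s') (c := |om m m' s' * v s'| - lam * M0 * s' ^ (m + 1)) (by linarith)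
      hs'.1 (hs'.2.trans h31) ?_ hK
    intro s hs
    have key : ∀ τ : ℝ, |τ| = 1 → τ * (om m m' s * v s) + lam * M0 * s ^ (m + 1) ≤
        τ * (om m m' s' * v s') + lam * M0 * s' ^ (m + 1) := by
      intro τ hτ
      apply mono_aux' (f := fun s => τ * (om m m' s * v s) + lam * M0 * s ^ (m + 1)) hs.2
      intro t ht
      have ht' : t ∈ Ioc 0 s3 := ⟨by linarith [hs.1, ht.1], by linarith [hs'.2, ht.2]⟩
      have htp := Ioc_sub le_rfl (hmem t ht')
      refine ⟨_, ?_, (((om_deriv m m' htp).mul (hw t htp).2).const_mul τ).add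
        ((hasDerivAt_pow (m + 1) t).const_mul (lam * M0))⟩
      have e1 : (m + 1 - 1 : ℕ) = m := by omega
      have e2 : BB m m' t * om m m' t * v t + om m m' t * (-(BB m m' t * v t) - lam * ff p (w t))
        = - (lam * (om m m' t * ff p (w t))) := by ring
      rw [e1, e2]; push_cast
      have ho := (hom t (hmem t ht')).2
      have ho0 := om_pos m m' htp
      have h1 : |τ * (om m m' t * ff p (w t))| ≤ t ^ m * M0 := by
        rw [abs_mul, hτ, one_mul, abs_mul, abs_of_pos ho0]
        have := hff t ht'
        have ht0 := ht'.1
        gcongr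
      have h2 := (abs_le.1 h1).2
      have h4 : 0 ≤ lam * M0 * (m * t ^ m) := by have := ht'.1; positivity
      nlinarith
    have k1 := key 1 (by simp)
    have k2 := key (-1) (by simp)
    have hs3' : s ∈ Ioc 0 s3 := ⟨hs.1, hs.2.trans hs'.2⟩
    have ho := (hom s (hmem s hs3')).2
    have ho0 := om_pos m m' (Ioc_sub le_rfl (hmem s hs3'))
    have h0 : 0 ≤ lam * M0 * s ^ (m + 1) := by have := hs.1; positivity
    have h5 : |om m m' s' * v s'| ≤ |om m m' s * v s| + lam * M0 * s' ^ (m + 1) := by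
      have a1 := neg_abs_le (om m m' s * v s)
      have a2 := le_abs_self (om m m' s * v s)
      rw [abs_le]; constructor <;> linarith
    have h6 : |om m m' s * v s| ≤ s ^ m * |v s| := by
      rw [abs_mul, abs_of_pos ho0]; gcongr
    linarith
  obtain ⟨c, hc, hom⟩ := om_bound m m'
  refine ⟨s3, h3, h31, max (2 * |w s3|) (lam * M0 / c), fun s hs => ⟨(hwb s hs).trans (le_max_left _ _), ?_⟩⟩
  have h1 := hov s hs
  have ho := (hom s (hmem s hs)).1
  have ho0 := om_pos m m' (Ioc_sub le_rfl (hmem s hs))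
  rw [abs_mul, abs_of_pos ho0] at h1
  have hs0 := hs.1
  have h2 : c * s ^ m * |v s| ≤ lam * M0 * s ^ (m + 1) := le_trans (by gcongr) h1
  have h4 : |v s| ≤ lam * M0 / c * s := by
    rw [div_mul_eq_mul_div, le_div_iff₀ hc]
    have hsm : 0 < s ^ m := by positivity
    rw [pow_succ] at h2
    apply le_of_mul_le_mul_left _ hsm
    nlinarith
  refine h4.trans ?_
  gcongr
  exact le_max_right _ _

end Part3
end SphODE

namespace SphODE
section Part4
open Set Filter Topology

noncomputable def GG (m m' : ℕ) (g : ℝ → ℝ) (σ : ℝ) : ℝ :=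
  (∫ x in (0:ℝ)..σ, om m m' x * g x) / om m m' σ

section P4
variable {m m' : ℕ} {lam p : ℝ}

lemma om_ratio (m m' : ℕ) {R : ℝ} (hR0 : 0 < R) (hR : R < Real.pi) : ∃ C > 0, ∀ τ σ, 0 ≤ τ → τ ≤ σ → σ ≤ R →
    0 ≤ om m m' τ ∧ om m m' τ ≤ C * om m m' σ := by
  have hc : 0 < Real.cos (R / 2) := (half_facts ⟨hR0, hR⟩).2
  refine ⟨1 / Real.cos (R / 2) ^ m', by positivity, fun τ σ h0 h1 h2 => ?_⟩
  have hs0 : 0 ≤ Real.sin (τ / 2) := Real.sin_nonneg_of_nonneg_of_le_pi (by linarith) (by linarith)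
  have hct : 0 ≤ Real.cos (τ / 2) := Real.cos_nonneg_of_mem_Icc ⟨by linarith, by linarith⟩
  have hs : Real.sin (τ / 2) ≤ Real.sin (σ / 2) :=
    Real.sin_le_sin_of_le_of_le_pi_div_two (by linarith) (by linarith) (by linarith)
  have hcs : Real.cos (R / 2) ≤ Real.cos (σ / 2) :=
    Real.cos_le_cos_of_nonneg_of_le_pi (by linarith) (by linarith) (by linarith)
  unfold om
  refine ⟨by positivity, ?_⟩
  have h3 : Real.sin (τ / 2) ^ m * Real.cos (τ / 2) ^ m' ≤ Real.sin (σ / 2) ^ m := by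
    have a1 := pow_le_pow_left₀ hs0 hs m
    have a2 := pow_le_one₀ (n := m') hct (Real.cos_le_one _)
    have a3 : 0 ≤ Real.sin (σ / 2) ^ m := by apply pow_nonneg; linarith
    have a4 : 0 ≤ Real.sin (τ / 2) ^ m := by positivity
    nlinarith
  have h4 := pow_le_pow_left₀ hc.le hcs m'
  have h5 : 0 ≤ Real.sin (σ / 2) ^ m := by apply pow_nonneg; linarith
  rw [one_div_mul_eq_div, le_div_iff₀ (by positivity)]
  calc _ ≤ Real.sin (σ / 2) ^ m * Real.cos (R / 2) ^ m' := by gcongr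
    _ ≤ _ := by gcongr

lemma GG_bound (m m' : ℕ) {R : ℝ} (hR0 : 0 < R) (hR : R < Real.pi) : ∃ C > 0, ∀ (g : ℝ → ℝ) (N σ : ℝ),
    0 ≤ σ → σ ≤ R → (∀ τ ∈ Icc 0 σ, |g τ| ≤ N) → |GG m m' g σ| ≤ C * σ * N := by
  obtain ⟨C, hC, h⟩ := om_ratio m m' hR0 hR
  refine ⟨C, hC, fun g N σ h0 h1 hg => ?_⟩
  have hN : 0 ≤ N := (abs_nonneg _).trans (hg 0 ⟨le_rfl, h0⟩)
  rcases h0.eq_or_lt with h0 | h0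
  · subst h0; simp [GG]
  have ho := om_pos m m' (r := σ) ⟨h0, by linarith⟩
  have := intervalIntegral.norm_integral_le_of_norm_le_const (a := 0) (b := σ)
    (f := fun x => om m m' x * g x) (C := C * om m m' σ * N) (fun x hx => by
      rw [uIoc_of_le h0.le] at hx
      obtain ⟨a1, a2⟩ := h x σ hx.1.le hx.2 h1
      rw [Real.norm_eq_abs, abs_mul, abs_of_nonneg a1]
      exact mul_le_mul a2 (hg x ⟨hx.1.le, hx.2⟩) (abs_nonneg _) (by positivity))
  rw [Real.norm_eq_abs, sub_zero, abs_of_pos h0] at this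
  unfold GG
  rw [abs_div, abs_of_pos ho, div_le_iff₀ ho]
  linarith

lemma GG_zero (g : ℝ → ℝ) : GG m m' g 0 = 0 := by simp [GG]

lemma GG_congr {g g' : ℝ → ℝ} {σ : ℝ} (h0 : 0 ≤ σ) (h : ∀ τ ∈ Icc 0 σ, g τ = g' τ) :
    GG m m' g σ = GG m m' g' σ := by
  unfold GG
  congr 1
  apply intervalIntegral.integral_congr
  intro x hx
  rw [uIcc_of_le h0] at hx
  simp only [h x hx]

lemma GG_deriv {g : ℝ → ℝ} (hg : Continuous g) {σ : ℝ} (hσ : σ ∈ Ioo 0 Real.pi) :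
    HasDerivAt (GG m m' g) (g σ - BB m m' σ * GG m m' g σ) σ := by
  have hc : Continuous fun x => om m m' x * g x := (om_cont m m').mul hg
  have h1 := hc.integral_hasStrictDerivAt 0 σ
  have ho := (om_pos m m' hσ).ne'
  have := h1.hasDerivAt.div (om_deriv m m' hσ) ho
  refine this.congr_deriv ?_
  unfold GG
  field_simp

lemma GG_sub {g g' : ℝ → ℝ} (hg : Continuous g) (hg' : Continuous g') (σ : ℝ) :
    GG m m' (fun x => g x - g' x) σ = GG m m' g σ - GG m m' g' σ := by
  unfold GG
  rw [← sub_div, ← intervalIntegral.integral_sub]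
  · congr 1; apply intervalIntegral.integral_congr; intro x _; simp only; ring
  · exact (((om_cont m m').mul hg)).intervalIntegrable _ _
  · exact (((om_cont m m').mul hg')).intervalIntegrable _ _

lemma GG_cont {g : ℝ → ℝ} (hg : Continuous g) : ContinuousOn (GG m m' g) (Ico 0 Real.pi) := by
  intro σ hσ
  rcases hσ.1.eq_or_lt with h0 | h0
  · subst h0
    obtain ⟨C, hC, h⟩ := GG_bound m m' one_pos (by linarith [Real.pi_gt_three])
    obtain ⟨N, hN⟩ := isCompact_Icc.exists_bound_of_continuousOn (s := Icc (0:ℝ) 1) hg.continuousOn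
    have key : Tendsto (GG m m' g) (𝓝[Ico 0 Real.pi] 0) (𝓝 0) := by
      apply squeeze_zero_norm' (a := fun σ => C * σ * N)
      · have : Iio (1:ℝ) ∈ 𝓝[Ico 0 Real.pi] 0 := mem_nhdsWithin_of_mem_nhds (Iio_mem_nhds one_pos)
        filter_upwards [this, self_mem_nhdsWithin] with x hx hx'
        exact h g N x hx'.1 (le_of_lt hx) (fun τ hτ => hN τ ⟨hτ.1, hτ.2.trans (le_of_lt hx)⟩)
      · have : Tendsto (fun σ : ℝ => C * σ * N) (𝓝 0) (𝓝 (C * 0 * N)) := by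
          apply Continuous.tendsto; fun_prop
        simpa using this.mono_left nhdsWithin_le_nhds
    unfold ContinuousWithinAt
    rwa [GG_zero]
  · exact (GG_deriv hg ⟨h0, hσ.2⟩).continuousAt.continuousWithinAt

lemma GG_int {g : ℝ → ℝ} (hg : Continuous g) {σ : ℝ} (h0 : 0 ≤ σ) (h1 : σ < Real.pi) :
    IntervalIntegrable (GG m m' g) MeasureTheory.volume 0 σ := by
  apply ContinuousOn.intervalIntegrable
  rw [uIcc_of_le h0]
  exact (GG_cont hg).mono (fun x hx => ⟨hx.1, hx.2.trans_lt h1⟩)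

lemma GG_prim_deriv {g : ℝ → ℝ} (hg : Continuous g) {σ : ℝ} (hσ : σ ∈ Ioo 0 Real.pi) :
    HasDerivAt (fun s => ∫ x in (0:ℝ)..s, GG m m' g x) (GG m m' g σ) σ := by
  apply intervalIntegral.integral_hasDerivAt_right (GG_int hg hσ.1.le hσ.2)
  · apply ContinuousOn.stronglyMeasurableAtFilter (s := Ioo 0 Real.pi) isOpen_Ioo _ σ hσ
    exact (GG_cont hg).mono Ioo_subset_Ico_self
  · exact (GG_deriv hg hσ).continuousAt

lemma exp_int {κ : ℝ} (hκ : 0 < κ) (σ : ℝ) : ∫ x in (0:ℝ)..σ, Real.exp (κ * x) = (Real.exp (κ * σ) - 1) / κ := by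
  have := intervalIntegral.integral_eq_sub_of_hasDerivAt (a := 0) (b := σ) (f := fun x => Real.exp (κ * x) / κ)
    (f' := fun x => Real.exp (κ * x)) (fun x _ => ?_) ?_
  · rw [this]; simp; ring
  · have := (((hasDerivAt_id x).const_mul κ).exp).div_const κ
    refine this.congr_deriv ?_
    simp; field_simp
  · apply Continuous.intervalIntegrable; fun_prop

/-- the basic contraction estimate -/
lemma contr_est (m m' : ℕ) (hlam : 0 < lam) {R L : ℝ} (hR0 : 0 < R) (hR : R < Real.pi) (hL : 0 < L) :
    ∃ κ > 0, ∀ (f : ℝ → ℝ), (Continuous f) → (∀ x y, |f x - f y| ≤ L * |x - y|) →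
      ∀ (w1 w2 : ℝ → ℝ), Continuous w1 → Continuous w2 → ∀ N R', R' ≤ R →
      (∀ τ ∈ Icc 0 R', |w1 τ - w2 τ| ≤ N * Real.exp (κ * τ)) → ∀ σ ∈ Icc 0 R',
      |lam * (∫ x in (0:ℝ)..σ, GG m m' (fun x => f (w1 x)) x) -
        lam * (∫ x in (0:ℝ)..σ, GG m m' (fun x => f (w2 x)) x)| ≤ N * Real.exp (κ * σ) / 2 := by
  obtain ⟨C, hC, h⟩ := GG_bound m m' hR0 hR
  refine ⟨2 * lam * C * L * R, by positivity, fun f hf hfL w1 w2 h1 h2 N R' hR' hN σ hσ => ?_⟩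
  set κ := 2 * lam * C * L * R with hκ
  have hκ0 : 0 < κ := by positivity
  have hN0 : 0 ≤ N := by
    have := hN 0 ⟨le_rfl, hσ.1.trans hσ.2⟩
    simp at this; exact (abs_nonneg _).trans this
  have c1 : Continuous fun x => f (w1 x) := hf.comp h1
  have c2 : Continuous fun x => f (w2 x) := hf.comp h2
  have hσπ : σ < Real.pi := by linarith [hσ.2]
  rw [← mul_sub, ← intervalIntegral.integral_sub (GG_int c1 hσ.1 hσπ) (GG_int c2 hσ.1 hσπ), abs_mul, abs_of_pos hlam]
  have key : ∀ x ∈ Ioc 0 σ, ‖GG m m' (fun x => f (w1 x)) x - GG m m' (fun x => f (w2 x)) x‖ ≤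
      C * R * L * N * Real.exp (κ * x) := by
    intro x hx
    rw [← GG_sub c1 c2, Real.norm_eq_abs]
    refine (h _ (L * (N * Real.exp (κ * x))) x hx.1.le (by linarith [hx.2, hσ.2]) ?_).trans ?_
    · intro τ hτ
      refine (hfL _ _).trans ?_
      apply mul_le_mul_of_nonneg_left _ hL.le
      refine (hN τ ⟨hτ.1, by linarith [hτ.2, hx.2, hσ.2]⟩).trans ?_
      apply mul_le_mul_of_nonneg_left _ hN0
      apply Real.exp_le_exp.2
      nlinarith [hτ.2]
    · have : C * x ≤ C * R := mul_le_mul_of_nonneg_left (by linarith [hx.2, hσ.2]) hC.le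
      calc C * x * (L * (N * Real.exp (κ * x))) ≤ C * R * (L * (N * Real.exp (κ * x))) :=
            mul_le_mul_of_nonneg_right this (by positivity)
        _ = _ := by ring
  have i1 := intervalIntegral.norm_integral_le_of_norm_le hσ.1 (μ := MeasureTheory.volume)
    (f := fun x => GG m m' (fun x => f (w1 x)) x - GG m m' (fun x => f (w2 x)) x)
    (g := fun x => C * R * L * N * Real.exp (κ * x))
    (MeasureTheory.ae_of_all _ key) (by apply Continuous.intervalIntegrable; fun_prop)
  rw [intervalIntegral.integral_const_mul, exp_int hκ0, Real.norm_eq_abs] at i1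
  have i2 := mul_le_mul_of_nonneg_left i1 hlam.le
  refine i2.trans ?_
  have : lam * (C * R * L * N * ((Real.exp (κ * σ) - 1) / κ)) = N * (Real.exp (κ * σ) - 1) / 2 := by
    rw [hκ]; field_simp
  rw [this]
  nlinarith

/-- integral solution -/
def ISol (m m' : ℕ) (lam : ℝ) (f : ℝ → ℝ) (R a : ℝ) (w : ℝ → ℝ) : Prop :=
  Continuous w ∧ ∀ σ ∈ Icc 0 R, w σ = a - lam * ∫ x in (0:ℝ)..σ, GG m m' (fun x => f (w x)) x

lemma stab0 (m m' : ℕ) (hlam : 0 < lam) {R L : ℝ} (hR0 : 0 < R) (hR : R < Real.pi) (hL : 0 < L) :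
    ∃ C > 0, ∀ (f : ℝ → ℝ), (Continuous f) → (∀ x y, |f x - f y| ≤ L * |x - y|) →
      ∀ (w1 w2 : ℝ → ℝ) (a b R' : ℝ), R' ≤ R → ISol m m' lam f R' a w1 → ISol m m' lam f R' b w2 →
      ∀ σ ∈ Icc 0 R', |w1 σ - w2 σ| ≤ C * |a - b| := by
  obtain ⟨κ, hκ, H⟩ := contr_est m m' hlam hR0 hR hL
  refine ⟨2 * Real.exp (κ * R), by positivity, fun f hf hfL w1 w2 a b R' hR' h1 h2 => ?_⟩
  intro σ hσ
  have hne : (Icc 0 R').Nonempty := ⟨σ, hσ⟩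
  have hcont : ContinuousOn (fun τ => |w1 τ - w2 τ| * Real.exp (-(κ * τ))) (Icc 0 R') := by
    have := h1.1; have := h2.1
    apply Continuous.continuousOn; fun_prop
  obtain ⟨t, ht, hmax⟩ := isCompact_Icc.exists_isMaxOn hne hcont
  set N := |w1 t - w2 t| * Real.exp (-(κ * t)) with hN
  have hb : ∀ τ ∈ Icc 0 R', |w1 τ - w2 τ| ≤ N * Real.exp (κ * τ) := by
    intro τ hτ
    have := hmax hτ
    change |w1 τ - w2 τ| * Real.exp (-(κ * τ)) ≤ |w1 t - w2 t| * Real.exp (-(κ * t)) at this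
    rw [← hN, Real.exp_neg, ← div_eq_mul_inv, div_le_iff₀ (Real.exp_pos _)] at this
    exact this
  have h3 := H f hf hfL w1 w2 h1.1 h2.1 N R' hR' hb t ht
  have h4 : |w1 t - w2 t| = N * Real.exp (κ * t) := by
    rw [hN, mul_assoc, ← Real.exp_add]; simp
  have h5 : |w1 t - w2 t| ≤ |a - b| + N * Real.exp (κ * t) / 2 := by
    rw [h1.2 t ht, h2.2 t ht]
    refine le_trans ?_ (add_le_add_right h3 _)
    refine le_trans (le_of_eq ?_) (abs_sub (a - b) _)
    congr 1; ring
  have h6 : N ≤ 2 * |a - b| := by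
    have e1 : 1 ≤ Real.exp (κ * t) := Real.one_le_exp (mul_nonneg hκ.le ht.1)
    have : N * Real.exp (κ * t) ≤ 2 * |a - b| := by linarith
    have hN0 : 0 ≤ N := by positivity
    nlinarith
  refine (hb σ hσ).trans ?_
  have e2 : Real.exp (κ * σ) ≤ Real.exp (κ * R) := Real.exp_le_exp.2 (by nlinarith [hσ.2])
  calc N * Real.exp (κ * σ) ≤ (2 * |a - b|) * Real.exp (κ * R) :=
        mul_le_mul h6 e2 (Real.exp_pos _).le (by positivity)
    _ = _ := by ring

lemma exists0 (m m' : ℕ) (hlam : 0 < lam) {R L : ℝ} (hR0 : 0 < R) (hR : R < Real.pi) (hL : 0 < L)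
    (f : ℝ → ℝ) (hf : Continuous f) (hfL : ∀ x y, |f x - f y| ≤ L * |x - y|) (a : ℝ) :
    ∃ w, ISol m m' lam f R a w := by
  obtain ⟨κ, hκ, H⟩ := contr_est m m' hlam hR0 hR hL
  let E : C(Icc 0 R, ℝ) → ℝ → ℝ := fun u x => Real.exp (κ * x) * IccExtend hR0.le u x
  have hE : ∀ u, Continuous (E u) := fun u => by
    have : Continuous (IccExtend hR0.le u) := u.continuous.Icc_extend'
    fun_prop
  have hcont : ∀ u, ContinuousOn (fun s => ∫ x in (0:ℝ)..s, GG m m' (fun x => f (E u x)) x) (Icc 0 R) := by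
    intro u
    have c1 : Continuous fun x => f (E u x) := hf.comp (hE u)
    have := intervalIntegral.continuousOn_primitive_interval (a := 0) (b := R) (μ := MeasureTheory.volume)
      (f := GG m m' (fun x => f (E u x))) ?_
    · rwa [uIcc_of_le hR0.le] at this
    · rw [uIcc_of_le hR0.le]
      apply ContinuousOn.integrableOn_Icc
      exact (GG_cont c1).mono (fun x hx => ⟨hx.1, hx.2.trans_lt hR⟩)
  let T : C(Icc 0 R, ℝ) → C(Icc 0 R, ℝ) := fun u =>
    ⟨fun σ => Real.exp (-(κ * σ)) * (a - lam * ∫ x in (0:ℝ)..(σ:ℝ), GG m m' (fun x => f (E u x)) x), by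
      have := (hcont u).domRestrict
      have : Continuous fun σ : Icc 0 R => ∫ x in (0:ℝ)..(σ:ℝ), GG m m' (fun x => f (E u x)) x := this
      fun_prop⟩
  have hT : ContractingWith (1/2) T := by
    refine ⟨by rw [← NNReal.coe_lt_coe]; norm_num, ?_⟩
    apply LipschitzWith.of_dist_le_mul
    intro u1 u2
    rw [ContinuousMap.dist_le (by positivity)]
    intro σ
    have h3 := H f hf hfL (E u1) (E u2) (hE u1) (hE u2) (dist u1 u2) R le_rfl (by
      intro τ hτ
      simp only [E]
      rw [IccExtend_of_mem _ _ hτ, IccExtend_of_mem _ _ hτ, ← mul_sub, abs_mul, abs_of_pos (Real.exp_pos _), mul_comm]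
      apply mul_le_mul_of_nonneg_right _ (Real.exp_pos _).le
      exact ContinuousMap.dist_apply_le_dist (f := u1) (g := u2) ⟨τ, hτ⟩) σ σ.2
    rw [Real.dist_eq]
    simp only [T, ContinuousMap.coe_mk]
    rw [← mul_sub, abs_mul, abs_of_pos (Real.exp_pos _), sub_sub_sub_cancel_left, abs_sub_comm]
    calc _ ≤ Real.exp (-(κ * σ)) * (dist u1 u2 * Real.exp (κ * σ) / 2) :=
          mul_le_mul_of_nonneg_left h3 (Real.exp_pos _).le
      _ = dist u1 u2 / 2 * (Real.exp (-(κ * σ)) * Real.exp (κ * σ)) := by ring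
      _ = _ := by rw [← Real.exp_add]; simp; ring
  have hfix := hT.fixedPoint_isFixedPt
  set u := hT.fixedPoint with hu
  refine ⟨E u, hE u, fun σ hσ => ?_⟩
  have h1 : T u ⟨σ, hσ⟩ = u ⟨σ, hσ⟩ := by rw [hfix]
  have h2 : E u σ = Real.exp (κ * σ) * u ⟨σ, hσ⟩ := by simp only [E]; rw [IccExtend_of_mem _ _ hσ]
  rw [h2, ← h1]
  simp only [T, ContinuousMap.coe_mk]
  rw [← mul_assoc, ← Real.exp_add]
  simp

end P4
end Part4
end SphODE

namespace SphODE
section Part5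
open Set Filter Topology
section P5
variable {m m' : ℕ} {lam p : ℝ} {f w : ℝ → ℝ} {R a : ℝ}

lemma ISol.deriv (hf : Continuous f) (h : ISol m m' lam f R a w) (hR : R < Real.pi) {σ : ℝ} (hσ : σ ∈ Ioo 0 R) :
    HasDerivAt w (-lam * GG m m' (fun x => f (w x)) σ) σ := by
  have c : Continuous fun x => f (w x) := hf.comp h.1
  have h1 := ((GG_prim_deriv (m := m) (m' := m') c ⟨hσ.1, hσ.2.trans hR⟩).const_mul lam).const_sub a
  refine (h1.congr_of_eventuallyEq ?_).congr_deriv (by ring)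
  filter_upwards [Ioo_mem_nhds hσ.1 hσ.2] with x hx
  exact h.2 x ⟨hx.1.le, hx.2.le⟩

lemma ISol.deriv2 (hf : Continuous f) (h : ISol m m' lam f R a w) (hR : R < Real.pi) {σ : ℝ} (hσ : σ ∈ Ioo 0 R) :
    HasDerivAt (fun s => -lam * GG m m' (fun x => f (w x)) s)
      (-(BB m m' σ * (-lam * GG m m' (fun x => f (w x)) σ)) - lam * f (w σ)) σ := by
  have c : Continuous fun x => f (w x) := hf.comp h.1
  have h1 := ((GG_deriv (m := m) (m' := m') c ⟨hσ.1, hσ.2.trans hR⟩).const_mul (-lam))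
  exact h1.congr_deriv (by ring)

lemma ISol.mono {R' : ℝ} (h : ISol m m' lam f R a w) (hR : R' ≤ R) : ISol m m' lam f R' a w :=
  ⟨h.1, fun σ hσ => h.2 σ ⟨hσ.1, hσ.2.trans hR⟩⟩

structure Adm (A N : ℝ) (f : ℝ → ℝ) : Prop where
  cont : Continuous f
  odd : ∀ x, f (-x) = - f x
  low : ∀ x, 0 ≤ x → x ≤ 1 → -1 ≤ f x
  pos : ∀ x, 1 ≤ x → 0 ≤ f x
  bd : ∀ x, |x| ≤ A → |f x| ≤ N

lemma prim_low {A N : ℝ} (h : Adm A N f) {H : ℝ → ℝ} (h0 : H 0 = 0) (hd : ∀ x, HasDerivAt H (f x) x) {x : ℝ} (hx : 0 ≤ x) :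
    -1 ≤ H x := by
  have key : ∀ y, 0 ≤ y → y ≤ 1 → -y ≤ H y := by
    intro y hy hy1
    have := mono_aux' (f := fun x => H x + x) hy (fun t ht =>
      ⟨f t + 1, by linarith [h.low t ht.1 (ht.2.trans hy1)], (hd t).add (hasDerivAt_id t)⟩)
    simp [h0] at this; linarith
  rcases le_total x 1 with h1 | h1
  · linarith [key x hx h1]
  · have := mono_aux' (f := H) h1 (fun t ht => ⟨f t, h.pos t ht.1, hd t⟩)
    linarith [key 1 zero_le_one le_rfl]

lemma apriori (m m' : ℕ) (hlam : 0 < lam) {A N : ℝ} (hA : 0 < A) (hR0 : 0 < R) (hR : R < Real.pi) :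
    ∃ M, ∀ (f w : ℝ → ℝ) (R' a : ℝ), Adm A N f → R' ≤ R → |a| ≤ A → ISol m m' lam f R' a w →
      ∀ σ ∈ Icc 0 R', |w σ| ≤ M := by
  have hc : 0 < Real.cos (R / 2) := (half_facts ⟨hR0, hR⟩).2
  set B := (m' / 2 : ℝ) / Real.cos (R / 2) with hB
  have hB0 : 0 ≤ B := by positivity
  have hBB : ∀ σ ∈ Ioc 0 R, -BB m m' σ ≤ B := by
    intro σ hσ
    obtain ⟨h1, h2⟩ := half_facts (r := σ) ⟨hσ.1, by linarith [hσ.2]⟩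
    have hcs : Real.cos (R / 2) ≤ Real.cos (σ / 2) :=
      Real.cos_le_cos_of_nonneg_of_le_pi (by linarith [hσ.1]) (by linarith) (by linarith [hσ.2])
    have h3 : Real.sin (σ / 2) / Real.cos (σ / 2) ≤ 1 / Real.cos (R / 2) :=
      div_le_div₀ zero_le_one (Real.sin_le_one _) hc hcs
    have h4 := mul_le_mul_of_nonneg_left h3 (show (0:ℝ) ≤ m' / 2 by positivity)
    have h5 : 0 ≤ (m / 2 : ℝ) * (Real.cos (σ / 2) / Real.sin (σ / 2)) := by positivity
    unfold BB
    rw [hB]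
    have e : (m' / 2 : ℝ) / Real.cos (R / 2) = m' / 2 * (1 / Real.cos (R / 2)) := by ring
    rw [e]; linarith
  set Q := 2 * (lam * (N * A + 1) * Real.exp (2 * B * R)) with hQ
  refine ⟨A + Real.sqrt Q * R, ?_⟩
  intro f w R' a hf hR' ha hw σ hσ
  have hN : 0 ≤ N := (abs_nonneg _).trans (hf.bd 0 (by simpa using hA.le))
  set v := fun s => -lam * GG m m' (fun x => f (w x)) s with hv
  set H := fun x => ∫ t in (0:ℝ)..x, f t with hH
  have hH0 : H 0 = 0 := by simp [hH]
  have hHd : ∀ x, HasDerivAt H (f x) x := fun x => (hf.cont.integral_hasStrictDerivAt 0 x).hasDerivAt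
  have hHl : ∀ x, -1 ≤ H x := by
    intro x
    rcases le_total 0 x with h | h
    · exact prim_low hf hH0 hHd h
    · have := prim_low hf (H := fun x => H (-x)) (by simp [hH0]) (fun x => by
        have := (hHd (-x)).comp x (hasDerivAt_neg x)
        refine this.congr_deriv ?_
        rw [hf.odd]; ring) (x := -x) (by linarith)
      simpa using this
  have hHa : H a ≤ N * A := by
    have := intervalIntegral.norm_integral_le_of_norm_le_const (a := 0) (b := a) (f := f) (C := N) (fun x hx => by
      apply hf.bd
      have : x ∈ uIcc 0 a := uIoc_subset_uIcc hx
      have := abs_sub_left_of_mem_uIcc this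
      simp at this; linarith)
    rw [sub_zero] at this
    have h2 := (le_abs_self _).trans this
    exact h2.trans (mul_le_mul_of_nonneg_left ha hN)
  have c : Continuous fun x => f (w x) := hf.cont.comp hw.1
  have hR'π : R' < Real.pi := by linarith
  have hw0 : w 0 = a := by
    have := hw.2 0 ⟨le_rfl, hσ.1.trans hσ.2⟩
    simpa using this
  have hv0 : v 0 = 0 := by simp [hv, GG_zero]
  have hvc : ContinuousOn v (Icc 0 R') := by
    apply continuousOn_const.mul
    exact (GG_cont c).mono (fun x hx => ⟨hx.1, by linarith [hx.2]⟩)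
  have hHc : Continuous H := continuous_iff_continuousAt.2 fun x => (hHd x).continuousAt
  have hE : ∀ s ∈ Icc 0 R', v s ^ 2 ≤ Q := by
    intro s hs
    have hmono := mono_aux (f := fun t => -((v t ^ 2 / 2 + lam * (H (w t) + 1)) * Real.exp (-(2 * B * t)))) (a := 0) (b := s)
      hs.1 ?_ ?_
    · simp only [hv0, hw0] at hmono
      simp at hmono
      have e1 : Real.exp (-(2 * B * s)) * Real.exp (2 * B * R) ≥ 1 := by
        rw [← Real.exp_add]; apply Real.one_le_exp; nlinarith [hs.2]
      have e2 : 0 ≤ lam * (H (w s) + 1) := mul_nonneg hlam.le (by linarith [hHl (w s)])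
      have e3 : lam * (H a + 1) ≤ lam * (N * A + 1) := mul_le_mul_of_nonneg_left (by linarith) hlam.le
      have e4 := mul_le_mul_of_nonneg_right (hmono.trans e3) (Real.exp_pos (2 * B * R)).le
      have e5 : (v s ^ 2 / 2 + lam * (H (w s) + 1)) * 1 ≤
          (v s ^ 2 / 2 + lam * (H (w s) + 1)) * (Real.exp (-(2 * B * s)) * Real.exp (2 * B * R)) :=
        mul_le_mul_of_nonneg_left e1 (by positivity)
      rw [hQ]; linarith
    · have := hw.1
      have hvc' := hvc.mono (Icc_subset_Icc_right hs.2)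
      have : ContinuousOn (fun t => H (w t)) (Icc 0 s) := (hHc.comp hw.1).continuousOn
      have : ContinuousOn (fun t => Real.exp (-(2 * B * t))) (Icc 0 s) := by
        apply Continuous.continuousOn; fun_prop
      fun_prop
    · intro t ht
      have ht' : t ∈ Ioo 0 R' := ⟨ht.1, ht.2.trans_le hs.2⟩
      have d1 := hw.deriv hf.cont hR'π ht'
      have d2 := hw.deriv2 hf.cont hR'π ht'
      have d3 : HasDerivAt (fun t => Real.exp (-(2 * B * t))) (Real.exp (-(2 * B * t)) * (-(2 * B))) t := by
        have := (((hasDerivAt_id t).const_mul (2 * B)).neg).exp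
        refine this.congr_deriv ?_
        simp
      have d4 := ((((d2.pow 2).div_const 2).add ((((hHd (w t)).comp t d1).add_const 1).const_mul lam)).mul d3).neg
      refine ⟨_, ?_, d4⟩
      have b1 := hBB t ⟨ht.1, by linarith [ht.2, hs.2]⟩
      have e2 : 0 ≤ lam * (H (w t) + 1) := mul_nonneg hlam.le (by linarith [hHl (w t)])
      have e6 := Real.exp_pos (-(2 * B * t))
      simp only [Function.comp, Pi.add_apply, Pi.pow_apply]
      set vt := -lam * GG m m' (fun x => f (w x)) t with hvt
      set e := Real.exp (-(2 * B * t))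
      push_cast
      have : 0 ≤ e * ((B + BB m m' t) * vt ^ 2 + 2 * B * (lam * (H (w t) + 1))) := by
        apply mul_nonneg e6.le
        apply add_nonneg
        · apply mul_nonneg _ (sq_nonneg _); linarith
        · positivity
      refine this.trans (le_of_eq ?_)
      simp only [pow_one]
      ring
  have hvb : ∀ s ∈ Icc 0 R', |v s| ≤ Real.sqrt Q := by
    intro s hs
    exact Real.abs_le_sqrt (hE s hs)
  have h1 : w σ = a + ∫ x in (0:ℝ)..σ, v x := by
    rw [hw.2 σ hσ, hv, intervalIntegral.integral_const_mul]; ring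
  have h2 := intervalIntegral.norm_integral_le_of_norm_le_const (a := 0) (b := σ) (f := v) (C := Real.sqrt Q) (fun x hx => by
    rw [uIoc_of_le hσ.1] at hx
    exact hvb x ⟨hx.1.le, hx.2.trans hσ.2⟩)
  rw [sub_zero, abs_of_nonneg hσ.1, Real.norm_eq_abs] at h2
  rw [h1]
  refine (abs_add_le _ _).trans ?_
  have : Real.sqrt Q * σ ≤ Real.sqrt Q * R := mul_le_mul_of_nonneg_left (hσ.2.trans hR') (Real.sqrt_nonneg _)
  linarith

lemma ff_adm (hp : 1 < p) (A : ℝ) : Adm A (A ^ p + A) (ff p) := by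
  refine ⟨ff_cont hp, ff_neg p, ?_, ?_, ?_⟩
  · intro x h0 h1
    unfold ff
    have : 0 ≤ |x| ^ (p - 1) * x := by positivity
    linarith
  · intro x hx
    unfold ff
    have : 1 ≤ |x| ^ (p - 1) := Real.one_le_rpow (by rw [abs_of_nonneg] <;> linarith) (by linarith)
    nlinarith
  · intro x hx
    refine (ff_abs_le hp x).trans ?_
    have := Real.rpow_le_rpow (abs_nonneg x) hx (show 0 ≤ p by linarith)
    linarith

noncomputable def fM (p M x : ℝ) : ℝ := ff p (max (-M) (min M x))

lemma fM_eq {M x : ℝ} (h : |x| ≤ M) : fM p M x = ff p x := by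
  obtain ⟨h1, h2⟩ := abs_le.1 h
  unfold fM
  rw [min_eq_right h2, max_eq_right h1]

lemma fM_adm (hp : 1 < p) {A M : ℝ} (hA : A ≤ M) (hM : 1 ≤ M) : Adm A (A ^ p + A) (fM p M) := by
  have h := ff_adm hp A
  refine ⟨?_, ?_, ?_, ?_, ?_⟩
  · unfold fM; exact h.cont.comp (by fun_prop)
  · intro x
    unfold fM
    rw [← h.odd]
    congr 1
    grind
  · intro x h0 h1
    rw [fM_eq (by rw [abs_of_nonneg h0]; linarith)]
    exact h.low x h0 h1
  · intro x hx
    unfold fM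
    apply h.pos
    apply le_max_of_le_right
    exact le_min hM hx
  · intro x hx
    rw [fM_eq (hx.trans hA)]
    exact h.bd x hx

lemma fM_lip (hp : 1 < p) {M : ℝ} (hM : 0 < M) : ∃ L > 0, ∀ x y, |fM p M x - fM p M y| ≤ L * |x - y| := by
  obtain ⟨L, hL, h⟩ := ff_lip hp hM
  refine ⟨L, hL, fun x y => ?_⟩
  have hm : ∀ x, max (-M) (min M x) ∈ Icc (-M) M := fun x =>
    ⟨le_max_left _ _, max_le (by linarith) (min_le_left _ _)⟩
  refine (h _ (hm x) _ (hm y)).trans ?_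
  apply mul_le_mul_of_nonneg_left _ hL.le
  refine (abs_max_sub_max_le_max _ _ _ _).trans ?_
  have := abs_min_sub_min_le_max M x M y
  simp only [sub_self, abs_zero] at this ⊢
  rw [max_eq_right (abs_nonneg _)] at this ⊢
  exact this

lemma ISol.congr {g : ℝ → ℝ} (h : ISol m m' lam f R a w) (hg : ∀ σ ∈ Icc 0 R, f (w σ) = g (w σ)) :
    ISol m m' lam g R a w := by
  refine ⟨h.1, fun σ hσ => ?_⟩
  rw [h.2 σ hσ]
  congr 2
  apply intervalIntegral.integral_congr
  intro x hx
  rw [uIcc_of_le hσ.1] at hx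
  apply GG_congr hx.1
  intro τ hτ
  exact hg τ ⟨hτ.1, by linarith [hτ.2, hx.2, hσ.2]⟩

lemma true_exists (m m' : ℕ) (hlam : 0 < lam) (hp : 1 < p) (hR0 : 0 < R) (hR : R < Real.pi) (a : ℝ) :
    ∃ w, ISol m m' lam (ff p) R a w := by
  obtain ⟨M, hM⟩ := apriori m m' hlam (A := |a| + 1) (N := (|a| + 1) ^ p + (|a| + 1)) (by positivity) hR0 hR
  set M' := max M (|a| + 1) with hM'
  have h1 : |a| + 1 ≤ M' := le_max_right _ _
  have ha := abs_nonneg a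
  have hadm := fM_adm hp h1 (by linarith)
  obtain ⟨L, hL, hlip⟩ := fM_lip hp (M := M') (by linarith)
  obtain ⟨w, hw⟩ := exists0 m m' hlam hR0 hR hL _ hadm.cont hlip a
  refine ⟨w, hw.congr fun σ hσ => fM_eq ?_⟩
  exact (hM _ w R a hadm le_rfl (by linarith) hw σ hσ).trans (le_max_left _ _)

lemma true_stab (m m' : ℕ) (hlam : 0 < lam) (hp : 1 < p) (hR0 : 0 < R) (hR : R < Real.pi) {A : ℝ} (hA : 0 < A) :
    ∃ C > 0, ∀ (w1 w2 : ℝ → ℝ) (a b R' : ℝ), |a| ≤ A → |b| ≤ A → R' ≤ R →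
      ISol m m' lam (ff p) R' a w1 → ISol m m' lam (ff p) R' b w2 →
      ∀ σ ∈ Icc 0 R', |w1 σ - w2 σ| ≤ C * |a - b| ∧
        |(-lam * GG m m' (fun x => ff p (w1 x)) σ) - (-lam * GG m m' (fun x => ff p (w2 x)) σ)| ≤ C * |a - b| := by
  obtain ⟨M, hM⟩ := apriori m m' hlam (A := A) (N := A ^ p + A) hA hR0 hR
  set M' := max M (A + 1) with hM'
  have h1 : A + 1 ≤ M' := le_max_right _ _
  obtain ⟨L, hL, hlip⟩ := fM_lip hp (M := M') (by linarith)
  have hadm := fM_adm hp (A := A) (M := M') (by linarith) (by linarith)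
  obtain ⟨C, hC, hst⟩ := stab0 m m' hlam hR0 hR hL
  obtain ⟨C2, hC2, hGG⟩ := GG_bound m m' hR0 hR
  refine ⟨C + lam * (C2 * R * (L * C)), by positivity, ?_⟩
  intro w1 w2 a b R' ha hb hR' h1 h2
  have b1 := hM _ w1 R' a (ff_adm hp A) hR' ha h1
  have b2 := hM _ w2 R' b (ff_adm hp A) hR' hb h2
  have e1 : ∀ σ ∈ Icc 0 R', ff p (w1 σ) = fM p M' (w1 σ) := fun σ hσ => (fM_eq ((b1 σ hσ).trans (le_max_left _ _))).symm
  have e2 : ∀ σ ∈ Icc 0 R', ff p (w2 σ) = fM p M' (w2 σ) := fun σ hσ => (fM_eq ((b2 σ hσ).trans (le_max_left _ _))).symm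
  have i1 := h1.congr e1
  have i2 := h2.congr e2
  have key := hst _ hadm.cont hlip w1 w2 a b R' hR' i1 i2
  intro σ hσ
  have hab := abs_nonneg (a - b)
  have hQ : 0 ≤ lam * (C2 * R * (L * C)) * |a - b| := by positivity
  refine ⟨(key σ hσ).trans (by nlinarith), ?_⟩
  have c1 : Continuous fun x => ff p (w1 x) := (ff_cont hp).comp h1.1
  have c2 : Continuous fun x => ff p (w2 x) := (ff_cont hp).comp h2.1
  rw [← mul_sub, ← GG_sub c1 c2, abs_mul, abs_neg, abs_of_pos hlam]
  have := hGG (fun x => ff p (w1 x) - ff p (w2 x)) (L * (C * |a - b|)) σ hσ.1 (hσ.2.trans hR') (by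
    intro τ hτ
    have hτ' : τ ∈ Icc 0 R' := ⟨hτ.1, hτ.2.trans hσ.2⟩
    rw [e1 τ hτ', e2 τ hτ']
    exact (hlip _ _).trans (mul_le_mul_of_nonneg_left (key τ hτ') hL.le))
  have h3 : C2 * σ * (L * (C * |a - b|)) ≤ C2 * R * (L * (C * |a - b|)) := by
    apply mul_le_mul_of_nonneg_right _ (by positivity)
    exact mul_le_mul_of_nonneg_left (hσ.2.trans hR') hC2.le
  have h4 := mul_le_mul_of_nonneg_left (this.trans h3) hlam.le
  have h5 : 0 ≤ C * |a - b| := by positivity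
  linarith

structure Flow (m m' : ℕ) (lam p : ℝ) (W V : ℝ → ℝ → ℝ) : Prop where
  sol : ∀ a, Sol m m' lam p (W a) (V a)
  w0 : ∀ a, W a 0 = a
  v0 : ∀ a, V a 0 = 0
  wc : ∀ a, ContinuousOn (W a) (Ico 0 Real.pi)
  vc : ∀ a, ContinuousOn (V a) (Ico 0 Real.pi)
  stab : ∀ A R, 0 < A → 0 < R → R < Real.pi → ∃ C > 0, ∀ a b, |a| ≤ A → |b| ≤ A → ∀ σ ∈ Icc 0 R,
    |W a σ - W b σ| ≤ C * |a - b| ∧ |V a σ - V b σ| ≤ C * |a - b|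
  one : ∀ σ ∈ Ico 0 Real.pi, W 1 σ = 1
  vb : ∃ C > 0, ∀ a N, ∀ σ ∈ Icc (0:ℝ) 1, (∀ τ ∈ Icc 0 σ, |ff p (W a τ)| ≤ N) → |V a σ| ≤ C * σ * N

theorem exists_flow (m m' : ℕ) (hlam : 0 < lam) (hp : 1 < p) : ∃ W V, Flow m m' lam p W V := by
  have hpi := Real.pi_gt_three
  have hex : ∀ R a, ∃ w, 0 < R → R < Real.pi → ISol m m' lam (ff p) R a w := by
    intro R a
    by_cases h : 0 < R ∧ R < Real.pi
    · obtain ⟨w, hw⟩ := true_exists m m' hlam hp h.1 h.2 a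
      exact ⟨w, fun _ _ => hw⟩
    · exact ⟨0, fun h1 h2 => absurd ⟨h1, h2⟩ h⟩
  choose S hS using hex
  have huniq : ∀ R R' a, 0 < R → R < Real.pi → 0 < R' → R' < Real.pi → ∀ σ, 0 ≤ σ → σ ≤ R → σ ≤ R' →
      S R a σ = S R' a σ := by
    intro R R' a h1 h2 h3 h4 σ h5 h6 h7
    obtain ⟨C, hC, hst⟩ := true_stab m m' hlam hp h1 h2 (A := |a| + 1) (by positivity)
    have := (hst (S R a) (S R' a) a a (min R R') (by linarith) (by linarith) (min_le_left _ _)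
      ((hS R a h1 h2).mono (min_le_left _ _)) ((hS R' a h3 h4).mono (min_le_right _ _)) σ ⟨h5, le_min h6 h7⟩).1
    simp at this
    linarith
  set W : ℝ → ℝ → ℝ := fun a r => S ((r + Real.pi) / 2) a r with hW
  set V : ℝ → ℝ → ℝ := fun a r => -lam * GG m m' (fun x => ff p (W a x)) r with hV
  have hWS : ∀ R a, 0 < R → R < Real.pi → ∀ σ ∈ Icc 0 R, W a σ = S R a σ := by
    intro R a h1 h2 σ hσ
    exact huniq _ R a (by linarith [hσ.1]) (by linarith [hσ.2]) h1 h2 σ hσ.1 (by linarith [hσ.2]) hσ.2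
  have hVS : ∀ R a, 0 < R → R < Real.pi → ∀ σ ∈ Icc 0 R, V a σ = -lam * GG m m' (fun x => ff p (S R a x)) σ := by
    intro R a h1 h2 σ hσ
    simp only [hV]
    congr 1
    apply GG_congr hσ.1
    intro τ hτ
    rw [hWS R a h1 h2 τ ⟨hτ.1, hτ.2.trans hσ.2⟩]
  have hnear : ∀ σ ∈ Ico 0 Real.pi, ∃ R, 0 < R ∧ R < Real.pi ∧ σ < R := fun σ hσ =>
    ⟨(σ + Real.pi) / 2, by linarith [hσ.1], by linarith [hσ.2], by linarith [hσ.2]⟩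
  refine ⟨W, V, ?_, ?_, ?_, ?_, ?_, ?_, ?_, ?_⟩
  · intro a σ hσ
    obtain ⟨R, h1, h2, h3⟩ := hnear σ ⟨hσ.1.le, hσ.2⟩
    have hI := hS R a h1 h2
    have hm : ∀ᶠ x in 𝓝 σ, x ∈ Ioo 0 R := Ioo_mem_nhds hσ.1 h3
    have hσ' : σ ∈ Icc 0 R := ⟨hσ.1.le, h3.le⟩
    rw [hVS R a h1 h2 σ hσ', hWS R a h1 h2 σ hσ']
    constructor
    · apply (hI.deriv (ff_cont hp) h2 ⟨hσ.1, h3⟩).congr_of_eventuallyEq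
      filter_upwards [hm] with x hx
      exact hWS R a h1 h2 x ⟨hx.1.le, hx.2.le⟩
    · apply (hI.deriv2 (ff_cont hp) h2 ⟨hσ.1, h3⟩).congr_of_eventuallyEq
      filter_upwards [hm] with x hx
      exact hVS R a h1 h2 x ⟨hx.1.le, hx.2.le⟩
  · intro a
    rw [hWS 1 a one_pos (by linarith) 0 (by simp)]
    have := (hS 1 a one_pos (by linarith)).2 0 (by simp)
    simpa using this
  · intro a; simp [hV, GG_zero]
  · intro a σ hσ
    obtain ⟨R, h1, h2, h3⟩ := hnear σ hσ
    have hI := hS R a h1 h2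
    apply (hI.1.continuousAt.continuousWithinAt).congr_of_eventuallyEq_of_mem _ hσ
    filter_upwards [self_mem_nhdsWithin, mem_nhdsWithin_of_mem_nhds (Iio_mem_nhds h3)] with x hx hx'
    exact hWS R a h1 h2 x ⟨hx.1, le_of_lt hx'⟩
  · intro a σ hσ
    obtain ⟨R, h1, h2, h3⟩ := hnear σ hσ
    have hI := hS R a h1 h2
    have c : Continuous fun x => ff p (S R a x) := (ff_cont hp).comp hI.1
    have hc2 : ContinuousOn (fun s => -lam * GG m m' (fun x => ff p (S R a x)) s) (Ico 0 Real.pi) :=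
      continuousOn_const.mul (GG_cont c)
    apply (hc2 σ hσ).congr_of_eventuallyEq_of_mem _ hσ
    filter_upwards [self_mem_nhdsWithin, mem_nhdsWithin_of_mem_nhds (Iio_mem_nhds h3)] with x hx hx'
    exact hVS R a h1 h2 x ⟨hx.1, le_of_lt hx'⟩
  · intro A R hA h1 h2
    obtain ⟨C, hC, hst⟩ := true_stab m m' hlam hp h1 h2 hA
    refine ⟨C, hC, fun a b ha hb σ hσ => ?_⟩
    rw [hVS R a h1 h2 σ hσ, hVS R b h1 h2 σ hσ, hWS R a h1 h2 σ hσ, hWS R b h1 h2 σ hσ]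
    exact hst _ _ a b R ha hb le_rfl (hS R a h1 h2) (hS R b h1 h2) σ hσ
  · intro σ hσ
    obtain ⟨R, h1, h2, h3⟩ := hnear σ hσ
    obtain ⟨C, hC, hst⟩ := true_stab m m' hlam hp h1 h2 (A := 1) one_pos
    have hone : ISol m m' lam (ff p) R 1 (fun _ => 1) := by
      refine ⟨continuous_const, fun σ hσ => ?_⟩
      have : ∀ x, GG m m' (fun _ => ff p 1) x = 0 := fun x => by simp [GG, ff_one]
      simp [this]
    have := (hst _ _ 1 1 R (by simp) (by simp) le_rfl (hS R 1 h1 h2) hone σ ⟨hσ.1, h3.le⟩).1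
    rw [hWS R 1 h1 h2 σ ⟨hσ.1, h3.le⟩]
    simp at this; linarith
  · obtain ⟨C, hC, h⟩ := GG_bound m m' one_pos (by linarith)
    refine ⟨lam * C, by positivity, fun a N σ hσ hN => ?_⟩
    have := h (fun x => ff p (W a x)) N σ hσ.1 hσ.2 hN
    simp only [hV]
    rw [abs_mul, abs_neg, abs_of_pos hlam]
    have := mul_le_mul_of_nonneg_left this hlam.le
    linarith

end P5
end Part5
end SphODE

namespace SphODE
section Part6
open Set Filter Topology
section P6
variable {m m' : ℕ} {lam p θ s1 δ C : ℝ} {w v : ℝ → ℝ} {W V : ℝ → ℝ → ℝ}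

lemma BB_cont (m m' : ℕ) : ContinuousOn (BB m m') (Ioo 0 Real.pi) := by
  intro s hs
  obtain ⟨h1, h2⟩ := half_facts hs
  apply ContinuousAt.continuousWithinAt
  unfold BB
  have c1 : ContinuousAt (fun r : ℝ => Real.sin (r / 2)) s := by fun_prop
  have c2 : ContinuousAt (fun r : ℝ => Real.cos (r / 2)) s := by fun_prop
  exact (continuousAt_const.mul (c2.div c1 h1.ne')).sub (continuousAt_const.mul (c1.div c2 h2.ne'))

lemma Sol.contw (h : Sol m m' lam p w v) : ContinuousOn w (Ioo 0 Real.pi) :=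
  fun s hs => (h s hs).1.continuousAt.continuousWithinAt
lemma Sol.contv (h : Sol m m' lam p w v) : ContinuousOn v (Ioo 0 Real.pi) :=
  fun s hs => (h s hs).2.continuousAt.continuousWithinAt

lemma Sol.back (hlam : 0 < lam) (hp : 1 < p) (h : Sol m m' lam p w v) {r : ℝ} (hr : r ∈ Ioo 0 Real.pi) (hw : w r = 0) (hv : v r = 0)
    {e : ℝ} (he : 0 < e) (her : e ≤ r) : w e = 0 := by
  have hsub : Icc e r ⊆ Ioo 0 Real.pi := fun x hx => ⟨by linarith [hx.1], by linarith [hx.2, hr.2]⟩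
  obtain ⟨M, hM⟩ := isCompact_Icc.exists_bound_of_continuousOn (h.contw.mono hsub)
  obtain ⟨B, hB⟩ := isCompact_Icc.exists_bound_of_continuousOn ((BB_cont m m').mono hsub)
  have hB0 : 0 ≤ B := (norm_nonneg _).trans (hB r ⟨her, le_rfl⟩)
  have hM0 : 0 ≤ M := (norm_nonneg _).trans (hM r ⟨her, le_rfl⟩)
  obtain ⟨L, hL, hlip⟩ := ff_lip hp (M := M + 1) (by linarith)
  set K := 1 + 2 * B + lam * L with hK
  have hmono := mono_aux' (f := fun s => Real.exp (K * s) * (w s ^ 2 + v s ^ 2)) her ?_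
  · simp only [hw, hv] at hmono
    have := Real.exp_pos (K * e)
    simp at hmono
    have h2 : w e ^ 2 + v e ^ 2 ≤ 0 := by
      by_contra hcon
      push Not at hcon
      nlinarith
    nlinarith [sq_nonneg (w e), sq_nonneg (v e)]
  · intro s hs
    obtain ⟨h1, h2⟩ := h s (hsub hs)
    have d3 : HasDerivAt (fun t => Real.exp (K * t)) (Real.exp (K * s) * K) s := by
      have := (((hasDerivAt_id s).const_mul K)).exp
      refine this.congr_deriv ?_
      simp
    refine ⟨_, ?_, d3.mul ((h1.pow 2).add (h2.pow 2))⟩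
    have e0 := Real.exp_pos (K * s)
    have hb := hB s hs
    have hm := hM s hs
    rw [Real.norm_eq_abs] at hb hm
    obtain ⟨m1, m2⟩ := abs_le.1 hm
    obtain ⟨b1, b2⟩ := abs_le.1 hb
    have hl := hlip (w s) ⟨by linarith, by linarith⟩ 0 ⟨by linarith, by linarith⟩
    rw [ff_zero, sub_zero, sub_zero] at hl
    have k1 : 2 * (v s * ff p (w s)) ≤ L * (w s ^ 2 + v s ^ 2) := by
      calc 2 * (v s * ff p (w s)) ≤ 2 * (|v s| * |ff p (w s)|) := by
            rw [← abs_mul]; linarith [le_abs_self (v s * ff p (w s))]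
        _ ≤ 2 * (|v s| * (L * |w s|)) := by gcongr
        _ = L * (2 * |w s| * |v s|) := by ring
        _ ≤ L * (|w s| ^ 2 + |v s| ^ 2) := by gcongr; exact two_mul_le_add_sq _ _
        _ = _ := by rw [sq_abs, sq_abs]
    have k2 := mul_le_mul_of_nonneg_left k1 hlam.le
    have k3 : BB m m' s * v s ^ 2 ≤ B * v s ^ 2 := mul_le_mul_of_nonneg_right b2 (sq_nonneg _)
    have k4 : 0 ≤ B * w s ^ 2 := by positivity
    have : 0 ≤ K * (w s ^ 2 + v s ^ 2) + (2 * w s * v s + 2 * v s * (-(BB m m' s * v s) - lam * ff p (w s))) := by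
      rw [hK]; nlinarith [sq_nonneg (w s + v s)]
    have := mul_nonneg e0.le this
    refine this.trans (le_of_eq ?_)
    simp; ring

lemma Flow.nodz (hlam : 0 < lam) (hp : 1 < p) (F : Flow m m' lam p W V) {a : ℝ} (ha : a ≠ 0) :
    ∀ s ∈ Ioo 0 Real.pi, W a s = 0 → V a s ≠ 0 := by
  intro s hs hw hv
  have h1 : ∀ e ∈ Ioc 0 s, W a e = 0 := fun e he => (F.sol a).back hlam hp hs hw hv he.1 he.2
  have hc : Tendsto (W a) (𝓝[>] 0) (𝓝 (W a 0)) := by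
    have := F.wc a 0 ⟨le_rfl, Real.pi_pos⟩
    apply this.mono_left
    rw [← nhdsWithin_Ioo_eq_nhdsGT Real.pi_pos]
    exact nhdsWithin_mono _ Ioo_subset_Ico_self
  have h2 : Tendsto (W a) (𝓝[>] 0) (𝓝 0) := by
    apply tendsto_const_nhds.congr'
    filter_upwards [Ioc_mem_nhdsGT hs.1] with x hx
    exact (h1 x hx).symm
  have := tendsto_nhds_unique hc h2
  rw [F.w0] at this
  exact ha this

lemma osc (m m' : ℕ) (hlam : 0 < lam) (hp : 1 < p) {B μ : ℝ} (hμ : 0 < μ) : ∃ K : ℝ, ∀ (w v : ℝ → ℝ) (α β : ℝ),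
    Sol m m' lam p w v → α ≤ β → Icc α β ⊆ Ioo 0 Real.pi →
    (∀ s ∈ Icc α β, |BB m m' s| ≤ B) → (∀ s ∈ Icc α β, K ≤ v s ^ 2 + |w s| ^ (p + 1)) →
    2 * Real.pi < μ * (β - α) → ∃ s ∈ Icc α β, w s = 0 := by
  set Q := μ ^ 2 / 2 + lam + B ^ 2 with hQ
  have hQ0 : 0 < Q := by positivity
  obtain ⟨Cy, hCy, hy⟩ := young hp (η := lam / 2 / Q) (by positivity)
  have hmin : 0 < min (1 / 4) (lam / 2) := lt_min (by norm_num) (by linarith)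
  refine ⟨Q * Cy / min (1 / 4) (lam / 2), ?_⟩
  intro w v α β hw hab hsub hB hK hlen
  by_contra hcon
  push Not at hcon
  have hmono := mono_aux' (f := fun s => -(Real.arctan (v s / (μ * w s)) + μ / 2 * s)) hab ?_
  · have a1 := Real.arctan_lt_pi_div_two (v α / (μ * w α))
    have a2 := Real.neg_pi_div_two_lt_arctan (v β / (μ * w β))
    linarith
  · intro s hs
    obtain ⟨h1, h2⟩ := hw s (hsub hs)
    have hws := hcon s hs
    have hne : μ * w s ≠ 0 := mul_ne_zero hμ.ne' hws
    have d := (((h2.div (h1.const_mul μ) hne).arctan).add ((hasDerivAt_id s).const_mul (μ / 2))).neg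
    refine ⟨_, ?_, d⟩
    have key : (μ ^ 2 * w s ^ 2 + v s ^ 2) / 2 ≤ BB m m' s * v s * w s + lam * (w s * ff p (w s)) + v s ^ 2 := by
      rw [mul_ff hp]
      have k1 := hy (w s)
      have k2 := hK s hs
      rw [div_le_iff₀ hmin] at k2
      have k3 := hB s hs
      have k4 : Q * w s ^ 2 ≤ lam / 2 * |w s| ^ (p + 1) + Q * Cy := by
        have := mul_le_mul_of_nonneg_left k1 hQ0.le
        have e : Q * (lam / 2 / Q * |w s| ^ (p + 1) + Cy) = lam / 2 * |w s| ^ (p + 1) + Q * Cy := by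
          field_simp
        linarith
      have hX : 0 ≤ |w s| ^ (p + 1) := by positivity
      have k5 : (v s ^ 2 + |w s| ^ (p + 1)) * min (1 / 4) (lam / 2) ≤ v s ^ 2 / 4 + lam / 2 * |w s| ^ (p + 1) := by
        have q1 := mul_le_mul_of_nonneg_left (min_le_left (1 / 4 : ℝ) (lam / 2)) (sq_nonneg (v s))
        have q2 := mul_le_mul_of_nonneg_left (min_le_right (1 / 4 : ℝ) (lam / 2)) hX
        linarith
      have k6 : -(v s ^ 2 / 4 + B ^ 2 * w s ^ 2) ≤ BB m m' s * v s * w s := by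
        have q1 : (BB m m' s) ^ 2 ≤ B ^ 2 := sq_le_sq' (by linarith [(abs_le.1 k3).1]) (abs_le.1 k3).2
        have q2 := mul_le_mul_of_nonneg_right q1 (sq_nonneg (w s))
        nlinarith [sq_nonneg (v s / 2 + BB m m' s * w s)]
      have e9 : Q * w s ^ 2 = μ ^ 2 / 2 * w s ^ 2 + lam * w s ^ 2 + B ^ 2 * w s ^ 2 := by rw [hQ]; ring
      linarith
    have hD : 0 < μ ^ 2 * w s ^ 2 + v s ^ 2 := by positivity
    have e : 1 / (1 + (v / (fun y => μ * w y)) s ^ 2) * (((-(BB m m' s * v s) - lam * ff p (w s)) * (μ * w s) - v s * (μ * v s)) / (μ * w s) ^ 2)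
      = - (μ * (BB m m' s * v s * w s + lam * (w s * ff p (w s)) + v s ^ 2) / (μ ^ 2 * w s ^ 2 + v s ^ 2)) := by
      simp only [Pi.div_apply]
      have : 1 + (v s / (μ * w s)) ^ 2 = (μ ^ 2 * w s ^ 2 + v s ^ 2) / (μ * w s) ^ 2 := by
        field_simp
      rw [this]
      field_simp
      ring
    rw [e]
    have : μ / 2 ≤ μ * (BB m m' s * v s * w s + lam * (w s * ff p (w s)) + v s ^ 2) / (μ ^ 2 * w s ^ 2 + v s ^ 2) := by
      rw [le_div_iff₀ hD]
      have := mul_le_mul_of_nonneg_left key hμ.le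
      linarith
    linarith

lemma FF_le_abs (hp : 1 < p) {x a : ℝ} (ha : 1 ≤ a) (h : FF p x ≤ FF p a) : |x| ≤ a := by
  by_contra hcon
  push Not at hcon
  have hx : FF p x = FF p |x| := by
    rcases abs_cases x with h | h
    · rw [h.1]
    · rw [h.1, FF_neg]
  rw [hx] at h
  have : StrictMonoOn (FF p) (Icc a |x|) := by
    apply strictMonoOn_of_deriv_pos (convex_Icc _ _)
    · exact fun t _ => (FF_deriv hp t).continuousAt.continuousWithinAt
    · intro t ht
      rw [interior_Icc] at ht
      rw [(FF_deriv hp t).deriv]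
      unfold ff
      have ht1 : 1 < t := by linarith [ht.1]
      rw [abs_of_pos (by linarith)]
      have : 1 < t ^ (p - 1) := Real.one_lt_rpow ht1 (by linarith)
      nlinarith
  have := this ⟨le_rfl, hcon.le⟩ ⟨hcon.le, le_rfl⟩ hcon
  linarith

lemma Flow.le_a (hlam : 0 < lam) (hp : 1 < p) (F : Flow m m' lam p W V) (G : Good m m' lam p θ s1 δ C) {a : ℝ} (ha : 1 ≤ a) {r : ℝ}
    (hr : r ∈ Icc 0 s1) : |W a r| ≤ a := by
  have hs1 := G.s1le
  have hpi := Real.pi_gt_three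
  have hsub : Icc 0 r ⊆ Ico 0 Real.pi := fun x hx => ⟨hx.1, by linarith [hx.2, hr.2]⟩
  have hmono := mono_aux (f := fun s => -(V a s ^ 2 / 2 + lam * FF p (W a s))) hr.1 ?_ ?_
  · simp only [F.w0, F.v0] at hmono
    apply FF_le_abs hp ha
    have : lam * FF p (W a r) ≤ lam * FF p a := by nlinarith [sq_nonneg (V a r)]
    exact le_of_mul_le_mul_left this hlam
  · have c1 := (F.vc a).mono hsub
    have c2 : ContinuousOn (fun s => FF p (W a s)) (Icc 0 r) := by
      have : Continuous (FF p) := continuous_iff_continuousAt.2 fun x => (FF_deriv hp x).continuousAt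
      exact this.comp_continuousOn ((F.wc a).mono hsub)
    fun_prop
  · intro s hs
    obtain ⟨h1, h2⟩ := F.sol a s ⟨hs.1, by linarith [hs.2, hr.2]⟩
    have d := (((h2.pow 2).div_const 2).add (((FF_deriv hp (W a s)).comp s h1).const_mul lam)).neg
    refine ⟨_, ?_, d⟩
    have := mul_nonneg (G.Bpos s ⟨hs.1, by linarith [hs.2, hr.2]⟩) (sq_nonneg (V a s))
    refine this.trans (le_of_eq ?_)
    push_cast
    simp only [pow_one]; ring

lemma PP_up (hlam : 0 < lam) (hp : 1 < p) {Cy s : ℝ} (hCy : 0 ≤ Cy) (hy : ∀ x : ℝ, x ^ 2 ≤ 1 * |x| ^ (p + 1) + Cy)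
    (hs00 : 0 ≤ s) (h1 : s ≤ 1) :
    PP m lam p θ w v s ≤ (1 / 2 + lam + |θ|) * (v s ^ 2 + |w s| ^ (p + 1)) + |θ| * Cy := by
  have hX : 0 ≤ |w s| ^ (p + 1) := by positivity
  have q0 : FF p (w s) ≤ |w s| ^ (p + 1) := by
    unfold FF
    have : |w s| ^ (p + 1) / (p + 1) ≤ |w s| ^ (p + 1) := div_le_self hX (by linarith)
    nlinarith [sq_nonneg (w s)]
  have q1 : s ^ (m + 1) ≤ 1 := pow_le_one₀ hs00 (h1)
  have q2 : s ^ m ≤ 1 := pow_le_one₀ hs00 (h1)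
  have q3 : 0 ≤ s ^ (m + 1) := by positivity
  have q4 : 0 ≤ s ^ m := by positivity
  have q5 : v s ^ 2 / 2 + lam * FF p (w s) ≤ v s ^ 2 / 2 + lam * |w s| ^ (p + 1) := by
    have := mul_le_mul_of_nonneg_left q0 hlam.le
    linarith
  have q6 : s ^ (m + 1) * (v s ^ 2 / 2 + lam * FF p (w s)) ≤ v s ^ 2 / 2 + lam * |w s| ^ (p + 1) := by
    refine (mul_le_mul_of_nonneg_left q5 q3).trans ?_
    apply mul_le_of_le_one_left _ q1
    positivity
  have q7 : |w s * v s| ≤ v s ^ 2 + |w s| ^ (p + 1) + Cy := by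
    have := hy (w s)
    rw [abs_mul]
    have h2 := two_mul_le_add_sq |w s| |v s|
    rw [sq_abs, sq_abs] at h2
    nlinarith [sq_nonneg (v s)]
  have q8 : θ * s ^ m * (w s * v s) ≤ |θ| * (v s ^ 2 + |w s| ^ (p + 1) + Cy) := by
    refine (le_abs_self _).trans ?_
    rw [abs_mul, abs_mul, abs_of_nonneg q4]
    refine mul_le_mul ?_ q7 (abs_nonneg _) (abs_nonneg _)
    exact mul_le_of_le_one_right (abs_nonneg _) q2
  unfold PP
  have := mul_nonneg hlam.le (sq_nonneg (v s))
  linarith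

set_option maxHeartbeats 400000 in
lemma Flow.large (hm : 1 ≤ m) (hlam : 0 < lam) (hp : 1 < p) (F : Flow m m' lam p W V) (G : Good m m' lam p θ s1 δ C)
    (hγ : 0 < (p + 1) - (p - 1) * (m + 1) / 2) (K : ℝ) :
    ∃ A, ∀ a ≥ A, ∀ s ∈ Icc (s1 / 2) s1, K ≤ V a s ^ 2 + |W a s| ^ (p + 1) := by
  have hs1 := G.s1le
  have hs0 := G.s1pos
  have hδ := G.δpos
  have hC := G.Cpos
  have hpi := Real.pi_gt_three
  obtain ⟨C1, hC1, hvb⟩ := F.vb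
  set c0 := Real.sqrt (1 / (2 * C1)) with hc0
  have hc0p : 0 < c0 := Real.sqrt_pos.2 (by positivity)
  have hc0s : c0 ^ 2 = 1 / (2 * C1) := Real.sq_sqrt (by positivity)
  obtain ⟨Cy, hCy, hy⟩ := young hp (η := 1) one_pos
  set c1 := 1 / 2 + lam + |θ| with hc1
  have hc1p : 0 < c1 := by positivity
  set c2 := δ * (1 / 2) ^ (p + 1) / (m + 1) * c0 ^ (m + 1) with hc2
  have hc2p : 0 < c2 := by positivity
  have t1 := (tendsto_rpow_atTop hγ).const_mul_atTop hc2p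
  have t2 : Tendsto (fun a : ℝ => c0 * a ^ (-((p - 1) / 2))) atTop (𝓝 0) := by
    have := (tendsto_rpow_neg_atTop (y := (p - 1) / 2) (by linarith)).const_mul c0
    simpa using this
  obtain ⟨A, hA⟩ := ((t1.eventually_ge_atTop (c1 * K + |θ| * Cy + 3 * C)).and
    ((t2.eventually (gt_mem_nhds (half_pos hs0))).and (eventually_ge_atTop 1))).exists_forall_of_atTop
  refine ⟨A, fun a haA s hs => ?_⟩
  obtain ⟨g1, g2, ha⟩ := hA a haA
  have ha0 : 0 < a := by linarith
  set ρ := c0 * a ^ (-((p - 1) / 2)) with hρ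
  have hρ0 : 0 < ρ := by positivity
  have hρs : ρ ≤ s1 := by linarith
  have hle : ∀ r ∈ Icc 0 s1, |W a r| ≤ a := fun r hr => F.le_a hlam hp G ha hr
  have hff : ∀ r ∈ Icc 0 s1, |ff p (W a r)| ≤ 2 * a ^ p := by
    intro r hr
    refine (ff_abs_le hp _).trans ?_
    have q1 := Real.rpow_le_rpow (abs_nonneg _) (hle r hr) (show 0 ≤ p by linarith)
    have q2 : a ≤ a ^ p := by
      have := Real.rpow_le_rpow_of_exponent_le ha hp.le
      rwa [Real.rpow_one] at this
    linarith [hle r hr]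
  have hV : ∀ r ∈ Icc 0 s1, |V a r| ≤ C1 * r * (2 * a ^ p) := fun r hr =>
    hvb a _ r ⟨hr.1, hr.2.trans hs1⟩ (fun τ hτ => hff τ ⟨hτ.1, hτ.2.trans hr.2⟩)
  have hWl : ∀ r ∈ Icc 0 ρ, a / 2 ≤ W a r := by
    intro r hr
    have hmono := mono_aux (f := fun s => W a s + C1 * a ^ p * s ^ 2) hr.1 ?_ ?_
    · simp only [F.w0] at hmono
      have q1 : r ^ 2 ≤ ρ ^ 2 := pow_le_pow_left₀ hr.1 hr.2 2
      have q2 : C1 * a ^ p * ρ ^ 2 = a / 2 := by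
        rw [hρ, mul_pow, hc0s, ← Real.rpow_natCast (a ^ _), ← Real.rpow_mul ha0.le]
        have : a ^ p * a ^ (-((p - 1) / 2) * ((2:ℕ):ℝ)) = a := by
          rw [← Real.rpow_add ha0]
          push_cast
          rw [show p + -((p - 1) / 2) * 2 = 1 by ring, Real.rpow_one]
        calc C1 * a ^ p * (1 / (2 * C1) * a ^ (-((p - 1) / 2) * ((2:ℕ):ℝ))) =
            (C1 * (1 / (2 * C1))) * (a ^ p * a ^ (-((p - 1) / 2) * ((2:ℕ):ℝ))) := by ring
          _ = _ := by rw [this]; field_simp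
      have q3 : C1 * a ^ p * r ^ 2 ≤ C1 * a ^ p * ρ ^ 2 := mul_le_mul_of_nonneg_left q1 (by positivity)
      norm_num at hmono
      linarith
    · have := (F.wc a).mono (show Icc 0 r ⊆ Ico 0 Real.pi from fun x hx => ⟨hx.1, by linarith [hx.2, hr.2]⟩)
      fun_prop
    · intro t ht
      have d := (F.sol a t ⟨ht.1, by linarith [ht.2, hr.2]⟩).1.add ((hasDerivAt_pow 2 t).const_mul (C1 * a ^ p))
      refine ⟨_, ?_, d⟩
      have := (abs_le.1 (hV t ⟨ht.1.le, by linarith [ht.2, hr.2]⟩)).1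
      push_cast
      simp only [pow_one]
      linarith
  have hPρ : c2 * a ^ ((p + 1) - (p - 1) * (m + 1) / 2) - C ≤ PP m lam p θ (W a) (V a) ρ := by
    set Y := δ * (a / 2) ^ (p + 1) - C with hY
    have hmono := mono_aux (f := fun s => PP m lam p θ (W a) (V a) s - Y * (s ^ (m + 1) / (m + 1))) hρ0.le ?_ ?_
    · have hP0 : PP m lam p θ (W a) (V a) 0 = 0 := by simp [PP, F.v0]
      simp only [hP0] at hmono
      have e0 : (0:ℝ) ^ (m + 1) = 0 := by simp
      rw [e0, zero_div, mul_zero, sub_zero] at hmono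
      have q1 : ρ ^ (m + 1) / (m + 1) ≤ 1 := by
        rw [div_le_one (by positivity)]
        have := pow_le_one₀ (n := m + 1) hρ0.le (hρs.trans hs1)
        have : (0:ℝ) ≤ m := by positivity
        linarith
      have q2 := mul_le_mul_of_nonneg_left q1 hC.le
      have q3 : δ * (a / 2) ^ (p + 1) * (ρ ^ (m + 1) / (m + 1)) = c2 * a ^ ((p + 1) - (p - 1) * (m + 1) / 2) := by
        rw [hc2, hρ, mul_pow, ← Real.rpow_natCast (a ^ _), ← Real.rpow_mul ha0.le,
          div_eq_mul_inv a 2, Real.mul_rpow ha0.le (by norm_num), one_div]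
        have : a ^ (p + 1 - (p - 1) * (m + 1) / 2) = a ^ (p + 1) * a ^ (-((p - 1) / 2) * ((m + 1 : ℕ):ℝ)) := by
          rw [← Real.rpow_add ha0]
          push_cast
          congr 1; ring
        rw [this]; ring
      rw [hY, sub_mul] at hmono
      linarith
    · have hsub : Icc 0 ρ ⊆ Ico 0 Real.pi := fun x hx => ⟨hx.1, by linarith [hx.2]⟩
      have k1 := (F.wc a).mono hsub
      have k2 := (F.vc a).mono hsub
      have k3 : ContinuousOn (fun s => FF p (W a s)) (Icc 0 ρ) := by
        have : Continuous (FF p) := continuous_iff_continuousAt.2 fun x => (FF_deriv hp x).continuousAt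
        exact this.comp_continuousOn k1
      unfold PP
      fun_prop
    · intro t ht
      obtain ⟨d, hd, hdl⟩ := G.mono _ _ (F.sol a) t ⟨ht.1, by linarith [ht.2]⟩
      have d2 := hd.sub ((((hasDerivAt_pow (m + 1) t).div_const ((m:ℝ) + 1))).const_mul Y)
      refine ⟨_, ?_, d2⟩
      have q1 : (a / 2) ^ (p + 1) ≤ |W a t| ^ (p + 1) := by
        apply Real.rpow_le_rpow (by linarith) _ (by linarith)
        exact (hWl t ⟨ht.1.le, ht.2.le⟩).trans (le_abs_self _)
      have q2 : Y ≤ δ * (V a t ^ 2 + |W a t| ^ (p + 1)) - C := by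
        rw [hY]
        have := mul_le_mul_of_nonneg_left q1 hδ.le
        nlinarith [sq_nonneg (V a t)]
      have q3 := mul_le_mul_of_nonneg_left q2 (pow_nonneg ht.1.le m)
      have : Y * (((m + 1 : ℕ) : ℝ) * t ^ (m + 1 - 1) / (m + 1)) = t ^ m * Y := by
        simp; field_simp
      rw [this]; linarith
  have hPs := G.mono1 (F.sol a) hρ0 (show ρ ≤ s by linarith [hs.1]) hs.2
  have hs00 : 0 ≤ s := by linarith [hs.1]
  have hup : PP m lam p θ (W a) (V a) s ≤ c1 * (V a s ^ 2 + |W a s| ^ (p + 1)) + |θ| * Cy := by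
    exact PP_up hlam hp hCy.le hy hs00 (hs.2.trans hs1)
  have : c1 * K ≤ c1 * (V a s ^ 2 + |W a s| ^ (p + 1)) := by linarith
  exact le_of_mul_le_mul_left this hc1p

def HasZ (j : ℕ) (w : ℝ → ℝ) : Prop := ∃ S : Finset ℝ, S.card = j ∧ ∀ x ∈ S, x ∈ Ioo 0 Real.pi ∧ w x = 0

lemma Flow.manyzeros (hm : 1 ≤ m) (hlam : 0 < lam) (hp : 1 < p) (F : Flow m m' lam p W V) (G : Good m m' lam p θ s1 δ C)
    (hγ : 0 < (p + 1) - (p - 1) * (m + 1) / 2) (j : ℕ) :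
    ∃ A, ∀ a ≥ A, HasZ j (W a) := by
  have hs1 := G.s1le
  have hs0 := G.s1pos
  have hpi := Real.pi_gt_three
  have hsub : Icc (s1 / 2) s1 ⊆ Ioo 0 Real.pi := fun x hx => ⟨by linarith [hx.1], by linarith [hx.2]⟩
  obtain ⟨B, hB⟩ := isCompact_Icc.exists_bound_of_continuousOn ((BB_cont m m').mono hsub)
  set h := s1 / (2 * (j + 1)) with hh
  have hh0 : 0 < h := by positivity
  obtain ⟨K, hK⟩ := osc m m' hlam hp (B := B) (μ := (2 * Real.pi + 1) / (h / 2)) (by positivity)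
  obtain ⟨A, hA⟩ := F.large hm hlam hp G hγ K
  refine ⟨A, fun a ha => ?_⟩
  have hex : ∀ i : Fin j, ∃ s ∈ Icc (s1 / 2 + i * h) (s1 / 2 + i * h + h / 2), W a s = 0 := by
    intro i
    have hi : ((i : ℕ) : ℝ) + 1 ≤ j := by exact_mod_cast i.2
    have hi0 : (0:ℝ) ≤ (i : ℕ) := by positivity
    have e : h * (2 * (j + 1)) = s1 := by rw [hh]; field_simp
    have hsub2 : Icc (s1 / 2 + i * h) (s1 / 2 + i * h + h / 2) ⊆ Icc (s1 / 2) s1 := by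
      intro x hx
      constructor
      · have := mul_nonneg hi0 hh0.le
        linarith [hx.1]
      · have : (i : ℕ) * h ≤ (j - 1) * h := mul_le_mul_of_nonneg_right (by linarith) hh0.le
        nlinarith [hx.2]
    apply hK _ _ _ _ (F.sol a) (by linarith) (hsub2.trans hsub) (fun s hs => hB s (hsub2 hs)) (fun s hs => hA a ha s (hsub2 hs))
    have : (2 * Real.pi + 1) / (h / 2) * (s1 / 2 + i * h + h / 2 - (s1 / 2 + i * h)) = 2 * Real.pi + 1 := by
      rw [add_sub_cancel_left]; field_simp
    rw [this]; linarith
  choose x hx hx0 using hex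
  have hinj : StrictMono x := by
    intro i i' hii
    have h1 := (hx i).2
    have h2 := (hx i').1
    have : ((i : ℕ) : ℝ) + 1 ≤ (i' : ℕ) := by exact_mod_cast hii
    nlinarith
  refine ⟨Finset.univ.image x, ?_, ?_⟩
  · rw [Finset.card_image_of_injective _ hinj.injective]; simp
  · intro y hy
    simp at hy
    obtain ⟨i, rfl⟩ := hy
    refine ⟨?_, hx0 i⟩
    apply hsub
    have hi : ((i : ℕ) : ℝ) + 1 ≤ j := by exact_mod_cast i.2
    have hi0 : (0:ℝ) ≤ (i : ℕ) := by positivity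
    have e : h * (2 * (j + 1)) = s1 := by rw [hh]; field_simp
    constructor
    · have := mul_nonneg hi0 hh0.le
      linarith [(hx i).1]
    · have : (i : ℕ) * h ≤ (j - 1) * h := mul_le_mul_of_nonneg_right (by linarith) hh0.le
      nlinarith [(hx i).2]

end P6
end Part6
end SphODE

namespace SphODE
section Part7
open Set Filter Topology
section P7
variable {m m' : ℕ} {lam p θ s1 δ C : ℝ} {w v : ℝ → ℝ} {W V : ℝ → ℝ → ℝ}

lemma Flow.stab' (F : Flow m m' lam p W V) (a0 : ℝ) {R : ℝ} (hR0 : 0 < R) (hR : R < Real.pi) :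
    ∃ C > 0, ∀ᶠ a in 𝓝 a0, ∀ σ ∈ Icc 0 R, |W a σ - W a0 σ| ≤ C * |a - a0| ∧ |V a σ - V a0 σ| ≤ C * |a - a0| := by
  obtain ⟨C, hC, h⟩ := F.stab (|a0| + 1) R (by positivity) hR0 hR
  refine ⟨C, hC, ?_⟩
  filter_upwards [Metric.ball_mem_nhds a0 one_pos] with a ha σ hσ
  apply h a a0 _ (by linarith) σ hσ
  rw [Metric.mem_ball, Real.dist_eq] at ha
  have := abs_sub_abs_le_abs_sub a a0
  linarith

lemma tend_of_stab {Φ : ℝ → ℝ → ℝ} {a0 C σ : ℝ} (h : ∀ᶠ a in 𝓝 a0, |Φ a σ - Φ a0 σ| ≤ C * |a - a0|) :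
    Tendsto (fun a => Φ a σ) (𝓝 a0) (𝓝 (Φ a0 σ)) := by
  rw [tendsto_iff_dist_tendsto_zero]
  apply squeeze_zero' (g := fun a => C * |a - a0|)
  · exact Eventually.of_forall fun _ => dist_nonneg
  · exact h
  · have : Tendsto (fun a => C * |a - a0|) (𝓝 a0) (𝓝 (C * |a0 - a0|)) := by
      apply Continuous.tendsto; fun_prop
    simpa using this

lemma Flow.tendW (F : Flow m m' lam p W V) (a0 : ℝ) {σ : ℝ} (hσ : σ ∈ Ioo 0 Real.pi) :
    Tendsto (fun a => W a σ) (𝓝 a0) (𝓝 (W a0 σ)) := by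
  obtain ⟨C, hC, h⟩ := F.stab' a0 hσ.1 hσ.2
  exact tend_of_stab (C := C) (h.mono fun a ha => (ha σ ⟨hσ.1.le, le_rfl⟩).1)

lemma Flow.tendV (F : Flow m m' lam p W V) (a0 : ℝ) {σ : ℝ} (hσ : σ ∈ Ioo 0 Real.pi) :
    Tendsto (fun a => V a σ) (𝓝 a0) (𝓝 (V a0 σ)) := by
  obtain ⟨C, hC, h⟩ := F.stab' a0 hσ.1 hσ.2
  exact tend_of_stab (C := C) (h.mono fun a ha => (ha σ ⟨hσ.1.le, le_rfl⟩).2)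

lemma Flow.tendPP (hp : 1 < p) (F : Flow m m' lam p W V) (a0 : ℝ) (k : ℕ) {s : ℝ} (hs : s ∈ Ioo 0 Real.pi) :
    Tendsto (fun a => PP k lam p θ (fun s => W a (Real.pi - s)) (fun s => - V a (Real.pi - s)) s) (𝓝 a0)
      (𝓝 (PP k lam p θ (fun s => W a0 (Real.pi - s)) (fun s => - V a0 (Real.pi - s)) s)) := by
  have hs' : Real.pi - s ∈ Ioo 0 Real.pi := ⟨by linarith [hs.2], by linarith [hs.1]⟩
  have h1 := F.tendW a0 hs'
  have h2 := (F.tendV a0 hs').neg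
  have h3 := ((FF_deriv hp (W a0 (Real.pi - s))).continuousAt.tendsto).comp h1
  unfold PP
  exact (((h2.pow 2).div_const 2).add (h3.const_mul lam)).const_mul _ |>.add ((h1.mul h2).const_mul _)

lemma Flow.near_zero (hlam : 0 < lam) (hp : 1 < p) (F : Flow m m' lam p W V) {a0 : ℝ} (ha : a0 ≠ 0) {x : ℝ} (hx : x ∈ Ioo 0 Real.pi)
    (hx0 : W a0 x = 0) {U : Set ℝ} (hU : U ∈ 𝓝 x) : ∀ᶠ a in 𝓝 a0, ∃ y ∈ U, y ∈ Ioo 0 Real.pi ∧ W a y = 0 := by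
  have hU' : U ∩ Ioo 0 Real.pi ∈ 𝓝 x := inter_mem hU (Ioo_mem_nhds hx.1 hx.2)
  obtain ⟨η, hη, hball⟩ := Metric.mem_nhds_iff.1 hU'
  have hd := (F.sol a0 x hx).1
  have hv := F.nodz hlam hp ha x hx hx0
  have key : ∃ y ∈ Metric.ball x η, ∃ z ∈ Metric.ball x η, W a0 y < 0 ∧ 0 < W a0 z := by
    have hsl := hasDerivAt_iff_tendsto_slope.1 hd
    rcases lt_or_gt_of_ne hv with h | h
    · have ev := (hsl.eventually (gt_mem_nhds h))
      have evR : ∀ᶠ y in 𝓝[>] x, slope (W a0) x y < 0 := ev.filter_mono (nhdsWithin_mono _ (fun y hy => ne_of_gt hy))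
      have evL : ∀ᶠ y in 𝓝[<] x, slope (W a0) x y < 0 := ev.filter_mono (nhdsWithin_mono _ (fun y hy => ne_of_lt hy))
      have sR : ∀ᶠ y in 𝓝[>] x, x < y := self_mem_nhdsWithin
      have sL : ∀ᶠ z in 𝓝[<] x, z < x := self_mem_nhdsWithin
      have bR : ∀ᶠ y in 𝓝[>] x, y ∈ Metric.ball x η := mem_nhdsWithin_of_mem_nhds (Metric.ball_mem_nhds x hη)
      have bL : ∀ᶠ y in 𝓝[<] x, y ∈ Metric.ball x η := mem_nhdsWithin_of_mem_nhds (Metric.ball_mem_nhds x hη)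
      obtain ⟨y, hy1, hy2, hy3⟩ := (evR.and (sR.and bR)).exists
      obtain ⟨z, hz1, hz2, hz3⟩ := (evL.and (sL.and bL)).exists
      have hy2 : x < y := hy2
      have hz2 : z < x := hz2
      refine ⟨y, hy3, z, hz3, ?_, ?_⟩
      · rw [slope_def_field, hx0, sub_zero, div_lt_iff₀ (by linarith)] at hy1
        linarith
      · rw [slope_def_field, hx0, sub_zero, div_lt_iff_of_neg (by linarith)] at hz1
        linarith
    · have ev := (hsl.eventually (lt_mem_nhds h))
      have evR : ∀ᶠ y in 𝓝[>] x, 0 < slope (W a0) x y := ev.filter_mono (nhdsWithin_mono _ (fun y hy => ne_of_gt hy))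
      have evL : ∀ᶠ y in 𝓝[<] x, 0 < slope (W a0) x y := ev.filter_mono (nhdsWithin_mono _ (fun y hy => ne_of_lt hy))
      have sR : ∀ᶠ y in 𝓝[>] x, x < y := self_mem_nhdsWithin
      have sL : ∀ᶠ z in 𝓝[<] x, z < x := self_mem_nhdsWithin
      have bR : ∀ᶠ y in 𝓝[>] x, y ∈ Metric.ball x η := mem_nhdsWithin_of_mem_nhds (Metric.ball_mem_nhds x hη)
      have bL : ∀ᶠ y in 𝓝[<] x, y ∈ Metric.ball x η := mem_nhdsWithin_of_mem_nhds (Metric.ball_mem_nhds x hη)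
      obtain ⟨y, hy1, hy2, hy3⟩ := (evR.and (sR.and bR)).exists
      obtain ⟨z, hz1, hz2, hz3⟩ := (evL.and (sL.and bL)).exists
      have hy2 : x < y := hy2
      have hz2 : z < x := hz2
      refine ⟨z, hz3, y, hy3, ?_, ?_⟩
      · rw [slope_def_field, hx0, sub_zero, lt_div_iff_of_neg (by linarith)] at hz1
        linarith
      · rw [slope_def_field, hx0, sub_zero, lt_div_iff₀ (by linarith)] at hy1
        linarith
  obtain ⟨y, hy, z, hz, hy0, hz0⟩ := key
  have e1 := (F.tendW a0 (hball hy).2).eventually (gt_mem_nhds hy0)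
  have e2 := (F.tendW a0 (hball hz).2).eventually (lt_mem_nhds hz0)
  filter_upwards [e1, e2] with a h1 h2
  have hconn : IsPreconnected (Metric.ball x η) := (convex_ball x η).isPreconnected
  have hcont : ContinuousOn (W a) (Metric.ball x η) := (F.sol a).contw.mono (fun t ht => (hball ht).2)
  obtain ⟨t, ht, ht0⟩ := hconn.intermediate_value hy hz hcont (show (0:ℝ) ∈ Icc (W a y) (W a z) from ⟨h1.le, h2.le⟩)
  exact ⟨t, (hball ht).1, (hball ht).2, ht0⟩

lemma Flow.open_zeros (hlam : 0 < lam) (hp : 1 < p) (F : Flow m m' lam p W V) {a0 : ℝ} (ha : a0 ≠ 0) {j : ℕ} (h : HasZ j (W a0)) :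
    ∀ᶠ a in 𝓝 a0, HasZ j (W a) := by
  obtain ⟨S, hS, hz⟩ := h
  obtain ⟨U, hU, hdis⟩ := (S.finite_toSet).t2_separation
  have : ∀ᶠ a in 𝓝 a0, ∀ x ∈ S, ∃ y ∈ U x, y ∈ Ioo 0 Real.pi ∧ W a y = 0 := by
    rw [Filter.eventually_all_finset]
    intro x hx
    exact F.near_zero hlam hp ha (hz x hx).1 (hz x hx).2 ((hU x).2.mem_nhds (hU x).1)
  filter_upwards [this] with a hax
  choose! g hg1 hg2 using hax
  refine ⟨S.image g, ?_, ?_⟩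
  · rw [Finset.card_image_of_injOn, hS]
    intro x hx y hy hxy
    by_contra hne
    have := hdis hx hy hne
    exact (disjoint_left.1 this) (hg1 x hx) (by rw [hxy]; exact hg1 y hy)
  · intro y hy
    obtain ⟨x, hx, rfl⟩ := Finset.mem_image.1 hy
    exact hg2 x hx

lemma near_ne {Φ : ℝ → ℝ → ℝ} {a0 C R x : ℝ} (hC : 0 < C) (hc : ContinuousOn (Φ a0) (Icc 0 R))
    (h : ∀ᶠ a in 𝓝 a0, ∀ σ ∈ Icc 0 R, |Φ a σ - Φ a0 σ| ≤ C * |a - a0|) (hx : x ∈ Icc 0 R) (hne : Φ a0 x ≠ 0) :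
    ∃ η > 0, ∀ᶠ a in 𝓝 a0, ∀ y ∈ Icc 0 R, y ∈ Metric.ball x η → Φ a y ≠ 0 := by
  set d := |Φ a0 x| with hd
  have hd0 : 0 < d := abs_pos.2 hne
  obtain ⟨η, hη, hb⟩ := Metric.continuousWithinAt_iff.1 (hc x hx) (d / 2) (by linarith)
  refine ⟨η, hη, ?_⟩
  filter_upwards [h, Metric.ball_mem_nhds a0 (show 0 < d / (2 * C) by positivity)] with a h1 h2 y hy hyb h0
  have k1 := h1 y hy
  have k2 := hb hy hyb
  rw [Metric.mem_ball, Real.dist_eq, lt_div_iff₀ (by positivity)] at h2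
  rw [Real.dist_eq] at k2
  rw [h0, zero_sub, abs_neg] at k1
  have := abs_sub_abs_le_abs_sub (Φ a0 x) (Φ a0 y)
  rw [abs_sub_comm] at this
  linarith

lemma Flow.upper_zeros (hlam : 0 < lam) (hp : 1 < p) (F : Flow m m' lam p W V) {a0 : ℝ} (ha : a0 ≠ 0) {R : ℝ} (hR0 : 0 < R)
    (hR : R < Real.pi) : ∀ᶠ a in 𝓝 a0, ∀ S : Finset ℝ, (∀ x ∈ S, x ∈ Icc 0 R ∧ W a x = 0) → HasZ S.card (W a0) := by
  obtain ⟨C, hC, hst⟩ := F.stab' a0 hR0 hR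
  have hsub : Icc 0 R ⊆ Ico 0 Real.pi := fun x hx => ⟨hx.1, by linarith [hx.2]⟩
  have hloc : ∀ x ∈ Icc 0 R, ∃ U ∈ 𝓝 x, ∀ᶠ a in 𝓝 a0, (∀ y ∈ U, y ∈ Icc 0 R → W a y = 0 → W a0 x = 0) ∧
      (∀ y ∈ U, ∀ z ∈ U, y ∈ Icc 0 R → z ∈ Icc 0 R → W a y = 0 → W a z = 0 → y = z) := by
    intro x hx
    by_cases h0 : W a0 x = 0
    · have hx0 : x ≠ 0 := by
        rintro rfl
        rw [F.w0] at h0; exact ha h0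
      have hxI : x ∈ Ioo 0 Real.pi := ⟨lt_of_le_of_ne hx.1 (Ne.symm hx0), by linarith [hx.2]⟩
      obtain ⟨η, hη, hev⟩ := near_ne hC ((F.vc a0).mono hsub) (hst.mono fun a h σ hσ => (h σ hσ).2) hx
        (F.nodz hlam hp ha x hxI h0)
      refine ⟨Metric.ball x η, Metric.ball_mem_nhds x hη, ?_⟩
      filter_upwards [hev] with a hne
      refine ⟨fun _ _ _ _ => h0, ?_⟩
      have main : ∀ y ∈ Metric.ball x η, ∀ z ∈ Metric.ball x η, y ∈ Icc 0 R → z ∈ Icc 0 R → W a y = 0 → W a z = 0 → ¬ y < z := by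
        intro y hy z hz hyR hzR hy0 hz0 hlt
        obtain ⟨c, hc, hc0⟩ := exists_hasDerivAt_eq_zero (f := W a) (f' := V a) hlt
          ((F.wc a).mono (fun t ht => ⟨hyR.1.trans ht.1, by linarith [ht.2, hzR.2]⟩)) (by rw [hy0, hz0])
          (fun t ht => (F.sol a t ⟨by linarith [hyR.1, ht.1], by linarith [ht.2, hzR.2]⟩).1)
        refine hne c ⟨by linarith [hyR.1, hc.1], by linarith [hc.2, hzR.2]⟩ ?_ hc0
        exact (convex_ball x η).ordConnected.out hy hz ⟨hc.1.le, hc.2.le⟩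
      intro y hy z hz hyR hzR hy0 hz0
      rcases lt_trichotomy y z with h | h | h
      · exact absurd h (main y hy z hz hyR hzR hy0 hz0)
      · exact h
      · exact absurd h (main z hz y hy hzR hyR hz0 hy0)
    · obtain ⟨η, hη, hev⟩ := near_ne hC ((F.wc a0).mono hsub) (hst.mono fun a h σ hσ => (h σ hσ).1) hx h0
      refine ⟨Metric.ball x η, Metric.ball_mem_nhds x hη, ?_⟩
      filter_upwards [hev] with a hne
      exact ⟨fun y hy hyR hy0 => absurd hy0 (hne y hyR hy), fun y hy z _ hyR _ hy0 _ => absurd hy0 (hne y hyR hy)⟩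
  choose! U hU hev using hloc
  obtain ⟨t, ht, hcov⟩ := isCompact_Icc.elim_nhds_subcover U hU
  have hall : ∀ᶠ a in 𝓝 a0, ∀ x ∈ t, (∀ y ∈ U x, y ∈ Icc 0 R → W a y = 0 → W a0 x = 0) ∧
      (∀ y ∈ U x, ∀ z ∈ U x, y ∈ Icc 0 R → z ∈ Icc 0 R → W a y = 0 → W a z = 0 → y = z) := by
    rw [Filter.eventually_all_finset]
    exact fun x hx => hev x (ht x hx)
  filter_upwards [hall] with a hal S hS
  have hch : ∀ y ∈ S, ∃ x ∈ t, y ∈ U x := by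
    intro y hy
    have := hcov (hS y hy).1
    simpa using this
  choose! g hg1 hg2 using hch
  refine ⟨S.image g, ?_, ?_⟩
  · apply Finset.card_image_of_injOn
    intro y hy z hz hyz
    exact (hal (g y) (hg1 y hy)).2 y (hg2 y hy) z (by rw [hyz]; exact hg2 z hz) (hS y hy).1 (hS z hz).1 (hS y hy).2 (hS z hz).2
  · intro x hx
    obtain ⟨y, hy, rfl⟩ := Finset.mem_image.1 hx
    have h0 := (hal (g y) (hg1 y hy)).1 y (hg2 y hy) (hS y hy).1 (hS y hy).2
    have hgR := ht _ (hg1 y hy)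
    refine ⟨⟨lt_of_le_of_ne hgR.1 ?_, by linarith [hgR.2]⟩, h0⟩
    intro h
    rw [← h, F.w0] at h0; exact ha h0

lemma endpoint (hm : 1 ≤ m) (hlam : 0 < lam) (hp : 1 < p) (hw : Sol m m' lam p w v) {s3 M : ℝ} (hs3 : 0 < s3) (hs31 : s3 ≤ 1)
    (hB : ∀ s ∈ Ioc 0 s3, 0 ≤ BB m m' s)
    (hM : ∀ s ∈ Ioc 0 s3, |w s| ≤ M ∧ |v s| ≤ M * s) :
    ∃ b, Tendsto w (𝓝[>] 0) (𝓝 b) ∧ Tendsto v (𝓝[>] 0) (𝓝 0) ∧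
      (∃ c, Tendsto (fun s => -(BB m m' s * v s) - lam * ff p (w s)) (𝓝[>] 0) (𝓝 c)) ∧
      (b = 0 → w s3 = 0 ∧ v s3 = 0) := by
  have hpi := Real.pi_gt_three
  have hM0 : 0 ≤ M := (abs_nonneg _).trans (hM s3 ⟨hs3, le_rfl⟩).1
  have hin : ∀ s ∈ Ioc 0 s3, s ∈ Ioo 0 Real.pi := fun s hs => ⟨hs.1, by linarith [hs.2]⟩
  have hmem : ∀ᶠ s in 𝓝[>] (0:ℝ), s ∈ Ioc 0 s3 := Ioc_mem_nhdsGT hs3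
  have hlip : LipschitzOnWith (Real.toNNReal M) w (Ioc 0 s3) := by
    apply LipschitzOnWith.of_dist_le_mul
    intro x hx y hy
    rw [Real.coe_toNNReal _ hM0]
    have := (convex_Ioc 0 s3).norm_image_sub_le_of_norm_hasDerivWithin_le (f := w) (f' := v) (C := M)
      (fun x hx => (hw x (hin x hx)).1.hasDerivWithinAt) (fun x hx => by
        have h1 := (hM x hx).2
        rw [Real.norm_eq_abs]
        nlinarith [hx.1, hx.2]) hy hx
    simpa [Real.dist_eq] using this
  obtain ⟨g, hg, hgw⟩ := hlip.extend_real
  have hwb : Tendsto w (𝓝[>] 0) (𝓝 (g 0)) := by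
    have := (hg.continuous.tendsto 0).mono_left (nhdsWithin_le_nhds (s := Ioi 0))
    apply this.congr'
    filter_upwards [hmem] with s hs
    exact (hgw hs).symm
  have hv0 : Tendsto v (𝓝[>] 0) (𝓝 0) := by
    apply squeeze_zero_norm' (a := fun s => M * s)
    · filter_upwards [hmem] with s hs
      exact (hM s hs).2
    · have : Tendsto (fun s : ℝ => M * s) (𝓝 0) (𝓝 (M * 0)) := by apply Continuous.tendsto; fun_prop
      simpa using this.mono_left nhdsWithin_le_nhds
  have hsB : Tendsto (fun s => s * BB m m' s) (𝓝[>] 0) (𝓝 m) := by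
    obtain ⟨C, hC, h⟩ := BB_bound m m'
    have : Tendsto (fun s => s * BB m m' s - m) (𝓝[>] 0) (𝓝 0) := by
      apply squeeze_zero_norm' (a := fun s => s * C)
      · filter_upwards [hmem] with s hs
        have := h s ⟨hs.1, hs.2.trans hs31⟩
        have e : s * BB m m' s - m = s * (BB m m' s - m / s) := by
          have := hs.1.ne'
          field_simp
        rw [e, norm_mul, Real.norm_eq_abs, Real.norm_eq_abs, abs_of_pos hs.1]
        exact mul_le_mul_of_nonneg_left this hs.1.le
      · have : Tendsto (fun s : ℝ => s * C) (𝓝 0) (𝓝 (0 * C)) := by apply Continuous.tendsto; fun_prop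
        simpa using this.mono_left nhdsWithin_le_nhds
    simpa using this.add_const (m:ℝ)
  have hffb := ((ff_cont hp).tendsto (g 0)).comp hwb
  have hm1 : (0:ℝ) < 1 + m := by positivity
  have hvs : Tendsto (fun s => v s / s) (𝓝[>] 0) (𝓝 (-(lam * ff p (g 0)) / (1 + m))) := by
    have homc : Tendsto (om m m') (𝓝[>] 0) (𝓝 (om m m' 0)) := ((om_cont m m').tendsto 0).mono_left nhdsWithin_le_nhds
    have hlop := HasDerivAt.lhopital_zero_nhdsGT (a := 0) (f := fun s => om m m' s * v s) (g := fun s => s * om m m' s)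
      (f' := fun s => om m m' s * (-(lam * ff p (w s)))) (g' := fun s => om m m' s * (1 + s * BB m m' s))
      (l := 𝓝 (-(lam * ff p (g 0)) / (1 + m))) ?_ ?_ ?_ ?_ ?_ ?_
    · apply hlop.congr'
      filter_upwards [hmem] with s hs
      have := (om_pos m m' (hin s hs)).ne'
      have := hs.1.ne'
      field_simp
    · filter_upwards [hmem] with s hs
      refine ((om_deriv m m' (hin s hs)).mul (hw s (hin s hs)).2).congr_deriv ?_
      ring
    · filter_upwards [hmem] with s hs
      refine ((hasDerivAt_id s).mul (om_deriv m m' (hin s hs))).congr_deriv ?_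
      simp; ring
    · filter_upwards [hmem] with s hs
      have := (om_pos m m' (hin s hs))
      have := mul_nonneg hs.1.le (hB s hs)
      positivity
    · simpa using homc.mul hv0
    · have : Tendsto (fun s : ℝ => s) (𝓝[>] 0) (𝓝 0) := tendsto_id.mono_left nhdsWithin_le_nhds
      simpa using this.mul homc
    · have : Tendsto (fun s => -(lam * ff p (w s)) / (1 + s * BB m m' s)) (𝓝[>] 0) (𝓝 (-(lam * ff p (g 0)) / (1 + m))) :=
        ((hffb.const_mul lam).neg).div (hsB.const_add 1) hm1.ne'
      apply this.congr'
      filter_upwards [hmem] with s hs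
      have := (om_pos m m' (hin s hs)).ne'
      rw [mul_div_mul_left _ _ this]
  refine ⟨g 0, hwb, hv0, ?_, ?_⟩
  · refine ⟨_, (((hsB.mul hvs).neg).sub (hffb.const_mul lam)).congr' ?_⟩
    filter_upwards [hmem] with s hs
    have := hs.1.ne'
    simp only [Function.comp]
    field_simp
  · intro hb
    have hE : ∀ s ∈ Ioc 0 s3, v s ^ 2 / 2 + lam * FF p (w s) ≤ 0 := by
      intro s hs
      have hlim : Tendsto (fun t => v t ^ 2 / 2 + lam * FF p (w t)) (𝓝[>] 0) (𝓝 0) := by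
        have h1 := ((FF_deriv hp (g 0)).continuousAt.tendsto).comp hwb
        have := ((hv0.pow 2).div_const 2).add (h1.const_mul lam)
        simpa [hb, FF_zero hp] using this
      apply ge_of_tendsto hlim
      filter_upwards [Ioc_mem_nhdsGT hs.1] with t ht
      have hmono := mono_aux' (f := fun t => -(v t ^ 2 / 2 + lam * FF p (w t))) ht.2 ?_
      · linarith
      · intro r hr
        have hr' : r ∈ Ioc 0 s3 := ⟨by linarith [ht.1, hr.1], by linarith [hr.2, hs.2]⟩
        obtain ⟨h1, h2⟩ := hw r (hin r hr')
        have d := (((h2.pow 2).div_const 2).add (((FF_deriv hp (w r)).comp r h1).const_mul lam)).neg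
        refine ⟨_, ?_, d⟩
        refine (mul_nonneg (hB r hr') (sq_nonneg (v r))).trans (le_of_eq ?_)
        push_cast
        simp only [pow_one]; ring
    set q := lam + 1 with hq
    have hvw : ∀ s ∈ Ioc 0 s3, v s ^ 2 ≤ lam * w s ^ 2 := by
      intro s hs
      have := hE s hs
      unfold FF at this
      have h2 : 0 ≤ |w s| ^ (p + 1) / (p + 1) := by
        apply div_nonneg (by positivity); linarith
      have h3 := mul_nonneg hlam.le h2
      linarith
    have hws3 : w s3 ^ 2 * Real.exp (-(q * s3)) ≤ 0 := by
      have hlim : Tendsto (fun t => w t ^ 2 * Real.exp (-(q * t))) (𝓝[>] 0) (𝓝 0) := by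
        have h1 : Tendsto (fun t : ℝ => Real.exp (-(q * t))) (𝓝[>] 0) (𝓝 (Real.exp (-(q * 0)))) := by
          apply Tendsto.mono_left _ nhdsWithin_le_nhds
          apply Continuous.tendsto; fun_prop
        have := (hwb.pow 2).mul h1
        simpa [hb] using this
      apply ge_of_tendsto hlim
      filter_upwards [hmem] with t ht
      have hmono := mono_aux' (f := fun t => -(w t ^ 2 * Real.exp (-(q * t)))) ht.2 ?_
      · linarith
      · intro r hr
        have hr' : r ∈ Ioc 0 s3 := ⟨by linarith [ht.1, hr.1], hr.2⟩
        obtain ⟨h1, h2⟩ := hw r (hin r hr')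
        have d3 : HasDerivAt (fun t => Real.exp (-(q * t))) (Real.exp (-(q * r)) * (-q)) r := by
          have := (((hasDerivAt_id r).const_mul q).neg).exp
          refine this.congr_deriv ?_
          simp
        refine ⟨_, ?_, ((h1.pow 2).mul d3).neg⟩
        have e0 := Real.exp_pos (-(q * r))
        have := hvw r hr'
        have k : 0 ≤ q * w r ^ 2 - 2 * w r * v r := by
          rw [hq]; nlinarith [sq_nonneg (w r - v r)]
        refine (mul_nonneg e0.le k).trans (le_of_eq ?_)
        simp; ring
    have hw0 : w s3 ^ 2 = 0 := by
      have e0 := Real.exp_pos (-(q * s3))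
      have := sq_nonneg (w s3)
      by_contra hcon
      have : 0 < w s3 ^ 2 := lt_of_le_of_ne this (Ne.symm hcon)
      nlinarith
    have := hvw s3 ⟨hs3, le_rfl⟩
    rw [hw0, mul_zero] at this
    have hv00 : v s3 ^ 2 = 0 := le_antisymm this (sq_nonneg _)
    exact ⟨pow_eq_zero_iff (two_ne_zero) |>.1 hw0, pow_eq_zero_iff (two_ne_zero) |>.1 hv00⟩

end P7
end Part7
end SphODE

namespace SphODE
section Part8
open Set Filter Topology
section P8

noncomputable def ext (f : ℝ → ℝ) (a b r : ℝ) : ℝ := if r ≤ 0 then a else if Real.pi ≤ r then b else f r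

lemma ext_in {f : ℝ → ℝ} {a b r : ℝ} (hr : r ∈ Ioo 0 Real.pi) : ext f a b r = f r := by
  unfold ext; rw [if_neg (not_le.2 hr.1), if_neg (not_le.2 hr.2)]
lemma ext_l {f : ℝ → ℝ} {a b r : ℝ} (hr : r ≤ 0) : ext f a b r = a := by
  unfold ext; rw [if_pos hr]
lemma ext_r {f : ℝ → ℝ} {a b r : ℝ} (hr : Real.pi ≤ r) : ext f a b r = b := by
  unfold ext; rw [if_neg (not_le.2 (Real.pi_pos.trans_le hr)), if_pos hr]

lemma ext_ev {f : ℝ → ℝ} {a b r : ℝ} (hr : r ∈ Ioo 0 Real.pi) : ext f a b =ᶠ[𝓝 r] f := by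
  filter_upwards [Ioo_mem_nhds hr.1 hr.2] with x hx using ext_in hx

lemma ext_tl {f : ℝ → ℝ} {a b : ℝ} {y : ℝ} (h0 : Tendsto f (𝓝[>] 0) (𝓝 y)) : Tendsto (ext f a b) (𝓝[>] 0) (𝓝 y) := by
  refine h0.congr' ?_
  filter_upwards [Ioo_mem_nhdsGT Real.pi_pos] with x hx using (ext_in hx).symm

lemma ext_tr {f : ℝ → ℝ} {a b : ℝ} {y : ℝ} (h0 : Tendsto f (𝓝[<] Real.pi) (𝓝 y)) : Tendsto (ext f a b) (𝓝[<] Real.pi) (𝓝 y) := by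
  refine h0.congr' ?_
  filter_upwards [Ioo_mem_nhdsLT Real.pi_pos] with x hx using (ext_in hx).symm

lemma ext_cont {f : ℝ → ℝ} {a b : ℝ} (hf : ContinuousOn f (Ioo 0 Real.pi)) (h0 : Tendsto f (𝓝[>] 0) (𝓝 a))
    (h1 : Tendsto f (𝓝[<] Real.pi) (𝓝 b)) : ContinuousOn (ext f a b) (Icc 0 Real.pi) := by
  intro x hx
  rcases eq_or_lt_of_le hx.1 with h | h
  · subst h
    have : ContinuousWithinAt (ext f a b) (Ioi 0) 0 := by
      unfold ContinuousWithinAt; rw [ext_l le_rfl]; exact ext_tl h0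
    exact (continuousWithinAt_Ioi_iff_Ici.1 this).mono Icc_subset_Ici_self
  rcases eq_or_lt_of_le hx.2 with h' | h'
  · subst h'
    have : ContinuousWithinAt (ext f a b) (Iio Real.pi) Real.pi := by
      unfold ContinuousWithinAt; rw [ext_r le_rfl]; exact ext_tr h1
    exact (continuousWithinAt_Iio_iff_Iic.1 this).mono Icc_subset_Iic_self
  · exact ((hf.continuousAt (Ioo_mem_nhds h h')).congr (ext_ev ⟨h, h'⟩).symm).continuousWithinAt

lemma ext_deriv {f f' : ℝ → ℝ} {a b a' b' : ℝ} (hf : ∀ x ∈ Ioo 0 Real.pi, HasDerivAt f (f' x) x) (h0 : Tendsto f (𝓝[>] 0) (𝓝 a))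
    (h1 : Tendsto f (𝓝[<] Real.pi) (𝓝 b)) (h0' : Tendsto f' (𝓝[>] 0) (𝓝 a')) (h1' : Tendsto f' (𝓝[<] Real.pi) (𝓝 b')) :
    HasDerivWithinAt (ext f a b) a' (Ici 0) 0 ∧ HasDerivWithinAt (ext f a b) b' (Iic Real.pi) Real.pi ∧
    ∀ x ∈ Icc 0 Real.pi, HasDerivWithinAt (ext f a b) (ext f' a' b' x) (Icc 0 Real.pi) x := by
  have hc := ext_cont (fun x hx => (hf x hx).continuousAt.continuousWithinAt) h0 h1
  have hd : ∀ x ∈ Ioo 0 Real.pi, HasDerivAt (ext f a b) (f' x) x := fun x hx =>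
    (hf x hx).congr_of_eventuallyEq (ext_ev hx)
  have hdd : DifferentiableOn ℝ (ext f a b) (Ioo 0 Real.pi) := fun x hx => (hd x hx).differentiableAt.differentiableWithinAt
  have e0 : HasDerivWithinAt (ext f a b) a' (Ici 0) 0 := by
    refine hasDerivWithinAt_Ici_of_tendsto_deriv hdd ((hc 0 (left_mem_Icc.2 Real.pi_pos.le)).mono Ioo_subset_Icc_self)
      (Ioo_mem_nhdsGT Real.pi_pos) ?_
    refine h0'.congr' ?_
    filter_upwards [Ioo_mem_nhdsGT Real.pi_pos] with x hx using (hd x hx).deriv.symm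
  have e1 : HasDerivWithinAt (ext f a b) b' (Iic Real.pi) Real.pi := by
    refine hasDerivWithinAt_Iic_of_tendsto_deriv hdd ((hc Real.pi (right_mem_Icc.2 Real.pi_pos.le)).mono Ioo_subset_Icc_self)
      (Ioo_mem_nhdsLT Real.pi_pos) ?_
    refine h1'.congr' ?_
    filter_upwards [Ioo_mem_nhdsLT Real.pi_pos] with x hx using (hd x hx).deriv.symm
  refine ⟨e0, e1, ?_⟩
  intro x hx
  rcases eq_or_lt_of_le hx.1 with h | h
  · subst h
    rw [ext_l le_rfl]; exact e0.mono Icc_subset_Ici_self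
  rcases eq_or_lt_of_le hx.2 with h' | h'
  · subst h'
    rw [ext_r le_rfl]; exact e1.mono Icc_subset_Iic_self
  · rw [ext_in ⟨h, h'⟩]; exact (hd x ⟨h, h'⟩).hasDerivWithinAt

lemma glue {w v g : ℝ → ℝ} {a b c0 c1 : ℝ} (hw : ∀ x ∈ Ioo 0 Real.pi, HasDerivAt w (v x) x)
    (hv : ∀ x ∈ Ioo 0 Real.pi, HasDerivAt v (g x) x) (hg : ContinuousOn g (Ioo 0 Real.pi))
    (w0 : Tendsto w (𝓝[>] 0) (𝓝 a)) (w1 : Tendsto w (𝓝[<] Real.pi) (𝓝 b))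
    (v0 : Tendsto v (𝓝[>] 0) (𝓝 0)) (v1 : Tendsto v (𝓝[<] Real.pi) (𝓝 0))
    (g0 : Tendsto g (𝓝[>] 0) (𝓝 c0)) (g1 : Tendsto g (𝓝[<] Real.pi) (𝓝 c1)) :
    ContDiffOn ℝ 2 (ext w a b) (Icc 0 Real.pi) ∧
    (∀ r ∈ Ioo 0 Real.pi, deriv (ext w a b) r = v r ∧ deriv (deriv (ext w a b)) r = g r) ∧
    deriv (ext w a b) 0 = 0 ∧ deriv (ext w a b) Real.pi = 0 := by
  obtain ⟨e0, e1, e⟩ := ext_deriv hw w0 w1 v0 v1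
  obtain ⟨-, -, d⟩ := ext_deriv hv v0 v1 g0 g1
  have gc := ext_cont hg g0 g1
  have hu : UniqueDiffOn ℝ (Icc 0 Real.pi) := uniqueDiffOn_Icc Real.pi_pos
  have hdv : ∀ r ∈ Ioo 0 Real.pi, deriv (ext w a b) r = v r := fun r hr =>
    ((hw r hr).congr_of_eventuallyEq (ext_ev hr)).deriv
  refine ⟨?_, ?_, ?_, ?_⟩
  · have c1 : ContDiffOn ℝ 1 (ext v 0 0) (Icc 0 Real.pi) := by
      rw [show (1 : WithTop ℕ∞) = 0 + 1 by norm_num, contDiffOn_succ_iff_derivWithin hu]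
      refine ⟨fun x hx => (d x hx).differentiableWithinAt, by simp, ?_⟩
      rw [contDiffOn_zero]
      exact gc.congr fun x hx => (d x hx).derivWithin (hu x hx)
    rw [show (2 : WithTop ℕ∞) = 1 + 1 by norm_num, contDiffOn_succ_iff_derivWithin hu]
    refine ⟨fun x hx => (e x hx).differentiableWithinAt, by simp, ?_⟩
    exact c1.congr fun x hx => (e x hx).derivWithin (hu x hx)
  · intro r hr
    refine ⟨hdv r hr, ?_⟩
    have : deriv (ext w a b) =ᶠ[𝓝 r] v := by
      filter_upwards [Ioo_mem_nhds hr.1 hr.2] with x hx using hdv x hx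
    rw [this.deriv_eq]; exact (hv r hr).deriv
  · have l : HasDerivWithinAt (ext w a b) 0 (Iic 0) 0 :=
      (hasDerivWithinAt_const (0:ℝ) (Iic 0) a).congr (fun x hx => ext_l hx) (ext_l le_rfl)
    have := l.union e0
    rw [Iic_union_Ici, hasDerivWithinAt_univ] at this
    exact this.deriv
  · have l : HasDerivWithinAt (ext w a b) 0 (Ici Real.pi) Real.pi :=
      (hasDerivWithinAt_const (Real.pi) (Ici Real.pi) b).congr (fun x hx => ext_r hx) (ext_r le_rfl)
    have := e1.union l
    rw [Iic_union_Ici, hasDerivWithinAt_univ] at this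
    exact this.deriv

variable {m m' : ℕ} {lam p θ θ' s1 δ C s1' δ' C' ζ : ℝ} {W V : ℝ → ℝ → ℝ}

lemma shoot (hm : 1 ≤ m) (hlam : 0 < lam) (hp : 1 < p) (F : Flow m m' lam p W V) (G : Good m m' lam p θ s1 δ C)
    (hγ : 0 < (p + 1) - (p - 1) * (m + 1) / 2) (k : ℕ) :
    ∃ a, 1 ≤ a ∧ ¬ HasZ (k + 1) (W a) ∧ ∀ b, a < b → HasZ (k + 1) (W b) := by
  obtain ⟨A, hA⟩ := F.manyzeros hm hlam hp G hγ (k + 1)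
  set T : Set ℝ := {a | 1 ≤ a ∧ ¬ HasZ (k + 1) (W a)} with hT
  have h1 : (1:ℝ) ∈ T := by
    refine ⟨le_rfl, ?_⟩
    rintro ⟨S, hS, hz⟩
    have : S.Nonempty := Finset.card_pos.1 (by omega)
    obtain ⟨x, hx⟩ := this
    obtain ⟨hx1, hx2⟩ := hz x hx
    rw [F.one x ⟨hx1.1.le, hx1.2⟩] at hx2
    norm_num at hx2
  have hbdd : BddAbove T := ⟨A, fun a ha => by
    by_contra h; push Not at h
    exact ha.2 (hA a h.le)⟩
  have hge : 1 ≤ sSup T := le_csSup hbdd h1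
  refine ⟨sSup T, hge, ?_, ?_⟩
  · intro hz
    have ev := F.open_zeros hlam hp (by linarith) hz
    obtain ⟨ε, hε, hb⟩ := Metric.eventually_nhds_iff.1 ev
    obtain ⟨a, haT, ha⟩ := exists_lt_of_lt_csSup ⟨1, h1⟩ (show sSup T - ε < sSup T by linarith)
    refine haT.2 (hb ?_)
    rw [Real.dist_eq, abs_lt]
    constructor <;> linarith [le_csSup hbdd haT]
  · intro b hb
    by_contra h
    have : b ∈ T := ⟨by linarith, h⟩
    linarith [le_csSup hbdd this]

lemma HasZ.mono {i j : ℕ} {w : ℝ → ℝ} (h : HasZ j w) (hij : i ≤ j) : HasZ i w := by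
  obtain ⟨S, hS, hz⟩ := h
  obtain ⟨S', h1, h2⟩ := Finset.exists_subset_card_eq (hij.trans hS.ge)
  exact ⟨S', h2, fun x hx => hz x (h1 hx)⟩

lemma core (hm : 1 ≤ m) (hm' : 1 ≤ m') (hlam : 0 < lam) (hp : 1 < p) (F : Flow m m' lam p W V) (G : Good m m' lam p θ s1 δ C)
    (hγ : 0 < (p + 1) - (p - 1) * (m + 1) / 2) (G' : Good m' m lam p θ' s1' δ' C')
    (hζ : 0 < ζ) (hζ1 : ζ ≤ 1) (hsub : ((m' : ℝ) / 2 - 1 / 4) * (p - 1) + 2 * ζ ≤ 2) (k : ℕ) :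
    ∃ a, 1 ≤ a ∧ ¬ HasZ (k + 1) (W a) ∧ HasZ k (W a) ∧ 
      ∃ s3, 0 < s3 ∧ s3 ≤ s1' ∧ ∃ M, ∀ s ∈ Ioc 0 s3, |W a (Real.pi - s)| ≤ M ∧ |-V a (Real.pi - s)| ≤ M * s := by
  obtain ⟨a, ha1, hna, hab⟩ := shoot hm hlam hp F G hγ k
  have hpi := Real.pi_gt_three
  have ha0 : a ≠ 0 := by linarith
  have hs1 := G'.s1le
  have hs0 := G'.s1pos
  have hC := G'.Cpos
  set w : ℝ → ℝ → ℝ := fun b s => W b (Real.pi - s) with hw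
  set v : ℝ → ℝ → ℝ := fun b s => -V b (Real.pi - s) with hv
  have hsol : ∀ b, Sol m' m lam p (w b) (v b) := fun b => (F.sol b).refl
  have hnz : ∀ b, b ≠ 0 → ∀ s ∈ Ioo 0 Real.pi, w b s = 0 → v b s ≠ 0 := by
    intro b hb s hs h0 h1
    exact F.nodz hlam hp hb (Real.pi - s) ⟨by linarith [hs.2], by linarith [hs.1]⟩ h0 (by simpa [hv] using h1)
  have hgt : ∃ᶠ b in 𝓝 a, a < b := by
    have h : ∃ᶠ b in 𝓝[>] a, a < b := by
      apply Filter.Eventually.frequently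
      exact self_mem_nhdsWithin
    exact h.filter_mono nhdsWithin_le_nhds
  refine ⟨a, ha1, hna, ?_, ?_⟩
  · obtain ⟨s2, hs2, hs21, hdis⟩ := G'.disconj hm' hp hlam hζ hζ1 hsub (PP m' lam p θ' (w a) (v a) s1' + C' + 1)
    have hm1 := G'.mono1 (hsol a) hs2 hs21 le_rfl
    have hs2I : s2 ∈ Ioo 0 Real.pi := ⟨hs2, by linarith⟩
    have ev1 := (F.tendPP (θ := θ') hp a m' hs2I).eventually (gt_mem_nhds (show PP m' lam p θ' (w a) (v a) s2 < PP m' lam p θ' (w a) (v a) s1' + C' + 1 by linarith))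
    have ev2 := F.upper_zeros hlam hp ha0 (R := Real.pi - s2) (by linarith) (by linarith)
    have ev3 : ∀ᶠ b in 𝓝 a, b ≠ 0 := (continuousAt_id.eventually_ne ha0)
    obtain ⟨b, hb, hb1, hb2, hb3⟩ := (hgt.and_eventually (ev1.and (ev2.and ev3))).exists
    obtain ⟨S, hS, hSz⟩ := hab b hb
    have hone : (S.filter (fun x => ¬ x ≤ Real.pi - s2)).card ≤ 1 := by
      rw [Finset.card_le_one]
      have key : ∀ x ∈ S, ¬ x ≤ Real.pi - s2 → ∀ y ∈ S, ¬ y ≤ Real.pi - s2 → ¬ x < y := by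
        intro x hx hx2 y hy hy2 hxy
        push Not at hx2 hy2
        refine hdis (w b) (v b) (hsol b) (hnz b hb3) hb1.le (Real.pi - y) (Real.pi - x) ?_ ?_ ?_ ?_ ?_
        · linarith [(hSz y hy).1.2]
        · linarith
        · linarith
        · simp only [hw, sub_sub_cancel]; exact (hSz y hy).2
        · simp only [hw, sub_sub_cancel]; exact (hSz x hx).2
      intro x hx y hy
      rw [Finset.mem_filter] at hx hy
      exact le_antisymm (not_lt.1 (key y hy.1 hy.2 x hx.1 hx.2)) (not_lt.1 (key x hx.1 hx.2 y hy.1 hy.2))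
    have hsum := Finset.card_filter_add_card_filter_not (s := S) (fun x => x ≤ Real.pi - s2)
    refine (hb2 (S.filter (fun x => x ≤ Real.pi - s2)) ?_).mono (by omega)
    intro x hx
    rw [Finset.mem_filter] at hx
    exact ⟨⟨(hSz x hx.1).1.1.le, hx.2⟩, (hSz x hx.1).2⟩
  · by_cases hK : ∀ s ∈ Ioc 0 s1', -(C' + 1) ≤ PP m' lam p θ' (w a) (v a) s
    · exact G'.regular hm' hp hlam hζ hζ1 hsub (hsol a) hK
    · exfalso
      push Not at hK
      obtain ⟨s0, hs0', hlt⟩ := hK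
      have hsI : s0 ∈ Ioo 0 Real.pi := ⟨hs0'.1, by linarith [hs0'.2]⟩
      have ev1 := (F.tendPP (θ := θ') hp a m' hsI).eventually (gt_mem_nhds (show PP m' lam p θ' (w a) (v a) s0 < -C' by linarith))
      have ev2 := F.upper_zeros hlam hp ha0 (R := Real.pi - s0) (by linarith [hsI.2]) (by linarith [hsI.1])
      obtain ⟨b, hb, hb1, hb2⟩ := (hgt.and_eventually (ev1.and ev2)).exists
      obtain ⟨S, hS, hSz⟩ := hab b hb
      apply hna
      rw [← hS]
      apply hb2 S
      intro x hx
      obtain ⟨hx1, hx2⟩ := hSz x hx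
      refine ⟨⟨hx1.1.le, ?_⟩, hx2⟩
      by_contra hcon
      push Not at hcon
      have hm1 := G'.mono1 (hsol b) (s := Real.pi - x) (t := s0) (by linarith [hx1.2]) (by linarith) hs0'.2
      have hwx : w b (Real.pi - x) = 0 := by simp only [hw, sub_sub_cancel]; exact hx2
      have : 0 ≤ PP m' lam p θ' (w b) (v b) (Real.pi - x) := by
        unfold PP
        rw [hwx, FF_zero hp]
        have : 0 ≤ Real.pi - x := by linarith [hx1.2]
        simp only [mul_zero, zero_mul, add_zero]
        positivity
      have hb1 : PP m' lam p θ' (w b) (v b) s0 < -C' := hb1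
      linarith

lemma assemble (hm : 1 ≤ m) (hm' : 1 ≤ m') (hlam : 0 < lam) (hp : 1 < p) (F : Flow m m' lam p W V) (G : Good m m' lam p θ s1 δ C)
    (hγ : 0 < (p + 1) - (p - 1) * (m + 1) / 2) (G' : Good m' m lam p θ' s1' δ' C')
    (hζ : 0 < ζ) (hζ1 : ζ ≤ 1) (hsub : ((m' : ℝ) / 2 - 1 / 4) * (p - 1) + 2 * ζ ≤ 2) (k : ℕ) :
    ∃ u : ℝ → ℝ, ContDiffOn ℝ 2 u (Icc 0 Real.pi) ∧
      (∀ r ∈ Ioo 0 Real.pi, deriv (deriv u) r = -(BB m m' r * deriv u r) - lam * ff p (u r)) ∧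
      deriv u 0 = 0 ∧ deriv u Real.pi = 0 ∧
      {r ∈ Icc (0:ℝ) Real.pi | u r = 0}.Finite ∧ {r ∈ Icc (0:ℝ) Real.pi | u r = 0}.ncard = k := by
  obtain ⟨a, ha1, hna, hk, s3, hs3, hs31, M, hM⟩ := core hm hm' hlam hp F G hγ G' hζ hζ1 hsub k
  have hpi := Real.pi_gt_three
  have ha0 : a ≠ 0 := by linarith
  have hs1 := G'.s1le
  -- right end
  obtain ⟨b, hb1, hb2, ⟨c, hb3⟩, hb4⟩ := endpoint hm' hlam hp (F.sol a).refl hs3 (by linarith)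
    (fun s hs => G'.Bpos s ⟨hs.1, hs.2.trans hs31⟩) hM
  have hb0 : b ≠ 0 := by
    intro h
    obtain ⟨h1, h2⟩ := hb4 h
    exact F.nodz hlam hp ha0 (Real.pi - s3) ⟨by linarith, by linarith⟩ h1 (by simpa using h2)
  have hrefl : Tendsto (fun x : ℝ => Real.pi - x) (𝓝[<] Real.pi) (𝓝[>] 0) := by
    apply tendsto_nhdsWithin_of_tendsto_nhds_of_eventually_within
    · have : Tendsto (fun x : ℝ => Real.pi - x) (𝓝 Real.pi) (𝓝 (Real.pi - Real.pi)) := (continuous_const.sub continuous_id).tendsto _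
      rw [sub_self] at this
      exact this.mono_left nhdsWithin_le_nhds
    · filter_upwards [self_mem_nhdsWithin] with x hx
      have : x < Real.pi := hx
      exact sub_pos.2 this
  have w1 : Tendsto (W a) (𝓝[<] Real.pi) (𝓝 b) := by
    have := hb1.comp hrefl
    simpa [Function.comp_def] using this
  have v1 : Tendsto (V a) (𝓝[<] Real.pi) (𝓝 0) := by
    have := (hb2.comp hrefl).neg
    simpa [Function.comp_def] using this
  have g1 : Tendsto (fun s => -(BB m m' s * V a s) - lam * ff p (W a s)) (𝓝[<] Real.pi) (𝓝 c) := by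
    have := (hb3.comp hrefl)
    simpa [Function.comp_def, BB_refl] using this
  -- left end
  have hwc0 : Tendsto (W a) (𝓝[>] 0) (𝓝 a) := by
    have := (F.wc a 0 ⟨le_rfl, Real.pi_pos⟩)
    have h2 : ContinuousWithinAt (W a) (Ioo 0 Real.pi) 0 := this.mono Ioo_subset_Ico_self
    have h3 : Tendsto (W a) (𝓝[Ioo 0 Real.pi] 0) (𝓝 (W a 0)) := h2
    rwa [nhdsWithin_Ioo_eq_nhdsGT Real.pi_pos, F.w0] at h3
  obtain ⟨Cv, hCv, hvb⟩ := F.vb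
  have hcI : ContinuousOn (W a) (Icc 0 1) := (F.wc a).mono (fun x hx => ⟨hx.1, by linarith [hx.2]⟩)
  obtain ⟨N1, hN1⟩ := isCompact_Icc.exists_bound_of_continuousOn hcI
  obtain ⟨N2, hN2⟩ := isCompact_Icc.exists_bound_of_continuousOn ((ff_cont hp).comp_continuousOn hcI)
  obtain ⟨a', ha1', ha2', ⟨c', ha3'⟩, -⟩ := endpoint (M := max N1 (Cv * N2)) hm hlam hp (F.sol a) G.s1pos G.s1le G.Bpos (by
    intro s hs
    have hs' : s ∈ Icc (0:ℝ) 1 := ⟨hs.1.le, hs.2.trans G.s1le⟩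
    refine ⟨(hN1 s hs').trans (le_max_left _ _), ?_⟩
    have h1 := hvb a N2 s hs' (fun τ hτ => hN2 τ ⟨hτ.1, hτ.2.trans hs'.2⟩)
    calc |V a s| ≤ Cv * s * N2 := h1
      _ = Cv * N2 * s := by ring
      _ ≤ _ := by
        have := hs.1.le
        gcongr; exact le_max_right _ _)
  have hg : ContinuousOn (fun s => -(BB m m' s * V a s) - lam * ff p (W a s)) (Ioo 0 Real.pi) :=
    ((BB_cont m m').mul (F.sol a).contv).neg.sub (((ff_cont hp).comp_continuousOn (F.sol a).contw).const_smul lam)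
  obtain ⟨r1, r2, r3, r4⟩ := glue (fun x hx => (F.sol a x hx).1) (fun x hx => (F.sol a x hx).2) hg hwc0 w1 ha2' v1 ha3' g1
  have hset : {r ∈ Icc (0:ℝ) Real.pi | ext (W a) a b r = 0} = {r | r ∈ Ioo 0 Real.pi ∧ W a r = 0} := by
    ext r
    constructor
    · rintro ⟨hr, h0⟩
      rcases eq_or_lt_of_le hr.1 with h | h
      · rw [ext_l h.ge] at h0; exact absurd h0 ha0
      rcases eq_or_lt_of_le hr.2 with h' | h'
      · rw [ext_r h'.ge] at h0; exact absurd h0 hb0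
      · rw [ext_in ⟨h, h'⟩] at h0; exact ⟨⟨h, h'⟩, h0⟩
    · rintro ⟨hr, h0⟩
      exact ⟨Ioo_subset_Icc_self hr, by rw [ext_in hr]; exact h0⟩
  refine ⟨ext (W a) a b, r1, ?_, r3, r4, ?_⟩
  · intro r hr
    rw [(r2 r hr).1, (r2 r hr).2, ext_in hr]
  rw [hset]
  set Z : Set ℝ := {r | r ∈ Ioo 0 Real.pi ∧ W a r = 0} with hZ
  have hfin : Z.Finite := by
    by_contra hinf
    obtain ⟨S, hS, hc⟩ := Set.Infinite.exists_subset_card_eq hinf (k + 1)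
    exact hna ⟨S, hc, fun x hx => hS hx⟩
  refine ⟨hfin, ?_⟩
  have hcard : Z.ncard = hfin.toFinset.card := Set.ncard_eq_toFinset_card Z hfin
  have hle : Z.ncard ≤ k := by
    by_contra hcon
    push Not at hcon
    refine hna (HasZ.mono (j := Z.ncard) ⟨hfin.toFinset, hcard.symm, fun x hx => ?_⟩ hcon)
    exact hfin.mem_toFinset.1 hx
  obtain ⟨S, hS, hz⟩ := hk
  have hge : S.card ≤ hfin.toFinset.card := Finset.card_le_card (fun x hx => hfin.mem_toFinset.2 (hz x hx))
  omega

end P8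
end Part8
end SphODE

namespace SphODE
section P9
open Set Filter Topology

lemma params {n m : ℕ} (hn : 3 ≤ n) (hmn : m < n - 1) {p : ℝ} (hp : p = ((n : ℝ) + 2) / ((n : ℝ) - 2)) :
    1 < p ∧ (∃ θ : ℝ, ((m : ℝ) - 1) / 2 < θ ∧ θ < (m + 1) / (p + 1)) ∧ 0 < (p + 1) - (p - 1) * (m + 1) / 2 ∧
    ((m : ℝ) / 2 - 1 / 4) * (p - 1) + 2 * (1 / (2 * ((n : ℝ) - 2))) ≤ 2 := by
  have hN : (3 : ℝ) ≤ n := by exact_mod_cast hn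
  have hM : (m : ℝ) + 2 ≤ n := by
    have : m + 2 ≤ n := by omega
    exact_mod_cast this
  have hM0 : (0 : ℝ) ≤ m := by positivity
  set N : ℝ := (n : ℝ)
  set M : ℝ := (m : ℝ)
  have h2 : 0 < N - 2 := by linarith
  have e1 : p - 1 = 4 / (N - 2) := by rw [hp]; field_simp; ring
  have e2 : p + 1 = 2 * N / (N - 2) := by rw [hp]; field_simp; ring
  refine ⟨?_, ?_, ?_, ?_⟩
  · have : 0 < p - 1 := by rw [e1]; positivity
    linarith
  · apply exists_between
    rw [e2, div_div_eq_mul_div, div_lt_div_iff₀ (by norm_num) (by linarith)]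
    nlinarith
  · rw [e1, e2]
    have : 2 * N / (N - 2) - 4 / (N - 2) * (M + 1) / 2 = 2 * (N - 1 - M) / (N - 2) := by field_simp; ring
    rw [this]
    apply div_pos _ h2
    linarith
  · rw [e1]
    have : (M / 2 - 1 / 4) * (4 / (N - 2)) + 2 * (1 / (2 * (N - 2))) = 2 * M / (N - 2) := by field_simp; ring
    rw [this, div_le_iff₀ h2]
    linarith

lemma BB_eq (m m' : ℕ) {r : ℝ} (hr : r ∈ Ioo 0 Real.pi) :
    ((((m : ℝ) + (m' : ℝ)) / 2) * Real.cos r - ((m' : ℝ) - (m : ℝ)) / 2) / Real.sin r = BB m m' r := by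
  obtain ⟨h1, h2⟩ := half_facts hr
  have e1 : Real.sin r = 2 * Real.sin (r / 2) * Real.cos (r / 2) := by
    rw [← Real.sin_two_mul]; congr 1; ring
  have e2 : Real.cos r = Real.cos (r / 2) ^ 2 - Real.sin (r / 2) ^ 2 := by
    rw [← Real.cos_two_mul']; congr 1; ring
  have e3 := Real.sin_sq_add_cos_sq (r / 2)
  unfold BB
  rw [e1, e2]
  field_simp
  linear_combination (((m' : ℝ) - m)) * e3

end P9
end SphODE

/-- Theorem 1.2 (main ODE theorem): for `m₁, m₂ < n-1`, the singular ODE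
`w'' + (h(r)/sin r) w' + λ(|w|^{p-1}w - w) = 0` on `[0,π]` with Neumann boundary
conditions admits, for every positive integer `k`, a solution with exactly `k` zeroes. -/
theorem low_energy_nodal_solutions_sphere_ODE
    (n ℓ m₁ m₂ : ℕ) (hn : 3 ≤ n) (hℓ : 2 ≤ ℓ) (hm₁ : 1 ≤ m₁) (hm₂ : 1 ≤ m₂)
    (hm₁n : m₁ < n - 1) (hm₂n : m₂ < n - 1)
    (hmunzner : ℓ * (m₁ + m₂) = 2 * (n - 1))
    (p lam : ℝ) (hp : p = ((n : ℝ) + 2) / ((n : ℝ) - 2))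
    (hlam : lam = (n : ℝ) * ((n : ℝ) - 2) / (4 * (ℓ : ℝ) ^ 2))
    (h : ℝ → ℝ)
    (hh : ∀ r : ℝ, h r = (((m₁ : ℝ) + (m₂ : ℝ)) / 2) * Real.cos r - ((m₂ : ℝ) - (m₁ : ℝ)) / 2)
    (k : ℕ) (hk : 0 < k) :
    ∃ w : ℝ → ℝ,
      ContDiffOn ℝ 2 w (Set.Icc 0 Real.pi) ∧
      (∀ r ∈ Set.Ioo (0 : ℝ) Real.pi,
        deriv (deriv w) r + (h r / Real.sin r) * deriv w r
          + lam * (|w r| ^ (p - 1) * w r - w r) = 0) ∧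
      deriv w 0 = 0 ∧ deriv w Real.pi = 0 ∧
      {r ∈ Set.Icc (0 : ℝ) Real.pi | w r = 0}.Finite ∧
      {r ∈ Set.Icc (0 : ℝ) Real.pi | w r = 0}.ncard = k := by
  obtain ⟨hp1, ⟨θ, h1, h2⟩, hγ, -⟩ := SphODE.params hn hm₁n hp
  obtain ⟨-, ⟨θ', h1', h2'⟩, -, hsub⟩ := SphODE.params hn hm₂n hp
  have hN : (3 : ℝ) ≤ n := by exact_mod_cast hn
  have hL : (2 : ℝ) ≤ ℓ := by exact_mod_cast hℓ
  have hlam0 : 0 < lam := by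
    rw [hlam]
    have : 0 < (n : ℝ) - 2 := by linarith
    positivity
  obtain ⟨W, V, F⟩ := SphODE.exists_flow m₁ m₂ hlam0 hp1
  obtain ⟨s1, δ, C, G⟩ := SphODE.exists_good m₁ m₂ hm₁ hp1 hlam0 h1 h2
  obtain ⟨s1', δ', C', G'⟩ := SphODE.exists_good m₂ m₁ hm₂ hp1 hlam0 h1' h2'
  have hζ : 0 < 1 / (2 * ((n : ℝ) - 2)) := by
    have : 0 < (n : ℝ) - 2 := by linarith
    positivity
  have hζ1 : 1 / (2 * ((n : ℝ) - 2)) ≤ 1 := by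
    rw [div_le_one (by linarith)]; linarith
  obtain ⟨u, u1, u2, u3, u4, u5, u6⟩ := SphODE.assemble hm₁ hm₂ hlam0 hp1 F G hγ G' hζ hζ1 hsub k
  refine ⟨u, u1, ?_, u3, u4, u5, u6⟩
  intro r hr
  rw [u2 r hr, hh r, SphODE.BB_eq m₁ m₂ hr]
  unfold SphODE.ff
  ring
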